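/- Let ε > 0, P ∈ ℤ[n] with deg P = k ≥ 2 and P(0) = 0, and set M = c·(εN)^{1/k} for a sufficiently small constant c depending on P. Let g, h : ZMod N → ℂ with ‖g‖₂ ≤ 1, ‖h‖₂ ≤ 1 (uniform probability measure) and ‖ĥ‖_∞ ≤ η where 0 < η ≤ ε. Then for any natural number K ≥ C·k²·log k, the number of n ∈ [1,M] with |(1/N)·∑_{x ∈ ZMod N} h(x)·g(x − P(n))| ≥ η^{1/K} is at most C₁·η^{1/K}·M, where C₁ depends only on P. -/

import Mathlib

open Complex

/-- The discrete Fourier transform on `ZMod N`, normalized by `1/N`. -/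
noncomputable def dft (N : ℕ) [NeZero N] (f : ZMod N → ℂ) (ξ : ZMod N) : ℂ :=
  (1 / (N : ℂ)) * ∑ x : ZMod N,
    f x * Complex.exp (-2 * (Real.pi : ℂ) * I * (x.val : ℂ) * (ξ.val : ℂ) / (N : ℂ))

namespace FE
open Finset

/-- additive energy of a map on a finite set -/
def En {τ G : Type*} [DecidableEq G] (T : Finset τ) (v : τ → G) : ℕ :=
  ((T ×ˢ T).filter (fun p => v p.1 = v p.2)).card

theorem En_eq_sum {τ G : Type*} [DecidableEq G] (T : Finset τ) (v : τ → G) :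
    En T v = ∑ t ∈ T, (T.filter (fun t' => v t' = v t)).card := by
  unfold En
  rw [card_filter, sum_product]
  refine sum_congr rfl fun t _ => ?_
  rw [card_filter]
  refine sum_congr rfl fun t' _ => ?_
  simp only [eq_comm]

theorem En_eq_sum_sq {τ G : Type*} [DecidableEq G] (T : Finset τ) (v : τ → G) (U : Finset G)
    (hU : ∀ t ∈ T, v t ∈ U) :
    En T v = ∑ g ∈ U, (T.filter (fun t => v t = g)).card ^ 2 := by
  rw [En_eq_sum, ← sum_fiberwise_of_maps_to hU]
  refine sum_congr rfl fun g _ => ?_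
  rw [sq, ← smul_eq_mul, ← sum_const]
  refine sum_congr rfl fun t ht => ?_
  rw [(mem_filter.1 ht).2]

theorem En_inj {τ τ' G G' : Type*} [DecidableEq G] [DecidableEq G'] (T : Finset τ) (v : τ → G)
    (T' : Finset τ') (v' : τ' → G') (f : τ → τ') (hf : Set.InjOn f T) (hT : ∀ t ∈ T, f t ∈ T')
    (hv : ∀ t ∈ T, ∀ u ∈ T, v t = v u → v' (f t) = v' (f u)) : En T v ≤ En T' v' := by
  unfold En
  refine card_le_card_of_injOn (fun p => (f p.1, f p.2)) ?_ ?_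
  · intro p hp
    simp only [coe_filter, mem_product, Set.mem_ofPred_eq] at hp ⊢
    exact ⟨⟨hT _ hp.1.1, hT _ hp.1.2⟩, hv _ hp.1.1 _ hp.1.2 hp.2⟩
  · intro p hp q hq h
    simp only [coe_filter, mem_product, Set.mem_ofPred_eq] at hp hq
    simp only [Prod.mk.injEq] at h
    exact Prod.ext (hf hp.1.1 hq.1.1 h.1) (hf hp.1.2 hq.1.2 h.2)

theorem En_mono {τ G : Type*} [DecidableEq G] {T T' : Finset τ} (h : T ⊆ T') (v : τ → G) :
    En T v ≤ En T' v :=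
  En_inj T v T' v id (fun _ _ _ _ h => h) (fun _ ht => h ht) (fun _ _ _ _ h => h)

theorem En_diff_one {τ G : Type*} [DecidableEq G] [AddCommGroup G] (T : Finset τ) (v : τ → G)
    (d : G) : ((T ×ˢ T).filter (fun p => v p.1 - v p.2 = d)).card ≤ En T v := by
  classical
  set U : Finset G := T.image v ∪ T.image (fun t => v t + d) with hU
  set r : G → ℕ := fun g => (T.filter (fun t => v t = g)).card with hr
  have h0 : ((T ×ˢ T).filter (fun p => v p.1 - v p.2 = d)).card = ∑ g ∈ U, r g * r (g - d) := by
    rw [card_filter, sum_product]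
    have h1 : ∀ x ∈ T, ∑ y ∈ T, (if v x - v y = d then 1 else 0) = r (v x - d) := by
      intro x _
      rw [hr]; simp only [card_filter]
      refine sum_congr rfl fun y _ => ?_
      congr 1
      apply propext
      constructor
      · intro h; rw [← h]; abel
      · intro h; rw [h]; abel
    rw [sum_congr rfl h1]
    have hm : ∀ t ∈ T, v t ∈ U := fun t ht => by
      rw [hU]; exact mem_union_left _ (mem_image_of_mem _ ht)
    rw [← sum_fiberwise_of_maps_to hm]
    refine sum_congr rfl fun g _ => ?_
    rw [hr]
    simp only
    rw [← smul_eq_mul, ← sum_const]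
    refine sum_congr rfl fun t ht => ?_
    rw [(mem_filter.1 ht).2]
  have hm : ∀ t ∈ T, v t ∈ U := fun t ht => by
    rw [hU]; exact mem_union_left _ (mem_image_of_mem _ ht)
  have e1 : En T v = ∑ g ∈ U, r g ^ 2 := En_eq_sum_sq T v U hm
  have hm2 : ∀ t ∈ T, v t ∈ U.image (fun g => g - d) := fun t ht => by
    refine mem_image.2 ⟨v t + d, ?_, by abel⟩
    rw [hU]; exact mem_union_right _ (mem_image.2 ⟨t, ht, rfl⟩)
  have e2 : En T v = ∑ g ∈ U, r (g - d) ^ 2 := by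
    rw [En_eq_sum_sq T v _ hm2, sum_image]
    intro a _ b _ h
    simpa using h
  rw [h0]
  have : 2 * ∑ g ∈ U, r g * r (g - d) ≤ En T v + En T v := by
    conv_rhs => rw [e1]
    rw [← e1]
    conv_rhs => arg 1; rw [e1]
    conv_rhs => arg 2; rw [e2]
    rw [← sum_add_distrib, mul_sum]
    refine sum_le_sum fun g _ => ?_
    have := two_mul_le_add_sq (r g) (r (g - d))
    nlinarith
  omega

theorem En_diff {τ G : Type*} [DecidableEq G] [AddCommGroup G] (T : Finset τ) (v : τ → G)
    (D : Finset G) : ((T ×ˢ T).filter (fun p => v p.1 - v p.2 ∈ D)).card ≤ D.card * En T v := by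
  classical
  have : (T ×ˢ T).filter (fun p => v p.1 - v p.2 ∈ D) ⊆
      D.biUnion (fun d => (T ×ˢ T).filter (fun p => v p.1 - v p.2 = d)) := by
    intro p hp
    simp only [mem_filter, mem_biUnion] at hp ⊢
    exact ⟨_, hp.2, hp.1, rfl⟩
  refine (card_le_card this).trans (card_biUnion_le.trans ?_)
  rw [← smul_eq_mul, ← sum_const]
  exact sum_le_sum fun d _ => En_diff_one T v d

theorem En_biUnion {τ G ι : Type*} [DecidableEq G] (T : Finset τ) (v : τ → G) (I : Finset ι)
    (S : ι → Finset τ) (h : ∀ t ∈ T, ∃ i ∈ I, t ∈ S i) :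
    En T v ≤ I.card * ∑ i ∈ I, En (S i) v := by
  classical
  set U : Finset G := (T ∪ I.biUnion S).image v with hU
  have hm : ∀ t ∈ T, v t ∈ U := fun t ht => mem_image_of_mem _ (mem_union_left _ ht)
  have hm2 : ∀ i ∈ I, ∀ t ∈ S i, v t ∈ U := fun i hi t ht =>
    mem_image_of_mem _ (mem_union_right _ (mem_biUnion.2 ⟨i, hi, ht⟩))
  rw [En_eq_sum_sq T v U hm, sum_congr rfl (fun i hi => En_eq_sum_sq (S i) v U (hm2 i hi)),
    sum_comm, mul_sum]
  refine sum_le_sum fun g _ => ?_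
  refine le_trans ?_ (sq_sum_le_card_mul_sum_sq)
  refine Nat.pow_le_pow_left ?_ 2
  have : T.filter (fun t => v t = g) ⊆ I.biUnion (fun i => (S i).filter (fun t => v t = g)) := by
    intro t ht
    rw [mem_filter] at ht
    obtain ⟨i, hi, hti⟩ := h t ht.1
    exact mem_biUnion.2 ⟨i, hi, mem_filter.2 ⟨hti, ht.2⟩⟩
  exact (card_le_card this).trans card_biUnion_le

/-- energy by characters -/
theorem En_char {τ G : Type*} [DecidableEq G] [AddCommGroup G] [Finite G] (T : Finset τ)
    (v : τ → G) [Fintype (AddChar G ℂ)]: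
    ((Nat.card G * En T v : ℕ) : ℝ) = ∑ ψ : AddChar G ℂ, ‖∑ t ∈ T, ψ (v t)‖ ^ 2 := by
  classical
  have := Fintype.ofFinite G
  have key : ∀ ψ : AddChar G ℂ, ((‖∑ t ∈ T, ψ (v t)‖ ^ 2 : ℝ) : ℂ) =
      ∑ p ∈ T ×ˢ T, ψ (v p.1 - v p.2) := by
    intro ψ
    push_cast
    rw [← Complex.mul_conj', map_sum, sum_mul_sum, sum_product]
    refine sum_congr rfl fun x _ => sum_congr rfl fun y _ => ?_
    rw [AddChar.map_sub_eq_div, div_eq_mul_inv, ← AddChar.map_neg_eq_inv, AddChar.map_neg_eq_conj]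
  rw [← Complex.ofReal_inj]
  rw [Complex.ofReal_sum, sum_congr rfl (fun ψ _ => key ψ), sum_comm]
  have h2 : ∀ p ∈ T ×ˢ T, ∑ ψ : AddChar G ℂ, ψ (v p.1 - v p.2) =
      if v p.1 = v p.2 then (Nat.card G : ℂ) else 0 := by
    intro p _
    have := AddChar.sum_apply_eq_ite (α := G) (v p.1 - v p.2)
    simp only [sub_eq_zero] at this
    rw [Nat.card_eq_fintype_card, ← this]
    convert rfl
  rw [sum_congr rfl h2, ← sum_filter, sum_const, En]
  push_cast
  rw [nsmul_eq_mul, mul_comm]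

end FE

namespace FE
open Finset

theorem prod_le_sum_pow {s : ℕ} (hs : 0 < s) (a : Fin s → ℝ) (ha : ∀ i, 0 ≤ a i) :
    ∏ i, a i ≤ ∑ i, a i ^ s := by
  have : Nonempty (Fin s) := ⟨⟨0, hs⟩⟩
  obtain ⟨i0, h0⟩ := Finite.exists_max a
  calc ∏ i, a i ≤ ∏ _i : Fin s, a i0 := prod_le_prod (fun i _ => ha i) (fun i _ => h0 i)
    _ = a i0 ^ s := by simp
    _ ≤ ∑ i, a i ^ s := single_le_sum (f := fun i => a i ^ s) (fun i _ => pow_nonneg (ha i) s)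
        (mem_univ i0)

theorem char_prod {τ G : Type*} [AddCommGroup G] {s : ℕ} (T : Finset τ)
    (v : τ → G) (A : Fin s → Finset ℤ) (w : ℤ → G) (ψ : AddChar G ℂ) :
    ∑ p ∈ T ×ˢ Fintype.piFinset A, ψ (v p.1 + ∑ i, w (p.2 i)) =
      (∑ t ∈ T, ψ (v t)) * ∏ i, ∑ x ∈ A i, ψ (w x) := by
  rw [prod_univ_sum, sum_mul_sum, sum_product]
  refine sum_congr rfl fun t _ => sum_congr rfl fun x _ => ?_
  rw [AddChar.map_add_eq_mul]
  congr 1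
  have : ∀ S : Finset (Fin s), ψ (∑ i ∈ S, w (x i)) = ∏ i ∈ S, ψ (w (x i)) := by
    intro S
    induction S using Finset.cons_induction with
    | empty => simp
    | cons a S ha ih => rw [sum_cons, prod_cons, AddChar.map_add_eq_mul, ih]
  exact this univ

theorem Hol_fin {τ G : Type*} [DecidableEq G] [AddCommGroup G] [Finite G] {s : ℕ} (hs : 0 < s)
    (T : Finset τ) (v : τ → G) (A : Fin s → Finset ℤ) (w : ℤ → G) :
    En (T ×ˢ Fintype.piFinset A) (fun p => v p.1 + ∑ i, w (p.2 i)) ≤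
      ∑ j, En (T ×ˢ Fintype.piFinset (fun _ : Fin s => A j))
        (fun p => v p.1 + ∑ i, w (p.2 i)) := by
  classical
  have := Fintype.ofFinite G
  have hG : 0 < Nat.card G := Nat.card_pos
  have h : ((Nat.card G * En (T ×ˢ Fintype.piFinset A)
      (fun p => v p.1 + ∑ i, w (p.2 i)) : ℕ) : ℝ) ≤
      ∑ j, ((Nat.card G * En (T ×ˢ Fintype.piFinset (fun _ : Fin s => A j))
        (fun p => v p.1 + ∑ i, w (p.2 i)) : ℕ) : ℝ) := by
    rw [En_char, sum_congr rfl (fun j _ => En_char _ _), sum_comm]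
    refine sum_le_sum fun ψ _ => ?_
    simp only [char_prod]
    simp only [prod_const, card_univ, Fintype.card_fin, norm_mul, norm_pow, mul_pow, norm_prod]
    rw [← mul_sum]
    refine mul_le_mul_of_nonneg_left ?_ (by positivity)
    rw [← prod_pow]
    refine (prod_le_sum_pow hs _ (fun i => by positivity)).trans (le_of_eq ?_)
    refine sum_congr rfl fun j _ => ?_
    ring
  rw [← Nat.cast_sum, ← mul_sum] at h
  exact Nat.le_of_mul_le_mul_left (by exact_mod_cast h) hG

theorem exists_sep {σ : Type*} {m : ℕ} (U : Finset σ) (u : σ → Fin m → ℤ) :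
    ∃ L : ℕ, L ≠ 0 ∧ ∀ t ∈ U, ∀ t' ∈ U,
      (∀ j, (u t j : ZMod L) = (u t' j : ZMod L)) → u t = u t' := by
  set L : ℕ := 1 + ∑ t ∈ U, ∑ t' ∈ U, ∑ j, (u t j - u t' j).natAbs with hL
  refine ⟨L, by omega, fun t ht t' ht' h => ?_⟩
  funext j
  have h1 := h j
  rw [ZMod.intCast_eq_intCast_iff_dvd_sub] at h1
  have h2 : (u t j - u t' j).natAbs < L := by
    have a1 : (u t j - u t' j).natAbs ≤ ∑ j, (u t j - u t' j).natAbs :=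
      single_le_sum (f := fun j => (u t j - u t' j).natAbs) (fun _ _ => Nat.zero_le _) (mem_univ j)
    have a2 : ∑ j, (u t j - u t' j).natAbs ≤ ∑ t' ∈ U, ∑ j, (u t j - u t' j).natAbs :=
      single_le_sum (f := fun t' => ∑ j, (u t j - u t' j).natAbs) (fun _ _ => Nat.zero_le _) ht'
    have a3 : ∑ t' ∈ U, ∑ j, (u t j - u t' j).natAbs ≤
        ∑ t ∈ U, ∑ t' ∈ U, ∑ j, (u t j - u t' j).natAbs :=
      single_le_sum (f := fun t => ∑ t' ∈ U, ∑ j, (u t j - u t' j).natAbs)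
        (fun _ _ => Nat.zero_le _) ht
    omega
  have h3 : (u t' j - u t j) = 0 := by
    apply Int.eq_zero_of_abs_lt_dvd h1
    rw [abs_sub_comm, Int.abs_eq_natAbs]
    exact_mod_cast h2
  omega

theorem Hol {τ : Type*} {m s : ℕ} (hs : 0 < s)
    (T : Finset τ) (v : τ → Fin m → ℤ) (A : Fin s → Finset ℤ) (w : ℤ → Fin m → ℤ) :
    En (T ×ˢ Fintype.piFinset A) (fun p => v p.1 + ∑ i, w (p.2 i)) ≤
      ∑ j, En (T ×ˢ Fintype.piFinset (fun _ : Fin s => A j))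
        (fun p => v p.1 + ∑ i, w (p.2 i)) := by
  classical
  set U := T ×ˢ Fintype.piFinset (fun _ : Fin s => univ.biUnion A) with hU
  obtain ⟨L, hL, hsep⟩ := exists_sep U (fun p => v p.1 + ∑ i, w (p.2 i))
  have : NeZero L := ⟨hL⟩
  have hsep' : ∀ t ∈ U, ∀ t' ∈ U, ((fun p : τ × (Fin s → ℤ) =>
        (fun j => (v p.1 j : ZMod L)) + ∑ i, (fun j => (w (p.2 i) j : ZMod L))) t =
       (fun p : τ × (Fin s → ℤ) =>
        (fun j => (v p.1 j : ZMod L)) + ∑ i, (fun j => (w (p.2 i) j : ZMod L))) t') ↔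
      (fun p : τ × (Fin s → ℤ) => v p.1 + ∑ i, w (p.2 i)) t =
      (fun p : τ × (Fin s → ℤ) => v p.1 + ∑ i, w (p.2 i)) t' := by
    intro t ht t' ht'
    constructor
    · intro h
      refine hsep t ht t' ht' fun j => ?_
      have := congrFun h j
      simpa using this
    · intro h
      funext j
      have := congrArg (fun z : ℤ => (z : ZMod L)) (congrFun h j)
      simpa using this
  refine le_trans ?_ ((Hol_fin hs T (fun t j => (v t j : ZMod L)) A
    (fun x j => (w x j : ZMod L))).trans (sum_le_sum fun j _ => ?_))
  · refine En_inj _ _ _ _ id (fun _ _ _ _ h => h) (fun _ h => h) ?_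
    intro t ht u hu h
    have hh : ∀ p ∈ T ×ˢ Fintype.piFinset A, p ∈ U := by
      intro p hp
      simp only [hU, mem_product, Fintype.mem_piFinset, mem_biUnion] at hp ⊢
      exact ⟨hp.1, fun i => ⟨i, mem_univ _, hp.2 i⟩⟩
    exact (hsep' t (hh t ht) u (hh u hu)).2 h
  · refine En_inj _ _ _ _ id (fun _ _ _ _ h => h) (fun _ h => h) ?_
    intro t ht u hu h
    have hh : ∀ p ∈ T ×ˢ Fintype.piFinset (fun _ : Fin s => A j), p ∈ U := by
      intro p hp
      simp only [hU, mem_product, Fintype.mem_piFinset, mem_biUnion] at hp ⊢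
      exact ⟨hp.1, fun i => ⟨j, mem_univ _, hp.2 i⟩⟩
    exact (hsep' t (hh t ht) u (hh u hu)).1 h

end FE

namespace FE
open Finset

theorem esymm_eq_of_psum_eq {R : Type*} [CommRing R] {k : ℕ} (x y : Fin k → R)
    (hu : ∀ j : ℕ, 1 ≤ j → j ≤ k → IsUnit (j : R))
    (h : ∀ j : ℕ, 1 ≤ j → j ≤ k → ∑ i, x i ^ j = ∑ i, y i ^ j) :
    ∀ j : ℕ, j ≤ k → MvPolynomial.aeval x (MvPolynomial.esymm (Fin k) R j) =
      MvPolynomial.aeval y (MvPolynomial.esymm (Fin k) R j) := by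
  intro j
  induction j using Nat.strong_induction_on with
  | _ j ih =>
    intro hj
    rcases Nat.eq_zero_or_pos j with rfl | hj0
    · simp
    · have hN := MvPolynomial.mul_esymm_eq_sum (σ := Fin k) (R := R) j
      have hx := congrArg (MvPolynomial.aeval (R := R) x) hN
      have hy := congrArg (MvPolynomial.aeval (R := R) y) hN
      have hps : ∀ (z : Fin k → R) (n : ℕ), MvPolynomial.aeval (R := R) z
          (MvPolynomial.psum (Fin k) R n) = ∑ i, z i ^ n := by
        intro z n; simp [MvPolynomial.psum]
      simp only [map_mul, map_sum, map_pow, map_neg, map_one, map_natCast, hps] at hx hy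
      apply (hu j hj0 hj).mul_left_cancel
      rw [hx, hy]
      congr 1
      refine sum_congr rfl fun a ha => ?_
      rw [mem_filter, HasAntidiagonal.mem_antidiagonal] at ha
      rw [ih a.1 ha.2 (by omega), h a.2 (by omega) (by omega)]

theorem prod_sub_eq {R : Type*} [CommRing R] {k : ℕ} (x : Fin k → R) (t : R) :
    ∏ i, (t - x i) = ∑ j ∈ range (k + 1), (-1) ^ j *
      (MvPolynomial.aeval x (MvPolynomial.esymm (Fin k) R j) * t ^ (k - j)) := by
  have h := Multiset.prod_X_sub_X_eq_sum_esymm (univ.val.map x)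
  have h2 := congrArg (Polynomial.eval t) h
  simp only [Multiset.map_map, Multiset.card_map, Finset.card_val, card_univ,
    Fintype.card_fin, Polynomial.eval_finsetSum] at h2
  have e : (Multiset.map ((fun t => Polynomial.X - Polynomial.C t) ∘ x) (univ : Finset (Fin k)).val).prod
    = ∏ i, (Polynomial.X - Polynomial.C (x i)) := rfl
  rw [e, Polynomial.eval_prod] at h2
  simp only [Polynomial.eval_sub, Polynomial.eval_X, Polynomial.eval_C, Polynomial.eval_mul,
    Polynomial.eval_pow, Polynomial.eval_neg, Polynomial.eval_one] at h2
  rw [h2]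
  refine sum_congr rfl fun j _ => ?_
  rw [MvPolynomial.aeval_esymm_eq_multiset_esymm]

theorem roots_of_psum {p k : ℕ} (hp : p.Prime) (hk : k < p) (hk0 : 0 < k) (x y : Fin k → ℤ)
    (h : ∀ j : ℕ, 1 ≤ j → j ≤ k → ((p ^ k : ℕ) : ℤ) ∣ ∑ i, x i ^ j - ∑ i, y i ^ j)
    (hx : ∀ i i', (p : ℤ) ∣ x i - x i' → i = i') :
    ∀ j, ∃ i, ((p ^ k : ℕ) : ℤ) ∣ y j - x i := by
  intro j
  have hdiv : ((p ^ k : ℕ) : ℤ) ∣ ∏ i, (y j - x i) := by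
    rw [← ZMod.intCast_zmod_eq_zero_iff_dvd _ (p ^ k)] 
    push_cast
    have e := esymm_eq_of_psum_eq (R := ZMod (p ^ k)) (fun i => (x i : ZMod (p ^ k)))
      (fun i => (y i : ZMod (p ^ k))) (fun j h1 h2 => by
        rw [ZMod.isUnit_natCast_iff_not_dvd_pow hp hk0]
        exact fun hd => by have := Nat.le_of_dvd (by omega) hd; omega) (fun j h1 h2 => by
        have := h j h1 h2
        rw [← ZMod.intCast_zmod_eq_zero_iff_dvd _ (p ^ k)] at this
        push_cast at this
        exact sub_eq_zero.1 this)
    have e1 := prod_sub_eq (R := ZMod (p ^ k)) (fun i => (x i : ZMod (p ^ k))) (y j : ZMod (p ^ k))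
    have e2 := prod_sub_eq (R := ZMod (p ^ k)) (fun i => (y i : ZMod (p ^ k))) (y j : ZMod (p ^ k))
    rw [e1]
    rw [sum_congr rfl (fun j hj => by rw [e j (by rw [mem_range] at hj; omega)]), ← e2]
    exact prod_eq_zero (mem_univ j) (sub_self _)
  have hpI : Prime (p : ℤ) := Nat.prime_iff_prime_int.1 hp
  have hpd : (p : ℤ) ∣ ∏ i, (y j - x i) := by
    refine dvd_trans ?_ hdiv
    push_cast
    exact dvd_pow_self _ (by omega)
  obtain ⟨i, _, hi⟩ := (Prime.dvd_finsetProd_iff hpI _).1 hpd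
  refine ⟨i, ?_⟩
  rw [← mul_prod_erase univ _ (mem_univ i)] at hdiv
  refine IsCoprime.dvd_of_dvd_mul_right ?_ hdiv
  push_cast
  apply IsCoprime.pow_left
  rw [Prime.coprime_iff_not_dvd hpI]
  intro hd
  obtain ⟨i', hi', hd'⟩ := (Prime.dvd_finsetProd_iff hpI _).1 hd
  refine (mem_erase.1 hi').1 (hx i' i ?_)
  have := dvd_sub hi hd'
  have e : y j - x i - (y j - x i') = x i' - x i := by ring
  rwa [e] at this

/-- moment vector -/
def mv (k : ℕ) (x : ℤ) : Fin (k + 1) → ℤ := fun j => x ^ (j : ℕ)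

/-- linear functional attached to a polynomial -/
def lin {k : ℕ} (Q : Polynomial ℤ) : (Fin (k + 1) → ℤ) →+ ℤ where
  toFun u := ∑ j : Fin (k + 1), Q.coeff j * u j
  map_zero' := by simp
  map_add' u v := by simp [mul_add, sum_add_distrib]

theorem lin_mv {k : ℕ} (Q : Polynomial ℤ) (hQ : Q.natDegree ≤ k) (x : ℤ) :
    lin Q (mv k x) = Q.eval x := by
  rw [Polynomial.eval_eq_sum_range' (n := k + 1) (by omega), ← Fin.sum_univ_eq_sum_range
    (fun i => Q.coeff i * x ^ i)]
  rfl

/-- Vinogradov count -/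
def J (s k : ℕ) (A : Finset ℤ) : ℕ :=
  En (Fintype.piFinset (fun _ : Fin s => A)) (fun x => ∑ i, mv k (x i))

theorem J_mono {s k : ℕ} {A B : Finset ℤ} (h : A ⊆ B) : J s k A ≤ J s k B :=
  En_mono (Fintype.piFinset_subset _ _ (fun _ => h)) _

theorem J_add_le (s t k : ℕ) (A : Finset ℤ) : J (t + s) k A ≤ A.card ^ (2 * t) * J s k A := by
  set T := Fintype.piFinset (fun _ : Fin s => A)
  set U := Fintype.piFinset (fun _ : Fin t => A)
  have hc : U.card = A.card ^ t := by simp [U]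
  have hJ : J (t + s) k A ≤ ((U ×ˢ U).biUnion (fun u => ((T ×ˢ T).filter
      (fun p => (∑ i, mv k (p.1 i)) - ∑ i, mv k (p.2 i) =
        ∑ i, mv k (u.2 i) - ∑ i, mv k (u.1 i))).image (fun p => (u, p)))).card := by
    unfold J En
    refine card_le_card_of_injOn (fun p => ((fun i => p.1 (Fin.castAdd s i),
      fun i => p.2 (Fin.castAdd s i)), (fun i => p.1 (Fin.natAdd t i),
      fun i => p.2 (Fin.natAdd t i)))) ?_ ?_
    · intro p hp
      simp only [coe_filter, mem_product, Fintype.mem_piFinset, Set.mem_ofPred_eq] at hp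
      simp only [coe_biUnion, Set.mem_iUnion, coe_image, Set.mem_image, mem_coe]
      refine ⟨_, ?_, _, ?_, rfl⟩
      · simp only [U, mem_product, Fintype.mem_piFinset]
        exact ⟨fun i => hp.1.1 _, fun i => hp.1.2 _⟩
      · simp only [T, mem_filter, mem_product, Fintype.mem_piFinset]
        refine ⟨⟨fun i => hp.1.1 _, fun i => hp.1.2 _⟩, ?_⟩
        have := hp.2
        rw [Fin.sum_univ_add, Fin.sum_univ_add] at this
        rw [sub_eq_sub_iff_add_eq_add]
        exact (add_comm _ _).trans this
    · intro p _ q _ h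
      simp only [Prod.mk.injEq] at h
      obtain ⟨⟨h1, h2⟩, h3, h4⟩ := h
      refine Prod.ext ?_ ?_
      · funext i
        induction i using Fin.addCases with
        | left i => exact congrFun h1 i
        | right i => exact congrFun h3 i
      · funext i
        induction i using Fin.addCases with
        | left i => exact congrFun h2 i
        | right i => exact congrFun h4 i
  refine hJ.trans (card_biUnion_le.trans ?_)
  calc _ ≤ ∑ u ∈ U ×ˢ U, J s k A := by
        refine sum_le_sum fun u _ => card_image_le.trans ?_
        exact En_diff_one T (fun x : Fin s → ℤ => ∑ i, mv k (x i)) _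
    _ = _ := by
        rw [sum_const, card_product, hc, smul_eq_mul]; ring

theorem J_pos_le (s k : ℕ) (A : Finset ℤ) : J s k A ≤ A.card ^ (2 * s) := by
  have := J_add_le 0 s k A
  simp only [add_zero] at this
  refine this.trans ?_
  have h0 : J 0 k A ≤ 1 := by
    unfold J En
    refine (card_filter_le _ _).trans ?_
    simp
  calc _ ≤ A.card ^ (2 * s) * 1 := Nat.mul_le_mul_left _ h0
    _ = _ := by ring

/-- affine invariance -/
theorem J_residue (s k X p : ℕ) (hp : 0 < p) (r : ZMod p) :
    J s k ((Icc (1 : ℤ) X).filter (fun x : ℤ => (x : ZMod p) = r)) ≤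
      J s k (Icc (1 : ℤ) ((X / p + 1 : ℕ) : ℤ)) := by
  have : NeZero p := ⟨by omega⟩
  have hrep : ∀ x ∈ ((Icc (1 : ℤ) X).filter (fun x : ℤ => (x : ZMod p) = r)),
      (p : ℤ) * (x / p + 1) = x - r.val + p := by
    intro x hx
    have h := (mem_filter.1 hx).2
    have h2 : (x % p : ℤ) = r.val := by
      rw [← h, ZMod.val_intCast]
    have := Int.mul_ediv_add_emod x p
    rw [h2] at this
    linarith
  refine En_inj _ _ _ _ (fun x i => x i / p + 1) ?_ ?_ ?_
  · intro x hx y hy h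
    simp only [Fintype.coe_piFinset, Set.mem_pi, mem_coe] at hx hy
    funext i
    have h1 := hrep _ (hx i (Set.mem_univ _))
    have h2 := hrep _ (hy i (Set.mem_univ _))
    have h3 := congrFun h i
    simp only at h3
    rw [h3] at h1
    linarith
  · intro x hx
    rw [Fintype.mem_piFinset] at hx ⊢
    intro i
    have := mem_Icc.1 (mem_filter.1 (hx i)).1
    rw [mem_Icc]
    push_cast
    have a1 : 0 ≤ x i / (p : ℤ) := Int.ediv_nonneg (by omega) (by omega)
    have a2 : x i / (p : ℤ) ≤ (X : ℤ) / p := Int.ediv_le_ediv (by omega) this.2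
    constructor <;> omega
  · intro x hx y hy h
    rw [Fintype.mem_piFinset] at hx hy
    funext j
    simp only [Finset.sum_apply]
    have hp0 : (p : ℤ) ^ (j : ℕ) ≠ 0 := pow_ne_zero _ (by omega)
    apply mul_left_cancel₀ hp0
    rw [mul_sum, mul_sum]
    set Q : Polynomial ℤ := (Polynomial.X + Polynomial.C ((p : ℤ) - r.val)) ^ (j : ℕ) with hQ
    have hQd : Q.natDegree ≤ k := by
      rw [hQ, Polynomial.natDegree_pow, Polynomial.natDegree_X_add_C]
      have := j.2
      omega
    have e : ∀ z ∈ ((Icc (1 : ℤ) X).filter (fun x : ℤ => (x : ZMod p) = r)),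
        (p : ℤ) ^ (j : ℕ) * mv k (z / p + 1) j = lin Q (mv k z) := by
      intro z hz
      rw [lin_mv Q hQd, mv, ← mul_pow, hrep z hz, hQ]
      simp only [Polynomial.eval_pow, Polynomial.eval_add, Polynomial.eval_X, Polynomial.eval_C]
      congr 1; ring
    rw [sum_congr rfl (fun i _ => e _ (hx i)), sum_congr rfl (fun i _ => e _ (hy i)),
      ← map_sum, ← map_sum, h]

end FE

namespace FE
open Finset

theorem exists_perm {k s : ℕ} (ι : Fin k → Fin (k + s)) (hι : Function.Injective ι) :
    ∃ σ : Fin (k + s) ≃ Fin (k + s), ∀ i, σ (Fin.castAdd s i) = ι i := by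
  classical
  have h := Finset.exists_equiv_extend_of_card_eq (α := Fin (k + s)) (β := Fin (k + s))
    (t := univ) (by simp) (s := univ.image (Fin.castAdd s))
    (f := fun j => if h : (j : ℕ) < k then ι ⟨j, h⟩ else j) (by simp) (by
      intro a ha b hb hab
      simp only [coe_image, coe_univ, Set.image_univ, Set.mem_range] at ha hb
      obtain ⟨a, rfl⟩ := ha
      obtain ⟨b, rfl⟩ := hb
      simp only [Fin.val_castAdd, Fin.is_lt, dite_true, Fin.eta] at hab
      rw [hι hab])
  obtain ⟨g, hg⟩ := h
  refine ⟨g.trans (Equiv.subtypeUnivEquiv (by simp)), fun i => ?_⟩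
  have := hg (Fin.castAdd s i) (mem_image_of_mem _ (mem_univ _))
  simpa using this

theorem card_fewvals {b k p : ℕ} [NeZero p] (hk : 2 ≤ k) :
    ((univ : Finset (Fin b → ZMod p)).filter
      (fun ρ => ¬ ∃ ι : Fin k → Fin b, Function.Injective (ρ ∘ ι))).card ≤
      (k - 1) ^ b * p ^ (k - 1) := by
  classical
  have hsub : (univ : Finset (Fin b → ZMod p)).filter
      (fun ρ => ¬ ∃ ι : Fin k → Fin b, Function.Injective (ρ ∘ ι)) ⊆
      (univ : Finset ((Fin b → Fin (k - 1)) × (Fin (k - 1) → ZMod p))).image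
        (fun q => q.2 ∘ q.1) := by
    intro ρ hρ
    have hρ := (mem_filter.1 hρ).2
    rw [mem_image]
    set S := univ.image ρ with hS
    have hcard : S.card ≤ k - 1 := by
      by_contra hcon
      apply hρ
      obtain ⟨S', hS', hc⟩ := exists_subset_card_eq (show k ≤ S.card by omega)
      let e : Fin k ≃ S' := (S'.equivFinOfCardEq hc).symm
      have hpre : ∀ i : Fin k, ∃ j, ρ j = (e i : ZMod p) := fun i => by
        have := hS' (e i).2
        rw [hS, mem_image] at this
        obtain ⟨j, _, hj⟩ := this
        exact ⟨j, hj⟩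
      choose ι hι using hpre
      refine ⟨ι, fun a c hac => ?_⟩
      simp only [Function.comp_apply, hι] at hac
      exact e.injective (Subtype.ext hac)
    let e : S ≃ Fin S.card := S.equivFin
    refine ⟨(fun i => Fin.castLE hcard (e ⟨ρ i, mem_image_of_mem _ (mem_univ i)⟩),
      fun m => if h : (m : ℕ) < S.card then (e.symm ⟨m, h⟩ : ZMod p) else 0), mem_univ _, ?_⟩
    funext i
    simp
  refine (card_le_card hsub).trans (card_image_le.trans ?_)
  simp [ZMod.card]

theorem Hol' {m s : ℕ} (hs : 0 < s) (A : Fin s → Finset ℤ) (w : ℤ → Fin m → ℤ) :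
    En (Fintype.piFinset A) (fun p => ∑ i, w (p i)) ≤
      ∑ j, En (Fintype.piFinset (fun _ : Fin s => A j)) (fun p => ∑ i, w (p i)) := by
  have h := Hol hs ({()} : Finset Unit) (fun _ => 0) A w
  refine le_trans ?_ (h.trans (sum_le_sum fun j _ => ?_))
  · refine En_inj _ _ _ _ (fun x => ((), x)) (fun x _ y _ h => by simpa using h)
      (fun x hx => by simpa using hx) (fun x _ y _ h => by simpa using h)
  · refine En_inj _ _ _ _ (fun x => x.2) (fun x _ y _ h => Prod.ext rfl h)
      (fun x hx => by simpa using hx) (fun x _ y _ h => by simpa using h)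

theorem cong_count {k p X : ℕ} (hp : p.Prime) (hk : k < p) (hk0 : 0 < k) (hX : X ≤ p ^ k) (r : ℤ)
    (x : Fin k → ℤ) :
    ((Fintype.piFinset (fun _ : Fin k => Icc (1 : ℤ) X)).filter (fun y =>
      Function.Injective (fun i => (y i : ZMod p)) ∧
      ∀ j : ℕ, 1 ≤ j → j ≤ k → ((p ^ j : ℕ) : ℤ) ∣ ∑ i, (y i - r) ^ j - ∑ i, (x i - r) ^ j)).card
      ≤ k ^ k * p ^ (k * (k - 1) / 2) := by
  classical
  set S := (Fintype.piFinset (fun _ : Fin k => Icc (1 : ℤ) X)).filter (fun y =>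
      Function.Injective (fun i => (y i : ZMod p)) ∧
      ∀ j : ℕ, 1 ≤ j → j ≤ k → ((p ^ j : ℕ) : ℤ) ∣ ∑ i, (y i - r) ^ j - ∑ i, (x i - r) ^ j) with hS
  set D : (Fin k → ℤ) → ℕ → ℤ := fun y j => ∑ i, (y i - r) ^ j - ∑ i, (x i - r) ^ j with hD
  set T : Finset (Fin k → ℤ) := Fintype.piFinset (fun j : Fin k =>
    Ico (0 : ℤ) ((p ^ (k - 1 - (j : ℕ)) : ℕ) : ℤ)) with hT
  have hTc : T.card = p ^ (k * (k - 1) / 2) := by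
    rw [hT, Fintype.card_piFinset]
    simp only [Int.card_Ico, sub_zero, Int.toNat_natCast]
    rw [prod_pow_eq_pow_sum, Fin.sum_univ_eq_sum_range (fun j => k - 1 - j) k,
      sum_range_reflect (fun j => j) k, Finset.sum_range_id]
  have hpp : ∀ j : ℕ, (0 : ℤ) < ((p ^ j : ℕ) : ℤ) := fun j => by
    exact_mod_cast pow_pos hp.pos j
  rw [← hTc]
  refine card_le_mul_card_image_of_maps_to (f := fun y (j : Fin k) =>
    (D y (j + 1) / ((p ^ ((j : ℕ) + 1) : ℕ) : ℤ)) % ((p ^ (k - 1 - (j : ℕ)) : ℕ) : ℤ)) ?_ _ ?_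
  · intro y hy
    rw [hT, Fintype.mem_piFinset]
    intro j
    rw [mem_Ico]
    exact ⟨Int.emod_nonneg _ (hpp _).ne', Int.emod_lt_of_pos _ (hpp _)⟩
  · intro t ht
    rcases (S.filter (fun y => (fun (j : Fin k) => (D y (j + 1) / ((p ^ ((j : ℕ) + 1) : ℕ) : ℤ)) %
      ((p ^ (k - 1 - (j : ℕ)) : ℕ) : ℤ)) = t)).eq_empty_or_nonempty with he | ⟨y0, hy0⟩
    · rw [he]; simp
    · obtain ⟨hy0S, hy0t⟩ := mem_filter.1 hy0
      obtain ⟨hy0X, hy0i, hy0d⟩ := mem_filter.1 hy0S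
      rw [Fintype.mem_piFinset] at hy0X
      have hsub : (S.filter (fun y => (fun (j : Fin k) =>
          (D y (j + 1) / ((p ^ ((j : ℕ) + 1) : ℕ) : ℤ)) %
          ((p ^ (k - 1 - (j : ℕ)) : ℕ) : ℤ)) = t)) ⊆
          Fintype.piFinset (fun _ : Fin k => univ.image y0) := by
        intro y hy
        obtain ⟨hyS, hyt⟩ := mem_filter.1 hy
        obtain ⟨hyX, hyi, hyd⟩ := mem_filter.1 hyS
        rw [Fintype.mem_piFinset] at hyX
        have hroots := roots_of_psum hp hk hk0 (fun i => y0 i - r) (fun i => y i - r) (by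
          intro j h1 h2
          obtain ⟨j, rfl⟩ : ∃ j', j = j' + 1 := ⟨j - 1, by omega⟩
          have ht' := congrFun (hy0t.trans hyt.symm) ⟨j, by omega⟩
          simp only at ht'
          have hd := Int.ModEq.dvd (Int.ModEq.symm ht')
          have e1 := Int.mul_ediv_cancel' (hy0d (j + 1) h1 h2)
          have e2 := Int.mul_ediv_cancel' (hyd (j + 1) h1 h2)
          have := mul_dvd_mul_left ((p ^ (j + 1) : ℕ) : ℤ) hd
          rw [mul_sub] at this
          simp only [hD] at this
          rw [e1, e2] at this
          rw [← Nat.cast_mul, ← pow_add, show j + 1 + (k - 1 - j) = k by omega] at this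
          have e : ∑ i, (y0 i - r) ^ (j + 1) - ∑ i, (x i - r) ^ (j + 1) -
            (∑ i, (y i - r) ^ (j + 1) - ∑ i, (x i - r) ^ (j + 1)) =
            ∑ i, (y0 i - r) ^ (j + 1) - ∑ i, (y i - r) ^ (j + 1) := by ring
          rwa [e] at this) (by
          intro i i' hd
          apply hy0i
          simp only
          rw [ZMod.intCast_eq_intCast_iff_dvd_sub]
          rw [← dvd_neg]
          have e : -(y0 i' - y0 i) = y0 i - r - (y0 i' - r) := by ring
          rwa [e])
        rw [Fintype.mem_piFinset]
        intro j
        obtain ⟨i, hi⟩ := hroots j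
        rw [mem_image]
        refine ⟨i, mem_univ _, ?_⟩
        have e : y j - r - (y0 i - r) = y j - y0 i := by ring
        rw [e] at hi
        have b1 := mem_Icc.1 (hyX j)
        have b2 := mem_Icc.1 (hy0X i)
        have hX' : (X : ℤ) ≤ ((p ^ k : ℕ) : ℤ) := by exact_mod_cast hX
        have := Int.eq_zero_of_abs_lt_dvd hi (by rw [abs_lt]; constructor <;> linarith)
        linarith
      refine (card_le_card hsub).trans ?_
      rw [Fintype.card_piFinset]
      simp only [prod_const, card_univ, Fintype.card_fin]
      exact Nat.pow_le_pow_left (card_image_le.trans (by simp)) _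

end FE

namespace FE
open Finset

theorem En_HA {k s p X : ℕ} (hp : p.Prime) (hk : k < p) (hk0 : 0 < k) (hX : X ≤ p ^ k)
    (r : ZMod p) :
    En (((Fintype.piFinset (fun _ : Fin k => Icc (1 : ℤ) X)).filter
        (fun y => Function.Injective (fun i => (y i : ZMod p)))) ×ˢ
      Fintype.piFinset (fun _ : Fin s => (Icc (1 : ℤ) X).filter (fun x : ℤ => (x : ZMod p) = r)))
      (fun q => ∑ i, mv k (q.1 i) + ∑ i, mv k (q.2 i)) ≤
    X ^ k * (k ^ k * p ^ (k * (k - 1) / 2)) * J s k (Icc (1 : ℤ) ((X / p + 1 : ℕ) : ℤ)) := by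
  classical
  have : NeZero p := ⟨hp.ne_zero⟩
  set H := ((Fintype.piFinset (fun _ : Fin k => Icc (1 : ℤ) X)).filter
        (fun y => Function.Injective (fun i => (y i : ZMod p)))) with hH
  set R := Fintype.piFinset (fun _ : Fin s => (Icc (1 : ℤ) X).filter
    (fun x : ℤ => (x : ZMod p) = r)) with hR
  set JZ := J s k (Icc (1 : ℤ) ((X / p + 1 : ℕ) : ℤ)) with hJZ
  set C := (H ×ˢ H).filter (fun q => ∀ j : ℕ, 1 ≤ j → j ≤ k →
    ((p ^ j : ℕ) : ℤ) ∣ ∑ i, (q.2 i - (r.val : ℤ)) ^ j - ∑ i, (q.1 i - (r.val : ℤ)) ^ j) with hC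
  have hCc : C.card ≤ X ^ k * (k ^ k * p ^ (k * (k - 1) / 2)) := by
    have hsub : C ⊆ H.biUnion (fun x => (((Fintype.piFinset (fun _ : Fin k => Icc (1 : ℤ) X)).filter
      (fun y => Function.Injective (fun i => (y i : ZMod p)) ∧
      ∀ j : ℕ, 1 ≤ j → j ≤ k → ((p ^ j : ℕ) : ℤ) ∣ ∑ i, (y i - (r.val : ℤ)) ^ j -
        ∑ i, (x i - (r.val : ℤ)) ^ j)).image (fun y => (x, y)))) := by
      rintro ⟨x, y⟩ h
      rw [hC, mem_filter, mem_product] at h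
      obtain ⟨⟨hx, hy⟩, hc⟩ := h
      rw [mem_biUnion]
      refine ⟨x, hx, mem_image.2 ⟨y, ?_, rfl⟩⟩
      simp only at hy
      rw [hH, mem_filter] at hy
      exact mem_filter.2 ⟨hy.1, hy.2, hc⟩
    refine (card_le_card hsub).trans (card_biUnion_le.trans ?_)
    have hHc : H.card ≤ X ^ k := by
      refine (card_filter_le _ _).trans ?_
      rw [Fintype.card_piFinset]
      simp
    refine (sum_le_sum fun x _ => card_image_le.trans (cong_count hp hk hk0 hX _ x)).trans ?_
    rw [sum_const, smul_eq_mul]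
    exact Nat.mul_le_mul_right _ hHc
  have hcover : En (H ×ˢ R) (fun q => ∑ i, mv k (q.1 i) + ∑ i, mv k (q.2 i)) ≤
      (C.biUnion (fun c => ((R ×ˢ R).filter (fun u => ∑ i, mv k (u.1 i) - ∑ i, mv k (u.2 i) =
        ∑ i, mv k (c.2 i) - ∑ i, mv k (c.1 i))).image (fun u => (c, u)))).card := by
    unfold En
    refine card_le_card_of_injOn (fun q => ((q.1.1, q.2.1), (q.1.2, q.2.2))) ?_ ?_
    · rintro ⟨⟨x, u⟩, ⟨y, w⟩⟩ h
      simp only [coe_filter, mem_product, Set.mem_ofPred_eq] at h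
      obtain ⟨⟨⟨hx, hu⟩, hy, hw⟩, he⟩ := h
      rw [mem_coe, mem_biUnion]
      refine ⟨(x, y), ?_, mem_image.2 ⟨(u, w), ?_, rfl⟩⟩
      · rw [hC, mem_filter, mem_product]
        refine ⟨⟨hx, hy⟩, fun j h1 h2 => ?_⟩
        simp only
        set Q : Polynomial ℤ := (Polynomial.X + Polynomial.C (-(r.val : ℤ))) ^ j with hQ
        have hQd : Q.natDegree ≤ k := by
          rw [hQ, Polynomial.natDegree_pow, Polynomial.natDegree_X_add_C]
          omega
        have ev : ∀ z : ℤ, lin Q (mv k z) = (z - r.val) ^ j := fun z => by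
          rw [lin_mv Q hQd, hQ]
          simp only [Polynomial.eval_pow, Polynomial.eval_add, Polynomial.eval_X, Polynomial.eval_C, sub_eq_add_neg]
        have h3 := congrArg (lin Q) he
        simp only [map_add, map_sum, ev] at h3
        have h4 : ∑ i, (y i - (r.val : ℤ)) ^ j - ∑ i, (x i - (r.val : ℤ)) ^ j =
          ∑ i, (u i - (r.val : ℤ)) ^ j - ∑ i, (w i - (r.val : ℤ)) ^ j := by linarith
        rw [h4]
        have hdv : ∀ z ∈ (Icc (1 : ℤ) X).filter (fun x : ℤ => (x : ZMod p) = r),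
            ((p ^ j : ℕ) : ℤ) ∣ (z - r.val) ^ j := by
          intro z hz
          rw [Nat.cast_pow]
          apply pow_dvd_pow_of_dvd
          rw [← ZMod.intCast_zmod_eq_zero_iff_dvd]
          push_cast
          rw [(mem_filter.1 hz).2]
          simp
        rw [hR, Fintype.mem_piFinset] at hu hw
        exact dvd_sub (dvd_sum fun i _ => hdv _ (hu i)) (dvd_sum fun i _ => hdv _ (hw i))
      · rw [mem_filter, mem_product]
        refine ⟨⟨hu, hw⟩, ?_⟩
        rw [sub_eq_sub_iff_add_eq_add]
        exact (add_comm _ _).trans he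
    · rintro ⟨⟨x, u⟩, ⟨y, w⟩⟩ _ ⟨⟨x', u'⟩, ⟨y', w'⟩⟩ _ h
      simp only [Prod.mk.injEq] at h ⊢
      tauto
  refine hcover.trans (card_biUnion_le.trans ?_)
  have hb : ∀ c ∈ C, (((R ×ˢ R).filter (fun u => ∑ i, mv k (u.1 i) - ∑ i, mv k (u.2 i) =
        ∑ i, mv k (c.2 i) - ∑ i, mv k (c.1 i))).image (fun u => (c, u))).card ≤ JZ := by
    intro c _
    refine card_image_le.trans ((En_diff_one R (fun x : Fin s → ℤ => ∑ i, mv k (x i)) _).trans ?_)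
    exact J_residue s k X p hp.pos r
  refine (sum_le_sum hb).trans ?_
  rw [sum_const, smul_eq_mul]
  exact Nat.mul_le_mul_right _ hCc

theorem En_HA' {k s p X : ℕ} (hs : 0 < s) (hp : p.Prime) (hk : k < p) (hk0 : 0 < k)
    (hX : X ≤ p ^ k) :
    En (((Fintype.piFinset (fun _ : Fin k => Icc (1 : ℤ) X)).filter
        (fun y => Function.Injective (fun i => (y i : ZMod p)))) ×ˢ
      Fintype.piFinset (fun _ : Fin s => (Icc (1 : ℤ) X)))
      (fun q => ∑ i, mv k (q.1 i) + ∑ i, mv k (q.2 i)) ≤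
    p ^ (2 * s) * s * (X ^ k * (k ^ k * p ^ (k * (k - 1) / 2)) *
      J s k (Icc (1 : ℤ) ((X / p + 1 : ℕ) : ℤ))) := by
  classical
  have : NeZero p := ⟨hp.ne_zero⟩
  set H := ((Fintype.piFinset (fun _ : Fin k => Icc (1 : ℤ) X)).filter
        (fun y => Function.Injective (fun i => (y i : ZMod p)))) with hH
  set B := X ^ k * (k ^ k * p ^ (k * (k - 1) / 2)) * J s k (Icc (1 : ℤ) ((X / p + 1 : ℕ) : ℤ))
  refine (En_biUnion _ _ (univ : Finset (Fin s → ZMod p)) (fun ρ => H ×ˢ Fintype.piFinset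
    (fun i => (Icc (1 : ℤ) X).filter (fun x : ℤ => (x : ZMod p) = ρ i))) ?_).trans ?_
  · rintro ⟨x, y⟩ h
    rw [mem_product] at h
    refine ⟨fun i => (y i : ZMod p), mem_univ _, mem_product.2 ⟨h.1, ?_⟩⟩
    have h2 := h.2
    rw [Fintype.mem_piFinset] at h2 ⊢
    intro i
    exact mem_filter.2 ⟨h2 i, rfl⟩
  · have hb : ∀ ρ ∈ (univ : Finset (Fin s → ZMod p)), En (H ×ˢ Fintype.piFinset
        (fun i => (Icc (1 : ℤ) X).filter (fun x : ℤ => (x : ZMod p) = ρ i)))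
        (fun q => ∑ i, mv k (q.1 i) + ∑ i, mv k (q.2 i)) ≤ s * B := by
      intro ρ _
      refine (Hol hs H (fun x => ∑ i, mv k (x i)) _ (mv k)).trans ?_
      refine (sum_le_sum fun j _ => En_HA hp hk hk0 hX (ρ j)).trans ?_
      simp [B]
    refine (Nat.mul_le_mul_left _ (sum_le_sum hb)).trans (le_of_eq ?_)
    simp only [sum_const, card_univ, Fintype.card_pi, ZMod.card, prod_const, Fintype.card_fin,
      smul_eq_mul]
    ring

theorem En_TB {k b p X : ℕ} (hb : 0 < b) (hp : p.Prime) (hk : 2 ≤ k) :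
    En ((Fintype.piFinset (fun _ : Fin b => Icc (1 : ℤ) X)).filter
        (fun y => ¬ ∃ ι : Fin k → Fin b, Function.Injective (fun i => (y (ι i) : ZMod p))))
      (fun x => ∑ i, mv k (x i)) ≤
    ((k - 1) ^ b * p ^ (k - 1)) ^ 2 * (b * J b k (Icc (1 : ℤ) ((X / p + 1 : ℕ) : ℤ))) := by
  classical
  have : NeZero p := ⟨hp.ne_zero⟩
  set JZ := J b k (Icc (1 : ℤ) ((X / p + 1 : ℕ) : ℤ))
  set I := (univ : Finset (Fin b → ZMod p)).filter
      (fun ρ => ¬ ∃ ι : Fin k → Fin b, Function.Injective (ρ ∘ ι)) with hI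
  have hIc := card_fewvals (b := b) (k := k) (p := p) hk
  rw [← hI] at hIc
  refine (En_biUnion _ _ I (fun ρ => Fintype.piFinset
    (fun i => (Icc (1 : ℤ) X).filter (fun x : ℤ => (x : ZMod p) = ρ i))) ?_).trans ?_
  · intro y h
    rw [mem_filter] at h
    refine ⟨fun i => (y i : ZMod p), mem_filter.2 ⟨mem_univ _, h.2⟩, ?_⟩
    have h2 := h.1
    rw [Fintype.mem_piFinset] at h2 ⊢
    intro i
    exact mem_filter.2 ⟨h2 i, rfl⟩
  · have hb : ∀ ρ ∈ I, En (Fintype.piFinset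
        (fun i => (Icc (1 : ℤ) X).filter (fun x : ℤ => (x : ZMod p) = ρ i)))
        (fun x => ∑ i, mv k (x i)) ≤ b * JZ := by
      intro ρ _
      refine (Hol' hb _ (mv k)).trans ?_
      refine (sum_le_sum fun j _ => J_residue b k X p hp.pos (ρ j)).trans ?_
      simp [JZ]
    refine (Nat.mul_le_mul_left _ (sum_le_sum hb)).trans ?_
    rw [sum_const, smul_eq_mul, ← mul_assoc, ← sq]
    exact Nat.mul_le_mul_right _ (Nat.pow_le_pow_left hIc 2)

theorem J_step {k s p X : ℕ} (hs : 0 < s) (hp : p.Prime) (hkp : k < p) (hk : 2 ≤ k)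
    (hX : X ≤ p ^ k) :
    J (k + s) k (Icc (1 : ℤ) X) ≤
    2 * (((k + s) ^ k) ^ 2 * (p ^ (2 * s) * s * (X ^ k * (k ^ k * p ^ (k * (k - 1) / 2)) *
      J s k (Icc (1 : ℤ) ((X / p + 1 : ℕ) : ℤ)))) +
     ((k - 1) ^ (k + s) * p ^ (k - 1)) ^ 2 *
      ((k + s) * J (k + s) k (Icc (1 : ℤ) ((X / p + 1 : ℕ) : ℤ)))) := by
  classical
  have : NeZero p := ⟨hp.ne_zero⟩
  set T := Fintype.piFinset (fun _ : Fin (k + s) => Icc (1 : ℤ) X) with hT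
  set TB := T.filter
    (fun y => ¬ ∃ ι : Fin k → Fin (k + s), Function.Injective (fun i => (y (ι i) : ZMod p))) with hTB
  set TA := T.filter
    (fun y => ∃ ι : Fin k → Fin (k + s), Function.Injective (fun i => (y (ι i) : ZMod p))) with hTA
  have hA : En TA (fun x => ∑ i, mv k (x i)) ≤ ((k + s) ^ k) ^ 2 *
      (p ^ (2 * s) * s * (X ^ k * (k ^ k * p ^ (k * (k - 1) / 2)) *
      J s k (Icc (1 : ℤ) ((X / p + 1 : ℕ) : ℤ)))) := by
    refine (En_biUnion _ _ (univ : Finset (Fin k → Fin (k + s))) (fun ι => T.filter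
      (fun y => Function.Injective (fun i => (y (ι i) : ZMod p)))) ?_).trans ?_
    · intro y hy
      rw [hTA, mem_filter] at hy
      obtain ⟨hy, ι, hι⟩ := hy
      exact ⟨ι, mem_univ _, mem_filter.2 ⟨hy, hι⟩⟩
    · have hb : ∀ ι ∈ (univ : Finset (Fin k → Fin (k + s))), En (T.filter
        (fun y => Function.Injective (fun i => (y (ι i) : ZMod p)))) (fun x => ∑ i, mv k (x i)) ≤
        p ^ (2 * s) * s * (X ^ k * (k ^ k * p ^ (k * (k - 1) / 2)) *
        J s k (Icc (1 : ℤ) ((X / p + 1 : ℕ) : ℤ))) := by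
        intro ι _
        by_cases hι : Function.Injective ι
        · refine le_trans ?_ (En_HA' hs hp hkp (by omega) hX)
          obtain ⟨σ, hσ⟩ := exists_perm ι hι
          refine En_inj _ _ _ _ (fun x => (fun i => x (σ (Fin.castAdd s i)),
            fun i => x (σ (Fin.natAdd k i)))) ?_ ?_ ?_
          · intro x _ y _ h
            simp only [Prod.mk.injEq] at h
            funext i
            obtain ⟨j, rfl⟩ := σ.surjective i
            induction j using Fin.addCases with
            | left j => exact congrFun h.1 j
            | right j => exact congrFun h.2 j
          · intro x hx
            rw [mem_filter, hT, Fintype.mem_piFinset] at hx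
            rw [mem_product, mem_filter, Fintype.mem_piFinset, Fintype.mem_piFinset]
            refine ⟨⟨fun i => hx.1 _, ?_⟩, fun i => hx.1 _⟩
            simp only [hσ]
            exact hx.2
          · intro x _ y _ h
            simp only at h ⊢
            have e : ∀ z : Fin (k + s) → ℤ, ∑ i, mv k (z (σ (Fin.castAdd s i))) +
                ∑ i, mv k (z (σ (Fin.natAdd k i))) = ∑ i, mv k (z i) := by
              intro z
              rw [← Equiv.sum_comp σ (fun i => mv k (z i)), Fin.sum_univ_add]
            rw [e, e, h]
        · have : (T.filter (fun y => Function.Injective (fun i => (y (ι i) : ZMod p)))) = ∅ := by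
            rw [filter_eq_empty_iff]
            intro y _ hinj
            apply hι
            intro a b hab
            exact hinj (by simp only [hab])
          rw [this]
          simp [En]
      refine (Nat.mul_le_mul_left _ (sum_le_sum hb)).trans (le_of_eq ?_)
      simp only [sum_const, card_univ, Fintype.card_pi, prod_const, Fintype.card_fin, smul_eq_mul]
      ring
  have hB := En_TB (k := k) (b := k + s) (p := p) (X := X) (by omega) hp hk
  refine (En_biUnion T _ (univ : Finset Bool) (fun b => if b then TA else TB) ?_).trans ?_
  · intro t ht
    by_cases h : ∃ ι : Fin k → Fin (k + s), Function.Injective (fun i => (t (ι i) : ZMod p))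
    · exact ⟨true, mem_univ _, by simp only [if_true]; exact mem_filter.2 ⟨ht, h⟩⟩
    · exact ⟨false, mem_univ _, by simp only [Bool.false_eq_true, if_false]; exact mem_filter.2 ⟨ht, h⟩⟩
  · simp only [Fintype.sum_bool, card_univ, Fintype.card_bool]
    exact Nat.mul_le_mul_left _ (Nat.add_le_add hA hB)

end FE

namespace FE
open Finset

lemma exists_prime_near (k : ℕ) (hk : 2 ≤ k) (X : ℕ) (hX : 1 ≤ X) :
    ∃ p : ℕ, p.Prime ∧ k < p ∧ X ≤ p ^ k ∧ (p : ℝ) ≤ (2 * (k + 2) : ℝ) * (X : ℝ) ^ (1 / (k : ℝ)) := by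
  have hx : (1 : ℝ) ≤ X := by exact_mod_cast hX
  have hk0 : (k : ℝ) ≠ 0 := by positivity
  set u : ℝ := (X : ℝ) ^ (1 / (k : ℝ)) with hu
  have hu1 : 1 ≤ u := Real.one_le_rpow hx (by positivity)
  have huk : u ^ k = X := by
    rw [hu, ← Real.rpow_natCast, ← Real.rpow_mul (by positivity), one_div_mul_cancel hk0, Real.rpow_one]
  obtain ⟨p, hp, h1, h2⟩ := Nat.exists_prime_lt_and_le_two_mul (⌈u⌉₊ + k) (by omega)
  refine ⟨p, hp, by omega, ?_, ?_⟩
  · have h3 : u ≤ p := (Nat.le_ceil u).trans (by exact_mod_cast (by omega : ⌈u⌉₊ ≤ p))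
    have : (X : ℝ) ≤ (p : ℝ) ^ k := by
      rw [← huk]; exact pow_le_pow_left₀ (by linarith) h3 k
    exact_mod_cast this
  · have h3 : (⌈u⌉₊ : ℝ) ≤ u + 1 := (Nat.ceil_lt_add_one (by linarith)).le
    have h4 : (p : ℝ) ≤ 2 * (⌈u⌉₊ + k) := by exact_mod_cast h2
    have : (0 : ℝ) ≤ k := by positivity
    nlinarith

lemma mvt_ring1 (A T x B c y z : ℝ) : A * (T * x * (B * (c * y * z))) = A * B * c * (x * y) * (T * z) := by
  ring

lemma mvt_ring2 (A B c x y d z : ℝ) : A * B * c * (x * y) * (d * z) = A * B * c * d * (x * y * z) := by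
  ring

set_option maxHeartbeats 1000000 in
lemma mvt_step (k s : ℕ) (hk : 2 ≤ k) (hs : k ^ 2 ≤ s) (Δ : ℝ) (hΔ0 : 0 ≤ Δ)
    (hΔ : Δ ≤ (k : ℝ) * (k + 1) / 2)
    (h : ∃ B : ℝ, 0 < B ∧ ∀ X : ℕ, 1 ≤ X → (J s k (Icc (1 : ℤ) X) : ℝ) ≤
      B * (X : ℝ) ^ (2 * (s : ℝ) - (k : ℝ) * (k + 1) / 2 + Δ)) :
    ∃ B : ℝ, 0 < B ∧ ∀ X : ℕ, 1 ≤ X → (J (k + s) k (Icc (1 : ℤ) X) : ℝ) ≤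
      B * (X : ℝ) ^ (2 * ((k + s : ℕ) : ℝ) - (k : ℝ) * (k + 1) / 2 + Δ * (1 - 1 / (k : ℝ))) := by
  obtain ⟨B, hB, h⟩ := h
  have hs0 : 0 < s := by nlinarith
  have hk2 : (2 : ℝ) ≤ k := by exact_mod_cast hk
  have hsr : (k : ℝ) ^ 2 ≤ s := by exact_mod_cast hs
  set w := k * (k - 1) / 2 with hw
  have hw2 : (w : ℝ) = (k : ℝ) * (k - 1) / 2 := by
    have : 2 * w = k * (k - 1) := by
      rw [hw, Nat.mul_div_cancel' (Nat.even_mul_pred_self k).two_dvd]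
    have h2 : (2 : ℝ) * w = (k : ℝ) * ((k - 1 : ℕ) : ℝ) := by exact_mod_cast this
    rw [Nat.cast_sub (by omega)] at h2
    push_cast at h2
    linarith
  set e : ℝ := 2 * (s : ℝ) - (k : ℝ) * (k + 1) / 2 + Δ with he
  have he0 : 0 ≤ e := by rw [he]; nlinarith
  set c0 : ℝ := 2 * (k + 2) with hc0
  have hc0' : 1 ≤ c0 := by rw [hc0]; linarith
  set c1 : ℝ := 1 + c0 with hc1
  have hc1' : 0 < c1 := by linarith
  set A1 : ℝ := 2 * (((k + s) ^ k) ^ 2 * (s * k ^ k)) with hA1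
  set A2 : ℝ := 2 * (((k - 1 : ℕ) ^ (k + s)) ^ 2 * (k + s)) with hA2
  have hA1p : 0 ≤ A1 := by positivity
  have hA2p : 0 ≤ A2 := by positivity
  refine ⟨(A1 + A2 * c1 ^ (2 * k)) * B * c1 ^ e * c0 ^ ((k : ℝ) ^ 2 - Δ) + 1, by positivity, ?_⟩
  intro X hX
  have hx : (1 : ℝ) ≤ X := by exact_mod_cast hX
  obtain ⟨p, hp, hkp, hXp, hpu⟩ := exists_prime_near k hk X hX
  have hJ := J_step (k := k) (s := s) (p := p) (X := X) hs0 hp hkp hk hXp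
  set Z := X / p + 1 with hZ
  have hJ2 := J_add_le s k k (Icc (1 : ℤ) Z)
  have hcard : (Icc (1 : ℤ) Z).card = Z := by simp
  rw [hcard] at hJ2
  have hZ1 : 1 ≤ Z := Nat.le_add_left 1 _
  have hJ3 := h Z hZ1
  set j := J s k (Icc (1 : ℤ) Z) with hj
  set u : ℝ := (X : ℝ) ^ (1 / (k : ℝ)) with hu
  have hq : (1 : ℝ) ≤ p := by exact_mod_cast hp.one_lt.le
  have hux : u ≤ X := by
    conv_rhs => rw [← Real.rpow_one (X : ℝ)]
    exact Real.rpow_le_rpow_of_exponent_le hx (by rw [div_le_one (by positivity)]; linarith)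
  have hpZ : (p : ℝ) * Z ≤ c1 * X := by
    have : p * Z ≤ X + p := by
      rw [hZ, mul_add, mul_one]
      exact Nat.add_le_add_right (Nat.mul_div_le X p) p
    have h2 : (p : ℝ) * Z ≤ X + p := by exact_mod_cast this
    have : c0 * u ≤ c0 * X := mul_le_mul_of_nonneg_left hux (by linarith)
    rw [hc1]; linarith
  have hXp' : (X : ℝ) ≤ (p : ℝ) ^ k := by exact_mod_cast hXp
  have hmain : (J (k + s) k (Icc (1 : ℤ) X) : ℝ) ≤
      A1 * (p : ℝ) ^ (2 * s + w) * (X : ℝ) ^ k * j + A2 * ((p : ℝ) ^ (k - 1)) ^ 2 * (Z : ℝ) ^ (2 * k) * j := by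
    have hJ' : J (k + s) k (Icc (1 : ℤ) X) ≤ 2 * (((k+s)^k)^2*(p^(2*s)*s*(X^k*(k^k*p^w)*j)) + ((k-1)^(k+s)*p^(k-1))^2*((k+s)*(Z ^ (2 * k) * j))) :=
      hJ.trans (by gcongr)
    have hJ'' : (J (k + s) k (Icc (1 : ℤ) X) : ℝ) ≤ ((2 * (((k+s)^k)^2*(p^(2*s)*s*(X^k*(k^k*p^w)*j)) + ((k-1)^(k+s)*p^(k-1))^2*((k+s)*(Z ^ (2 * k) * j))) : ℕ) : ℝ) := by exact_mod_cast hJ'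
    refine hJ''.trans (le_of_eq ?_)
    rw [hA1, hA2]
    simp only [Nat.cast_mul, Nat.cast_add, Nat.cast_pow, Nat.cast_ofNat]
    ring
  have hsec : ((p : ℝ) ^ (k - 1)) ^ 2 * (Z : ℝ) ^ (2 * k) ≤ c1 ^ (2 * k) * ((p : ℝ) ^ (2 * s + w) * (X : ℝ) ^ k) := by
    calc ((p : ℝ) ^ (k - 1)) ^ 2 * (Z : ℝ) ^ (2 * k) ≤ (p : ℝ) ^ (2 * k) * (Z : ℝ) ^ (2 * k) := by
          rw [← pow_mul]
          exact mul_le_mul_of_nonneg_right (pow_le_pow_right₀ hq (by omega)) (by positivity)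
      _ = ((p : ℝ) * Z) ^ (2 * k) := by rw [mul_pow]
      _ ≤ (c1 * X) ^ (2 * k) := by gcongr
      _ = c1 ^ (2 * k) * ((X : ℝ) ^ k * (X : ℝ) ^ k) := by rw [mul_pow, two_mul k, pow_add (X : ℝ)]
      _ ≤ c1 ^ (2 * k) * ((p : ℝ) ^ (2 * s + w) * (X : ℝ) ^ k) := by
          gcongr
          calc (X : ℝ) ^ k ≤ ((p : ℝ) ^ k) ^ k := by gcongr
            _ = (p : ℝ) ^ (k ^ 2) := by rw [← pow_mul, sq]
            _ ≤ _ := pow_le_pow_right₀ hq (by omega)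
  have hm2 : (J (k + s) k (Icc (1 : ℤ) X) : ℝ) ≤
      (A1 + A2 * c1 ^ (2 * k)) * ((p : ℝ) ^ (2 * s + w) * (X : ℝ) ^ k * (B * (Z : ℝ) ^ e)) := by
    calc _ ≤ _ := hmain
      _ = A1 * ((p : ℝ) ^ (2 * s + w) * (X : ℝ) ^ k) * j + A2 * (((p : ℝ) ^ (k - 1)) ^ 2 * (Z : ℝ) ^ (2 * k)) * j := by ring
      _ ≤ A1 * ((p : ℝ) ^ (2 * s + w) * (X : ℝ) ^ k) * j + A2 * (c1 ^ (2 * k) * ((p : ℝ) ^ (2 * s + w) * (X : ℝ) ^ k)) * j := by gcongr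
      _ = (A1 + A2 * c1 ^ (2 * k)) * ((p : ℝ) ^ (2 * s + w) * (X : ℝ) ^ k * j) := by ring
      _ ≤ _ := by gcongr
  have hp0 : (0 : ℝ) < p := by linarith
  have hX0 : (0 : ℝ) < X := by linarith
  have hZe : (Z : ℝ) ^ e ≤ c1 ^ e * (X : ℝ) ^ e * (p : ℝ) ^ (-e) := by
    have : (Z : ℝ) ≤ c1 * X * (p : ℝ)⁻¹ := by
      rw [← div_eq_mul_inv, le_div_iff₀ hp0]; linarith
    calc (Z : ℝ) ^ e ≤ (c1 * X * (p : ℝ)⁻¹) ^ e := Real.rpow_le_rpow (by positivity) this he0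
      _ = _ := by
        rw [Real.mul_rpow (by positivity) (by positivity), Real.mul_rpow (by positivity) (by positivity),
          Real.inv_rpow hp0.le, Real.rpow_neg hp0.le]
  have hpe : (p : ℝ) ^ (2 * s + w) * (p : ℝ) ^ (-e) ≤ c0 ^ ((k : ℝ) ^ 2 - Δ) * (X : ℝ) ^ (k - Δ / k) := by
    rw [← Real.rpow_natCast, ← Real.rpow_add hp0]
    have : ((2 * s + w : ℕ) : ℝ) + -e = (k : ℝ) ^ 2 - Δ := by
      push_cast; rw [hw2, he]; ring
    rw [this]
    calc (p : ℝ) ^ ((k : ℝ) ^ 2 - Δ) ≤ (c0 * u) ^ ((k : ℝ) ^ 2 - Δ) :=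
          Real.rpow_le_rpow hp0.le hpu (by nlinarith)
      _ = _ := by
        rw [Real.mul_rpow (by positivity) (by positivity), hu, ← Real.rpow_mul hX0.le]
        congr 2
        field_simp
  have hA : 0 ≤ A1 + A2 * c1 ^ (2 * k) := by positivity
  set A := A1 + A2 * c1 ^ (2 * k) with hAdef
  set T : ℝ := (p : ℝ) ^ (2 * s + w) with hT
  have hT0 : 0 ≤ T := by positivity
  clear_value A T A1 A2 c1 e c0 u j Z w
  calc (J (k + s) k (Icc (1 : ℤ) X) : ℝ) ≤ _ := hm2
    _ ≤ A * (T * (X : ℝ) ^ k * (B * (c1 ^ e * (X : ℝ) ^ e * (p : ℝ) ^ (-e)))) :=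
        mul_le_mul_of_nonneg_left (mul_le_mul_of_nonneg_left (mul_le_mul_of_nonneg_left hZe hB.le) (by positivity)) hA
    _ = A * B * c1 ^ e * ((X : ℝ) ^ k * (X : ℝ) ^ e) * (T * (p : ℝ) ^ (-e)) := mvt_ring1 _ _ _ _ _ _ _
    _ ≤ A * B * c1 ^ e * ((X : ℝ) ^ k * (X : ℝ) ^ e) * (c0 ^ ((k : ℝ) ^ 2 - Δ) * (X : ℝ) ^ (k - Δ / k)) :=
        mul_le_mul_of_nonneg_left hpe (by positivity)
    _ = A * B * c1 ^ e * c0 ^ ((k : ℝ) ^ 2 - Δ) * ((X : ℝ) ^ k * (X : ℝ) ^ e * (X : ℝ) ^ (k - Δ / k)) := mvt_ring2 _ _ _ _ _ _ _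
    _ = A * B * c1 ^ e * c0 ^ ((k : ℝ) ^ 2 - Δ) * ((X : ℝ) ^ (2 * ((k + s : ℕ) : ℝ) - (k : ℝ) * (k + 1) / 2 + Δ * (1 - 1 / (k : ℝ)))) := by
        rw [← Real.rpow_natCast (X : ℝ) k, ← Real.rpow_add hX0, ← Real.rpow_add hX0]
        congr 2
        rw [he]; push_cast; ring
    _ ≤ _ := by
        have : 0 ≤ (X : ℝ) ^ (2 * ((k + s : ℕ) : ℝ) - (k : ℝ) * (k + 1) / 2 + Δ * (1 - 1 / (k : ℝ))) := by positivity
        linarith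

lemma mvt_ind (k : ℕ) (hk : 2 ≤ k) (r : ℕ) :
    ∃ B : ℝ, 0 < B ∧ ∀ X : ℕ, 1 ≤ X → (J (k ^ 2 + r * k) k (Icc (1 : ℤ) X) : ℝ) ≤
      B * (X : ℝ) ^ (2 * ((k ^ 2 + r * k : ℕ) : ℝ) - (k : ℝ) * (k + 1) / 2 + (k : ℝ) * (k + 1) / 2 * (1 - 1 / (k : ℝ)) ^ r) := by
  have hk2 : (2 : ℝ) ≤ k := by exact_mod_cast hk
  have hk1 : 1 / (k : ℝ) ≤ 1 := by rw [div_le_one (by positivity)]; linarith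
  have hk3 : 0 ≤ 1 / (k : ℝ) := by positivity
  induction r with
  | zero =>
    refine ⟨1, one_pos, fun X hX => ?_⟩
    have := J_pos_le (k ^ 2 + 0 * k) k (Icc (1 : ℤ) X)
    have hc : (Icc (1 : ℤ) X).card = X := by simp
    rw [hc] at this
    have h2 : (J (k ^ 2 + 0 * k) k (Icc (1 : ℤ) X) : ℝ) ≤ (X : ℝ) ^ (2 * (k ^ 2 + 0 * k)) := by exact_mod_cast this
    refine h2.trans (le_of_eq ?_)
    rw [← Real.rpow_natCast, one_mul]
    congr 1
    push_cast; ring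
  | succ r ih =>
    have := mvt_step k (k ^ 2 + r * k) hk (by omega) ((k : ℝ) * (k + 1) / 2 * (1 - 1 / (k : ℝ)) ^ r)
      (by have := pow_nonneg (sub_nonneg.2 hk1) r; positivity)
      (mul_le_of_le_one_right (by positivity) (pow_le_one₀ (by linarith) (by linarith))) ih
    have hh : k + (k ^ 2 + r * k) = k ^ 2 + (r + 1) * k := by ring
    rw [hh] at this
    rw [pow_succ (1 - 1 / (k : ℝ)) r, ← mul_assoc]
    exact this

/-- the mean value theorem with small defect -/
lemma mvt (k : ℕ) (hk : 2 ≤ k) :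
    ∃ s : ℕ, 1 ≤ s ∧ (s : ℝ) ≤ 10 * (k : ℝ) ^ 2 * Real.log k ∧
    ∃ B : ℝ, 0 < B ∧ ∀ X : ℕ, 1 ≤ X → (J s k (Icc (1 : ℤ) X) : ℝ) * (X : ℝ) ^ (k * (k + 1) / 2) ≤
      B * (X : ℝ) ^ (2 * (s : ℝ) + 1 / 2) := by
  have hk2 : (2 : ℝ) ≤ k := by exact_mod_cast hk
  set l := Real.log k with hl
  have hl2 : 0.69 ≤ l := by
    have h1 := Real.log_two_gt_d9
    have h2 : Real.log 2 ≤ l := Real.log_le_log (by norm_num) hk2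
    linarith
  set r := ⌈(k : ℝ) * Real.log (k * (k + 1))⌉₊ with hr
  have hlog : Real.log (k * (k + 1)) ≤ 3 * l := by
    rw [hl, ← Real.log_rpow (by positivity)]
    apply Real.log_le_log (by positivity)
    norm_num
    nlinarith [mul_nonneg (by linarith : (0:ℝ) ≤ k) (mul_nonneg (by linarith : (0:ℝ) ≤ k - 2) (by linarith : (0:ℝ) ≤ k + 1))]
  have hlog0 : 0 ≤ Real.log (k * (k + 1)) := Real.log_nonneg (by nlinarith)
  have hrle : (r : ℝ) ≤ k * (3 * l) + 1 := by
    refine (Nat.ceil_lt_add_one (by positivity)).le.trans ?_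
    gcongr
  refine ⟨k ^ 2 + r * k, by nlinarith, ?_, ?_⟩
  · push_cast
    nlinarith [mul_le_mul_of_nonneg_right hrle (by linarith : (0 : ℝ) ≤ k), mul_nonneg (by linarith : (0 : ℝ) ≤ k) (by linarith : (0 : ℝ) ≤ k - 2), mul_nonneg (sq_nonneg (k : ℝ)) (by linarith : (0 : ℝ) ≤ l - 0.69)]
  · obtain ⟨B, hB, h⟩ := mvt_ind k hk r
    refine ⟨B, hB, fun X hX => ?_⟩
    have hx : (1 : ℝ) ≤ X := by exact_mod_cast hX
    have hX0 : (0 : ℝ) < X := by linarith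
    have hd : (k : ℝ) * (k + 1) / 2 * (1 - 1 / (k : ℝ)) ^ r ≤ 1 / 2 := by
      have h1 : (1 - 1 / (k : ℝ)) ^ r ≤ Real.exp (-(Real.log (k * (k + 1)))) := by
        calc (1 - 1 / (k : ℝ)) ^ r ≤ (Real.exp (-(1 / (k : ℝ)))) ^ r := by
              apply pow_le_pow_left₀
              · rw [sub_nonneg, div_le_one (by positivity)]; linarith
              · exact Real.one_sub_le_exp_neg _
          _ = Real.exp (r * (-(1 / (k : ℝ)))) := by rw [← Real.exp_nat_mul]
          _ ≤ _ := by
            apply Real.exp_le_exp.2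
            have : (k : ℝ) * Real.log (k * (k + 1)) ≤ r := Nat.le_ceil _
            have h3 : Real.log (k * (k + 1)) ≤ r * (1 / (k : ℝ)) := by
              rw [mul_one_div, le_div_iff₀ (by positivity)]; linarith
            linarith
      rw [Real.exp_neg, Real.exp_log (by positivity)] at h1
      calc (k : ℝ) * (k + 1) / 2 * (1 - 1 / (k : ℝ)) ^ r ≤ (k : ℝ) * (k + 1) / 2 * ((k : ℝ) * (k + 1))⁻¹ := by gcongr
        _ = 1 / 2 := by field_simp
    have hw : ((k * (k + 1) / 2 : ℕ) : ℝ) = (k : ℝ) * (k + 1) / 2 := by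
      rw [Nat.cast_div (Nat.even_mul_succ_self k).two_dvd (by norm_num)]
      push_cast; ring
    calc _ ≤ B * (X : ℝ) ^ (2 * ((k ^ 2 + r * k : ℕ) : ℝ) - (k : ℝ) * (k + 1) / 2 + (k : ℝ) * (k + 1) / 2 * (1 - 1 / (k : ℝ)) ^ r) * (X : ℝ) ^ (k * (k + 1) / 2) := by
          gcongr; exact h X hX
      _ ≤ _ := by
        rw [← Real.rpow_natCast (X : ℝ) (k * (k + 1) / 2), mul_assoc, ← Real.rpow_add hX0, hw]
        refine mul_le_mul_of_nonneg_left (Real.rpow_le_rpow_of_exponent_le hx ?_) hB.le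
        linarith

end FE

namespace FE
open Finset

lemma card_residue (N : ℕ) (hN : 0 < N) (b r L : ℤ) (hb : b ≠ 0) (H : ℕ) :
    ((Icc L (L + H)).filter (fun z => (N : ℤ) ∣ b * z + r)).card ≤ b.natAbs * H / N + 1 := by
  set S := (Icc L (L + H)).filter (fun z => (N : ℤ) ∣ b * z + r) with hS
  rcases S.eq_empty_or_nonempty with h | h
  · rw [h]; simp
  set z0 := S.min' h with hz0
  have hz0S : z0 ∈ S := S.min'_mem h
  have hge : ∀ z ∈ S, z0 ≤ z := fun z hz => S.min'_le z hz
  have h1 : ∀ z ∈ S, N ∣ b.natAbs * (z - z0).toNat := by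
    intro z hz
    have e1 := (mem_filter.1 hz).2
    have e2 := (mem_filter.1 hz0S).2
    have e3 : (N : ℤ) ∣ b * (z - z0) := by
      have := dvd_sub e1 e2
      rwa [add_sub_add_right_eq_sub, ← mul_sub] at this
    have e4 := Int.natAbs_dvd_natAbs.2 e3
    rw [Int.natAbs_mul, Int.natAbs_natCast] at e4
    have : (z - z0).toNat = (z - z0).natAbs := by
      have := hge z hz; omega
    rwa [this]
  rw [← card_range (b.natAbs * H / N + 1)]
  refine card_le_card_of_injOn (fun z => b.natAbs * (z - z0).toNat / N) ?_ ?_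
  · intro z hz
    have hz : z ∈ S := hz
    rw [mem_coe, mem_range, Nat.lt_succ_iff]
    apply Nat.div_le_div_right
    apply Nat.mul_le_mul_left
    have e1 := mem_Icc.1 (mem_filter.1 hz).1
    have e2 := mem_Icc.1 (mem_filter.1 hz0S).1
    omega
  · intro z hz z' hz' h
    have hz : z ∈ S := hz
    have hz' : z' ∈ S := hz'
    have e := Nat.div_left_inj (h1 z hz) (h1 z' hz') |>.1 h
    have e2 := Nat.eq_of_mul_eq_mul_left (Int.natAbs_pos.2 hb) e
    have := hge z hz
    have := hge z' hz'
    omega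

lemma card_D (k N : ℕ) (hN : 0 < N) (P : Polynomial ℤ) (hb : P.coeff k ≠ 0) (H : Fin (k + 1) → ℕ) :
    ((Fintype.piFinset (fun j => Icc (-(H j : ℤ)) (H j))).filter (fun d => (N : ℤ) ∣ lin P d)).card ≤
      ((P.coeff k).natAbs * (2 * H (Fin.last k)) / N + 1) * ∏ j : Fin k, (2 * H j.castSucc + 1) := by
  have hc : (Fintype.piFinset (fun j : Fin k => Icc (-(H j.castSucc : ℤ)) (H j.castSucc))).card =
      ∏ j : Fin k, (2 * H j.castSucc + 1) := by
    rw [Fintype.card_piFinset]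
    refine prod_congr rfl fun j _ => ?_
    rw [Int.card_Icc]; omega
  rw [← hc]
  refine card_le_mul_card_image_of_maps_to (f := fun d => Fin.init d) ?_ _ ?_
  · intro d hd
    rw [Fintype.mem_piFinset]
    intro j
    exact Fintype.mem_piFinset.1 (mem_filter.1 hd).1 j.castSucc
  · intro c _
    refine le_trans (card_le_card_of_injOn (fun d => d (Fin.last k)) ?_ ?_)
      (card_residue N hN (P.coeff k) (∑ j : Fin k, P.coeff j * c j) (-(H (Fin.last k) : ℤ)) hb _)
    · intro d hd
      rw [mem_coe, mem_filter, mem_filter] at hd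
      obtain ⟨⟨h1, h2⟩, h3⟩ := hd
      have h4 := mem_Icc.1 (Fintype.mem_piFinset.1 h1 (Fin.last k))
      rw [mem_coe, mem_filter, mem_Icc]
      refine ⟨⟨h4.1, by push_cast; linarith [h4.2]⟩, ?_⟩
      have : lin P d = P.coeff k * d (Fin.last k) + ∑ j : Fin k, P.coeff j * c j := by
        rw [← h3]
        change ∑ j : Fin (k + 1), P.coeff j * d j = _
        rw [Fin.sum_univ_castSucc, add_comm]
        rfl
      rwa [← this]
    · intro d hd d' hd' h
      rw [mem_coe, mem_filter] at hd hd'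
      rw [← Fin.snoc_init_self d, ← Fin.snoc_init_self d', hd.2, hd'.2]
      congr 1

lemma W {τ : Type*} (q : ℕ) [NeZero q] (T : Finset τ) (v : τ → ZMod q) (w : τ → ℂ)
    (hw : ∀ t ∈ T, ‖w t‖ ≤ 1) :
    ∑ r : ZMod q, ‖∑ t ∈ T, w t * ZMod.stdAddChar (r * v t)‖ ^ 2 ≤ (q : ℝ) * En T v := by
  classical
  have key : ∀ r : ZMod q, ((‖∑ t ∈ T, w t * ZMod.stdAddChar (r * v t)‖ ^ 2 : ℝ) : ℂ) =
      ∑ p ∈ T ×ˢ T, w p.1 * (starRingEnd ℂ) (w p.2) * ZMod.stdAddChar (r * (v p.1 - v p.2)) := by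
    intro r
    push_cast
    rw [← Complex.mul_conj', map_sum, sum_mul_sum, sum_product]
    refine sum_congr rfl fun x _ => sum_congr rfl fun y _ => ?_
    rw [mul_sub, AddChar.map_sub_eq_div, div_eq_mul_inv, ← AddChar.map_neg_eq_inv,
      AddChar.map_neg_eq_conj, (starRingEnd ℂ).map_mul]
    ring
  have h2 : ((∑ r : ZMod q, ‖∑ t ∈ T, w t * ZMod.stdAddChar (r * v t)‖ ^ 2 : ℝ) : ℂ) =
      ∑ p ∈ (T ×ˢ T).filter (fun p => v p.1 = v p.2), w p.1 * (starRingEnd ℂ) (w p.2) * q := by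
    rw [Complex.ofReal_sum, sum_congr rfl (fun r _ => key r), sum_comm, sum_filter]
    refine sum_congr rfl fun p _ => ?_
    rw [← mul_sum, AddChar.sum_mulShift _ (ZMod.isPrimitive_stdAddChar q)]
    simp only [sub_eq_zero, ZMod.card]
    split_ifs <;> simp
  have h3 : ‖((∑ r : ZMod q, ‖∑ t ∈ T, w t * ZMod.stdAddChar (r * v t)‖ ^ 2 : ℝ) : ℂ)‖ ≤ q * En T v := by
    rw [h2]
    refine (norm_sum_le _ _).trans ?_
    refine (sum_le_card_nsmul _ _ (q : ℝ) ?_).trans ?_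
    · intro p hp
      have hp := mem_product.1 (mem_filter.1 hp).1
      rw [norm_mul, norm_mul, RCLike.norm_conj, Complex.norm_natCast]
      have := mul_le_mul (hw _ hp.1) (hw _ hp.2) (norm_nonneg _) zero_le_one
      have hq : (0 : ℝ) ≤ q := by positivity
      nlinarith
    · rw [nsmul_eq_mul, mul_comm]; rfl
  rw [Complex.norm_real, Real.norm_of_nonneg (by positivity)] at h3
  exact h3

lemma mv_diff_bound (s k M : ℕ) (x y : Fin s → ℤ) (hx : ∀ i, x i ∈ Icc (1 : ℤ) M)
    (hy : ∀ i, y i ∈ Icc (1 : ℤ) M) (j : Fin (k + 1)) :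
    (∑ i, mv k (x i) - ∑ i, mv k (y i)) j ∈ Icc (-((s * M ^ (j : ℕ) : ℕ) : ℤ)) ((s * M ^ (j : ℕ) : ℕ) : ℤ) := by
  have hb : ∀ z : Fin s → ℤ, (∀ i, z i ∈ Icc (1 : ℤ) M) →
      0 ≤ (∑ i, mv k (z i)) j ∧ (∑ i, mv k (z i)) j ≤ ((s * M ^ (j : ℕ) : ℕ) : ℤ) := by
    intro z hz
    rw [Finset.sum_apply]
    constructor
    · exact sum_nonneg fun i _ => pow_nonneg (by linarith [(mem_Icc.1 (hz i)).1]) _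
    · refine (sum_le_card_nsmul _ _ ((M : ℤ) ^ (j : ℕ)) fun i _ => ?_).trans ?_
      · exact pow_le_pow_left₀ (by linarith [(mem_Icc.1 (hz i)).1]) (mem_Icc.1 (hz i)).2 _
      · simp
  have h1 := hb x hx
  have h2 := hb y hy
  rw [mem_Icc, Pi.sub_apply]
  constructor <;> linarith [h1.1, h1.2, h2.1, h2.2]

/-- exponential sum over Z/N -/
noncomputable def fs (N : ℕ) [NeZero N] (P : Polynomial ℤ) (M : ℕ) (ξ : ZMod N) : ℂ :=
  ∑ n ∈ Icc (1 : ℤ) M, ZMod.stdAddChar (ξ * ((P.eval n : ℤ) : ZMod N))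

lemma prod_box (s k M : ℕ) (hM : 1 ≤ M) :
    ∏ j : Fin k, (2 * (s * M ^ (j : ℕ)) + 1) ≤ (2 * s + 1) ^ k * M ^ (k * (k - 1) / 2) := by
  calc ∏ j : Fin k, (2 * (s * M ^ (j : ℕ)) + 1) ≤ ∏ j : Fin k, ((2 * s + 1) * M ^ (j : ℕ)) := by
        refine prod_le_prod' fun j _ => ?_
        have : 1 ≤ M ^ (j : ℕ) := Nat.one_le_pow _ _ hM
        nlinarith
    _ = _ := by
      rw [prod_mul_distrib, prod_const, card_univ, Fintype.card_fin, prod_pow_eq_pow_sum,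
        Fin.sum_univ_eq_sum_range (fun i => i), sum_range_id]

lemma char_sum {G ι : Type*} [AddCommGroup G] (ψ : AddChar G ℂ) (S : Finset ι) (w : ι → G) :
    ψ (∑ i ∈ S, w i) = ∏ i ∈ S, ψ (w i) := by
  induction S using Finset.cons_induction with
  | empty => simp
  | cons a S ha ih => rw [sum_cons, prod_cons, AddChar.map_add_eq_mul, ih]

lemma moment (N : ℕ) [NeZero N] (P : Polynomial ℤ) (s k M : ℕ) (hP : P.natDegree ≤ k)
    (hb : P.coeff k ≠ 0) (hM : 1 ≤ M) :
    ∑ ξ : ZMod N, ‖fs N P M ξ‖ ^ (2 * s) ≤ (N : ℝ) *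
      (((P.coeff k).natAbs * (2 * (s * M ^ k)) / N + 1) * ((2 * s + 1) ^ k * M ^ (k * (k - 1) / 2)) *
        J s k (Icc (1 : ℤ) M) : ℕ) := by
  set T := Fintype.piFinset (fun _ : Fin s => Icc (1 : ℤ) M) with hT
  set v : (Fin s → ℤ) → ZMod N := fun x => ((lin P (∑ i, mv k (x i)) : ℤ) : ZMod N) with hv
  have h1 : ∀ ξ : ZMod N, ‖fs N P M ξ‖ ^ (2 * s) =
      ‖∑ t ∈ T, (1 : ℂ) * ZMod.stdAddChar (ξ * v t)‖ ^ 2 := by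
    intro ξ
    rw [mul_comm 2 s, pow_mul, ← norm_pow]
    congr 2
    have : (fs N P M ξ) ^ s = ∏ i : Fin s, fs N P M ξ := by simp
    rw [this]
    unfold fs
    rw [prod_univ_sum]
    refine sum_congr rfl fun x _ => ?_
    rw [one_mul, ← char_sum, ← mul_sum]
    congr 2
    rw [hv]
    simp only [map_sum, lin_mv P hP]
    push_cast
    rfl
  rw [sum_congr rfl (fun ξ _ => h1 ξ)]
  refine (W N T v (fun _ => 1) (by simp)).trans ?_
  gcongr
  have h2 : En T v ≤ ((Fintype.piFinset (fun j : Fin (k + 1) => Icc (-((s * M ^ (j : ℕ) : ℕ) : ℤ)) ((s * M ^ (j : ℕ) : ℕ) : ℤ))).filter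
      (fun d => (N : ℤ) ∣ lin P d)).card * En T (fun x => ∑ i, mv k (x i)) := by
    refine le_trans (card_le_card ?_) (En_diff T _ _)
    intro p hp
    rw [mem_filter, mem_product] at hp
    obtain ⟨⟨h1, h2⟩, h3⟩ := hp
    rw [mem_filter, mem_product]
    refine ⟨⟨h1, h2⟩, mem_filter.2 ⟨Fintype.mem_piFinset.2 fun j => ?_, ?_⟩⟩
    · exact mv_diff_bound s k M _ _ (Fintype.mem_piFinset.1 h1) (Fintype.mem_piFinset.1 h2) j
    · rw [map_sub]
      rw [hv] at h3
      exact (ZMod.intCast_eq_intCast_iff_dvd_sub _ _ _).1 h3.symm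
  refine h2.trans ?_
  refine Nat.mul_le_mul_right _ ?_
  refine (card_D k N (NeZero.pos N) P hb (fun j => s * M ^ (j : ℕ))).trans ?_
  simp only [Fin.val_last, Fin.val_castSucc]
  exact Nat.mul_le_mul_left _ (prod_box s k M hM)

end FE

namespace FE
open Finset

/-- additive character of the reals -/
noncomputable def e (t : ℝ) : ℂ := Complex.exp (2 * Real.pi * t * I)

lemma e_add (x y : ℝ) : e (x + y) = e x * e y := by
  unfold e
  rw [← Complex.exp_add]
  congr 1
  push_cast; ring

lemma e_zero : e 0 = 1 := by simp [e]

lemma norm_e (x : ℝ) : ‖e x‖ = 1 := by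
  unfold e
  have : (2 * Real.pi * x * I : ℂ) = ((2 * Real.pi * x : ℝ) : ℂ) * I := by push_cast; ring
  rw [this, Complex.norm_exp_ofReal_mul_I]

lemma e_sum {ι : Type*} (S : Finset ι) (w : ι → ℝ) : e (∑ i ∈ S, w i) = ∏ i ∈ S, e (w i) := by
  induction S using Finset.cons_induction with
  | empty => simp [e_zero]
  | cons a S ha ih => rw [sum_cons, prod_cons, e_add, ih]

lemma e_std (q : ℕ) [NeZero q] (n : ℤ) : e ((n : ℝ) / q) = ZMod.stdAddChar (n : ZMod q) := by
  rw [ZMod.stdAddChar_coe]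
  unfold e
  congr 1
  push_cast
  ring

lemma taylor_sum {l : ℕ} (G : Polynomial ℝ) (hG : G.natDegree ≤ l + 2) (m : ℕ) (x : ℤ) :
    G.eval ((x : ℝ) + m) = ∑ j : Fin (l + 3), (Polynomial.taylor (m : ℝ) G).coeff j * (mv (l + 2) x j : ℝ) := by
  have h1 : G.eval ((x : ℝ) + m) = (Polynomial.taylor (m : ℝ) G).eval (x : ℝ) := by
    rw [Polynomial.taylor_eval]
  rw [h1, Polynomial.eval_eq_sum_range' (n := l + 3)
    (by rw [Polynomial.natDegree_taylor]; omega), ← Fin.sum_univ_eq_sum_range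
    (fun i => (Polynomial.taylor (m : ℝ) G).coeff i * (x : ℝ) ^ i)]
  refine sum_congr rfl fun j _ => ?_
  simp [mv]

lemma taylor_c2 {l : ℕ} (G : Polynomial ℝ) (hG : G.natDegree ≤ l + 2) (m : ℝ) :
    (Polynomial.taylor m G).coeff (l + 2) = G.coeff (l + 2) := by
  rw [Polynomial.taylor_coeff]
  have h : (Polynomial.hasseDeriv (l + 2) G).natDegree < 1 := by
    have := Polynomial.natDegree_hasseDeriv_le G (l + 2)
    omega
  rw [Polynomial.eval_eq_sum_range' h]
  simp [Polynomial.hasseDeriv_coeff]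

lemma taylor_c1 {l : ℕ} (G : Polynomial ℝ) (hG : G.natDegree ≤ l + 2) (m : ℝ) :
    (Polynomial.taylor m G).coeff (l + 1) = G.coeff (l + 1) + (l + 2) * m * G.coeff (l + 2) := by
  rw [Polynomial.taylor_coeff]
  have h : (Polynomial.hasseDeriv (l + 1) G).natDegree < 2 := by
    have := Polynomial.natDegree_hasseDeriv_le G (l + 1)
    omega
  rw [Polynomial.eval_eq_sum_range' h]
  simp [Polynomial.hasseDeriv_coeff, sum_range_succ]
  rw [show 1 + (l + 1) = (l + 1) + 1 by ring, Nat.choose_succ_self_right]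
  push_cast
  ring

lemma En_fiber_sum {τ G U : Type*} [DecidableEq G] [DecidableEq U] (T : Finset τ) (v : τ → G)
    (key : τ → U) (V : Finset U) (h : ∀ t ∈ T, key t ∈ V) :
    ∑ κ ∈ V, En (T.filter (fun t => key t = κ)) v = En T (fun t => (key t, v t)) := by
  unfold En
  rw [card_eq_sum_card_fiberwise (f := fun p => key p.1) (t := V)]
  · refine sum_congr rfl fun κ _ => ?_
    congr 1
    ext p
    simp only [mem_filter, mem_product, Prod.mk.injEq]
    constructor
    · rintro ⟨⟨⟨h1, h2⟩, h3, h4⟩, h5⟩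
      exact ⟨⟨⟨h1, h3⟩, by rw [h2, h4], h5⟩, h2⟩
    · rintro ⟨⟨⟨h1, h2⟩, h3, h4⟩, h5⟩
      exact ⟨⟨⟨h1, h5⟩, h2, by rw [← h3, h5]⟩, h4⟩
  · intro p hp
    exact h _ (mem_product.1 (mem_filter.1 hp).1).1

lemma sum_mult {q : ℕ} [NeZero q] (R μ : ℕ) (r : ℕ → ZMod q) (F : ZMod q → ℝ) (hF : ∀ x, 0 ≤ F x)
    (hr : ∀ x, ((range R).filter (fun m => r m = x)).card ≤ μ) :
    ∑ m ∈ range R, F (r m) ≤ μ * ∑ x, F x := by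
  rw [← sum_fiberwise_of_maps_to (t := (univ : Finset (ZMod q))) (g := r) (fun _ _ => mem_univ _), mul_sum]
  refine sum_le_sum fun x _ => ?_
  rw [sum_congr rfl (g := fun _ => F x) (fun m hm => by rw [(mem_filter.1 hm).2]), sum_const, nsmul_eq_mul]
  exact mul_le_mul_of_nonneg_right (by exact_mod_cast hr x) (hF x)

lemma mult_bound (q : ℕ) [NeZero q] (R : ℕ) (hR : R ≤ q) (l : ℕ) (a b : ℤ) (hb : b ≠ 0)
    (ha : IsCoprime a (q : ℤ)) (x : ZMod q) :
    ((range R).filter (fun m : ℕ => (((((l + 2 : ℕ) : ℤ) * m * (a * b) : ℤ)) : ZMod q) = x)).card ≤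
      (l + 2) * b.natAbs + 1 := by
  set S := (range R).filter (fun m : ℕ => (((((l + 2 : ℕ) : ℤ) * m * (a * b) : ℤ)) : ZMod q) = x)
  rcases S.eq_empty_or_nonempty with h | ⟨m0, hm0⟩
  · rw [h]; simp
  have hb' : ((l + 2 : ℕ) : ℤ) * b ≠ 0 := mul_ne_zero (by positivity) hb
  have := card_residue q (NeZero.pos q) (((l + 2 : ℕ) : ℤ) * b) (-(((l + 2 : ℕ) : ℤ) * b * m0)) 0 hb' q
  have h2 : (((l + 2 : ℕ) : ℤ) * b).natAbs * q / q + 1 = (l + 2) * b.natAbs + 1 := by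
    rw [Nat.mul_div_cancel _ (NeZero.pos q), Int.natAbs_mul, Int.natAbs_natCast]
  rw [h2] at this
  refine le_trans (card_le_card_of_injOn (fun m : ℕ => (m : ℤ)) ?_ ?_) this
  · intro m hm
    have hm : m ∈ S := hm
    have e1 := (mem_filter.1 hm).2
    have e2 := (mem_filter.1 hm0).2
    have e3 : m < R := mem_range.1 (mem_filter.1 hm).1
    rw [mem_coe, mem_filter, mem_Icc]
    refine ⟨⟨by positivity, by push_cast; omega⟩, ?_⟩
    have e4 := (ZMod.intCast_eq_intCast_iff_dvd_sub _ _ _).1 (e2.trans e1.symm)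
    have e5 : (q : ℤ) ∣ a * (((l + 2 : ℕ) : ℤ) * b * m + -(((l + 2 : ℕ) : ℤ) * b * m0)) := by
      refine e4.trans (dvd_of_eq ?_)
      ring
    exact ha.symm.dvd_of_dvd_mul_left e5
  · intro m _ m' _ h
    exact Int.ofNat_inj.1 h

lemma card_D2 (l q s X : ℕ) (hq : 0 < q) :
    ((Fintype.piFinset (fun j : Fin (l + 3) => Icc (-((s * X ^ (j : ℕ) : ℕ) : ℤ)) ((s * X ^ (j : ℕ) : ℕ) : ℤ))).filter
      (fun d => (∀ j : Fin (l + 1), d j.castSucc.castSucc = 0) ∧ (q : ℤ) ∣ d (Fin.last (l + 1)).castSucc)).card ≤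
    (2 * (s * X ^ (l + 1)) / q + 1) * (2 * (s * X ^ (l + 2)) + 1) := by
  have h1 := card_residue q hq 1 0 (-((s * X ^ (l + 1) : ℕ) : ℤ)) one_ne_zero (2 * (s * X ^ (l + 1)))
  have h2 : (Icc (-((s * X ^ (l + 2) : ℕ) : ℤ)) ((s * X ^ (l + 2) : ℕ) : ℤ)).card = 2 * (s * X ^ (l + 2)) + 1 := by
    rw [Int.card_Icc]; omega
  rw [Int.natAbs_one, one_mul] at h1
  rw [← h2]
  refine le_trans ?_ (Nat.mul_le_mul_right _ h1)
  rw [← card_product]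
  refine card_le_card_of_injOn (fun d => (d (Fin.last (l + 1)).castSucc, d (Fin.last (l + 2)))) ?_ ?_
  · intro d hd
    rw [mem_coe, mem_filter] at hd
    obtain ⟨h3, h4, h5⟩ := hd
    rw [mem_coe, mem_product, mem_filter]
    have e1 := Fintype.mem_piFinset.1 h3 (Fin.last (l + 1)).castSucc
    have e2 := Fintype.mem_piFinset.1 h3 (Fin.last (l + 2))
    refine ⟨⟨?_, by simpa using h5⟩, by simpa using e2⟩
    rw [Fin.val_castSucc, Fin.val_last, mem_Icc] at e1
    rw [mem_Icc]
    refine ⟨e1.1, e1.2.trans ?_⟩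
    push_cast; linarith
  · intro d hd d' hd' h
    rw [mem_coe, mem_filter] at hd hd'
    simp only [Prod.mk.injEq] at h
    funext j
    refine Fin.lastCases h.2 (fun j => ?_) j
    refine Fin.lastCases h.1 (fun j => ?_) j
    rw [hd.2.1 j, hd'.2.1 j]

set_option maxHeartbeats 1000000 in
lemma B1 (q : ℕ) [NeZero q] (l s X : ℕ) (hX : 1 ≤ X) (A : Finset ℤ) (hA : A ⊆ Icc (1 : ℤ) X)
    (G : Polynomial ℝ) (hG : G.natDegree ≤ l + 2) (a b : ℤ) (hb : b ≠ 0) (ha : IsCoprime a (q : ℤ))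
    (hc : G.coeff (l + 2) = (a * b : ℤ) / (q : ℝ)) (R : ℕ) (hR : R ≤ q) :
    ∑ m ∈ range R, ‖∑ x ∈ A, e (G.eval ((x : ℝ) + m))‖ ^ (2 * s) ≤
      (((2 * s + 1) ^ (l + 1) * X ^ ((l + 1) * l / 2) : ℕ) : ℝ) * ((((l + 2) * b.natAbs + 1 : ℕ) : ℝ) *
        ((q : ℝ) * (((2 * (s * X ^ (l + 1)) / q + 1) * (2 * (s * X ^ (l + 2)) + 1) * J s (l + 2) (Icc (1 : ℤ) X) : ℕ) : ℝ))) := by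
  classical
  set T := Fintype.piFinset (fun _ : Fin s => A) with hT
  set S : (Fin s → ℤ) → Fin (l + 3) → ℤ := fun t => ∑ i, mv (l + 2) (t i) with hS
  set key : (Fin s → ℤ) → Fin (l + 1) → ℤ := fun t j => S t j.castSucc.castSucc with hkey
  set v : (Fin s → ℤ) → ZMod q := fun t => ((S t (Fin.last (l + 1)).castSucc : ℤ) : ZMod q) with hv
  set w : (Fin s → ℤ) → ℂ := fun t => e (G.coeff (l + 1) * (S t (Fin.last (l + 1)).castSucc : ℝ) +
    G.coeff (l + 2) * (S t (Fin.last (l + 2)) : ℝ)) with hw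
  set r : ℕ → ZMod q := fun m => (((((l + 2 : ℕ) : ℤ) * m * (a * b) : ℤ)) : ZMod q) with hr
  set U : Finset (Fin (l + 1) → ℤ) := Fintype.piFinset (fun j => Icc (0 : ℤ) ((s * X ^ (j : ℕ) : ℕ) : ℤ)) with hU
  have hTX : ∀ t ∈ T, ∀ i, t i ∈ Icc (1 : ℤ) X := fun t ht i => hA (Fintype.mem_piFinset.1 ht i)
  have hkU : ∀ t ∈ T, key t ∈ U := by
    intro t ht
    rw [hU, Fintype.mem_piFinset]
    intro j
    simp only [hkey, hS]
    rw [Finset.sum_apply, mem_Icc]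
    have hz := hTX t ht
    constructor
    · exact sum_nonneg fun i _ => pow_nonneg (by linarith [(mem_Icc.1 (hz i)).1]) _
    · refine (sum_le_card_nsmul _ _ ((X : ℤ) ^ (j : ℕ)) fun i _ => ?_).trans ?_
      · exact pow_le_pow_left₀ (by linarith [(mem_Icc.1 (hz i)).1]) (mem_Icc.1 (hz i)).2 _
      · simp
  have hUc : U.card ≤ (2 * s + 1) ^ (l + 1) * X ^ ((l + 1) * l / 2) := by
    refine le_trans ?_ (prod_box s (l + 1) X hX)
    rw [hU, Fintype.card_piFinset]
    refine prod_le_prod' fun j _ => ?_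
    rw [Int.card_Icc]; omega
  -- main expansion
  have hexp : ∀ m : ℕ, (∑ x ∈ A, e (G.eval ((x : ℝ) + m))) ^ s =
      ∑ κ ∈ U, e (∑ j : Fin (l + 1), (Polynomial.taylor (m : ℝ) G).coeff j * (κ j : ℝ)) *
        ∑ t ∈ T.filter (fun t => key t = κ), w t * ZMod.stdAddChar (r m * v t) := by
    intro m
    have h1 : (∑ x ∈ A, e (G.eval ((x : ℝ) + m))) ^ s = ∏ _i : Fin s, ∑ x ∈ A, e (G.eval ((x : ℝ) + m)) := by simp
    rw [h1, prod_univ_sum, ← sum_fiberwise_of_maps_to hkU]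
    refine sum_congr rfl fun κ _ => ?_
    rw [mul_sum]
    refine sum_congr rfl fun t ht => ?_
    have hκ := (mem_filter.1 ht).2
    rw [← e_sum, hw, ← hκ]
    simp only
    have h3 : r m * v t = (((((l + 2 : ℕ) : ℤ) * m * (a * b)) * S t (Fin.last (l + 1)).castSucc : ℤ) : ZMod q) := by
      rw [hr, hv]; push_cast; ring
    rw [h3, ← e_std, ← e_add, ← e_add]
    congr 1
    have h4 : ∑ i, G.eval ((t i : ℝ) + m) = ∑ j : Fin (l + 3), (Polynomial.taylor (m : ℝ) G).coeff j * (S t j : ℝ) := by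
      simp only [taylor_sum G hG]
      rw [sum_comm]
      refine sum_congr rfl fun j _ => ?_
      rw [← mul_sum, hS]
      simp only [Finset.sum_apply]
      push_cast
      rfl
    rw [h4, Fin.sum_univ_castSucc, Fin.sum_univ_castSucc, hkey]
    simp only [Fin.val_castSucc, Fin.val_last]
    rw [taylor_c1 G hG, taylor_c2 G hG, hc]
    push_cast
    ring
  have hsq : ∀ m : ℕ, ‖∑ x ∈ A, e (G.eval ((x : ℝ) + m))‖ ^ (2 * s) ≤
      U.card * ∑ κ ∈ U, ‖∑ t ∈ T.filter (fun t => key t = κ), w t * ZMod.stdAddChar (r m * v t)‖ ^ 2 := by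
    intro m
    rw [mul_comm 2 s, pow_mul, ← norm_pow, hexp m]
    refine le_trans ?_ sq_sum_le_card_mul_sum_sq
    refine pow_le_pow_left₀ (norm_nonneg _) ((norm_sum_le _ _).trans (le_of_eq ?_)) 2
    refine sum_congr rfl fun κ _ => ?_
    rw [norm_mul, norm_e, one_mul]
  have hEn : En T (fun t => (key t, v t)) ≤ (2 * (s * X ^ (l + 1)) / q + 1) * (2 * (s * X ^ (l + 2)) + 1) *
      J s (l + 2) (Icc (1 : ℤ) X) := by
    refine le_trans ?_ (Nat.mul_le_mul (card_D2 l q s X (NeZero.pos q)) (J_mono hA))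
    refine le_trans (card_le_card ?_) (En_diff T S _)
    intro p hp
    rw [mem_filter, mem_product] at hp
    obtain ⟨⟨h1, h2⟩, h3⟩ := hp
    simp only [Prod.mk.injEq] at h3
    rw [mem_filter, mem_product]
    refine ⟨⟨h1, h2⟩, mem_filter.2 ⟨Fintype.mem_piFinset.2 fun j => ?_, fun j => ?_, ?_⟩⟩
    · exact mv_diff_bound s (l + 2) X _ _ (hTX _ h1) (hTX _ h2) j
    · have := congrFun h3.1 j
      simp only [hkey] at this
      rw [Pi.sub_apply, this, sub_self]
    · exact (ZMod.intCast_eq_intCast_iff_dvd_sub _ _ _).1 h3.2.symm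
  set μ := (l + 2) * b.natAbs + 1 with hμ
  calc ∑ m ∈ range R, ‖∑ x ∈ A, e (G.eval ((x : ℝ) + m))‖ ^ (2 * s)
      ≤ ∑ m ∈ range R, U.card * ∑ κ ∈ U, ‖∑ t ∈ T.filter (fun t => key t = κ), w t * ZMod.stdAddChar (r m * v t)‖ ^ 2 :=
        sum_le_sum fun m _ => hsq m
    _ = U.card * ∑ κ ∈ U, ∑ m ∈ range R, ‖∑ t ∈ T.filter (fun t => key t = κ), w t * ZMod.stdAddChar (r m * v t)‖ ^ 2 := by
        rw [← mul_sum, sum_comm]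
    _ ≤ U.card * ∑ κ ∈ U, (μ : ℝ) * ((q : ℝ) * En (T.filter (fun t => key t = κ)) v) := by
        refine mul_le_mul_of_nonneg_left (sum_le_sum fun κ _ => ?_) (by positivity)
        refine (sum_mult R μ r (fun x => ‖∑ t ∈ T.filter (fun t => key t = κ), w t * ZMod.stdAddChar (x * v t)‖ ^ 2)
          (fun _ => by positivity) (fun x => mult_bound q R hR l a b hb ha x)).trans ?_
        exact mul_le_mul_of_nonneg_left (W q _ v w (fun t _ => by rw [hw]; exact (norm_e _).le)) (by positivity)
    _ = U.card * ((μ : ℝ) * ((q : ℝ) * ((En T (fun t => (key t, v t)) : ℕ) : ℝ))) := by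
        rw [← mul_sum, ← mul_sum, ← En_fiber_sum T v key U hkU]
        push_cast; rfl
    _ ≤ _ := by
        gcongr

end FE

namespace FE
open Finset

/-- mean value hypothesis -/
def MV (s k : ℕ) (B : ℝ) : Prop := ∀ X : ℕ, 1 ≤ X →
  (J s k (Icc (1 : ℤ) X) : ℝ) * (X : ℝ) ^ (k * (k + 1) / 2) ≤ B * (X : ℝ) ^ (2 * (s : ℝ) + 1 / 2)

lemma B2 (l s : ℕ) (B : ℝ) (hMV : MV s (l + 2) B) (b : ℤ) (hb : b ≠ 0) (A' : ℝ) (hA' : 0 ≤ A') :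
    ∃ C : ℝ, 0 < C ∧ ∀ (q : ℕ) [NeZero q] (X : ℕ) (_ : 1 ≤ X) (A : Finset ℤ) (_ : A ⊆ Icc (1 : ℤ) X)
      (G : Polynomial ℝ) (_ : G.natDegree ≤ l + 2) (a : ℤ) (_ : IsCoprime a (q : ℤ))
      (_ : G.coeff (l + 2) = (a * b : ℤ) / (q : ℝ)) (R : ℕ) (_ : R ≤ q) (_ : (q : ℝ) ≤ A' * (X : ℝ) ^ (l + 1)),
      ∑ m ∈ range R, ‖∑ x ∈ A, e (G.eval ((x : ℝ) + m))‖ ^ (2 * s) ≤ C * (X : ℝ) ^ (2 * (s : ℝ) + 1 / 2) := by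
  have hB0 : 0 ≤ B := by
    have := hMV 1 le_rfl
    simp at this
    exact le_trans (by positivity) this
  set C0 : ℝ := (2 * s + 1) ^ (l + 1) * ((l + 2) * b.natAbs + 1) * ((2 * s + A') * (2 * s + 1)) with hC0
  refine ⟨C0 * B + 1, by positivity, ?_⟩
  intro q _ X hX A hA G hG a ha hc R hR hq
  refine (B1 q l s X hX A hA G hG a b hb ha hc R hR).trans ?_
  have hx : (1 : ℝ) ≤ X := by exact_mod_cast hX
  have hqp : (0 : ℝ) < q := by exact_mod_cast NeZero.pos q
  have hw : (l + 1) * l / 2 + (l + 1) + (l + 2) = (l + 2) * (l + 2 + 1) / 2 := by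
    have : (l + 2) * (l + 2 + 1) = (l + 1) * l + ((l + 1) + (l + 2)) * 2 := by ring
    rw [this, Nat.add_mul_div_right _ _ (by norm_num)]
    ring
  set j := J s (l + 2) (Icc (1 : ℤ) X) with hj
  have h1 : (q : ℝ) * ((2 * (s * X ^ (l + 1)) / q + 1 : ℕ) : ℝ) ≤ (2 * s + A') * (X : ℝ) ^ (l + 1) := by
    push_cast
    have : ((2 * (s * X ^ (l + 1)) / q : ℕ) : ℝ) ≤ (2 * (s * X ^ (l + 1)) : ℝ) / q := by
      have := @Nat.cast_div_le ℝ _ _ _ (2 * (s * X ^ (l + 1))) q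
      push_cast at this
      exact this
    calc (q : ℝ) * (((2 * (s * X ^ (l + 1)) / q : ℕ) : ℝ) + 1) ≤ q * ((2 * (s * X ^ (l + 1)) : ℝ) / q + 1) := by gcongr
      _ = 2 * (s * X ^ (l + 1)) + q := by field_simp
      _ ≤ _ := by linarith
  have h2 : ((2 * (s * X ^ (l + 2)) + 1 : ℕ) : ℝ) ≤ (2 * s + 1) * (X : ℝ) ^ (l + 2) := by
    push_cast
    have := one_le_pow₀ hx (n := l + 2)
    linarith
  set u1 : ℝ := ((2 * (s * X ^ (l + 1)) / q + 1 : ℕ) : ℝ) with hu1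
  set u2 : ℝ := ((2 * (s * X ^ (l + 2)) + 1 : ℕ) : ℝ) with hu2
  have e1 : (((2 * (s * X ^ (l + 1)) / q + 1) * (2 * (s * X ^ (l + 2)) + 1) * j : ℕ) : ℝ) = u1 * u2 * j := by
    rw [Nat.cast_mul, Nat.cast_mul]
  rw [e1]
  have hu2n : 0 ≤ u2 := by positivity
  clear_value u1 u2
  calc (((2 * s + 1) ^ (l + 1) * X ^ ((l + 1) * l / 2) : ℕ) : ℝ) * ((((l + 2) * b.natAbs + 1 : ℕ) : ℝ) * ((q : ℝ) * (u1 * u2 * j)))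
      = (2 * s + 1 : ℝ) ^ (l + 1) * ((l + 2) * b.natAbs + 1) * (X : ℝ) ^ ((l + 1) * l / 2) * ((q : ℝ) * u1 * u2) * j := by
        push_cast; ring
    _ ≤ (2 * s + 1 : ℝ) ^ (l + 1) * ((l + 2) * b.natAbs + 1) * (X : ℝ) ^ ((l + 1) * l / 2) *
        (((2 * s + A') * (X : ℝ) ^ (l + 1)) * ((2 * s + 1) * (X : ℝ) ^ (l + 2))) * j := by
        refine mul_le_mul_of_nonneg_right (mul_le_mul_of_nonneg_left (mul_le_mul h1 h2 hu2n (by positivity)) (by positivity)) (by positivity)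
    _ = C0 * (j * (X : ℝ) ^ ((l + 2) * (l + 2 + 1) / 2)) := by
        rw [← hw, pow_add, pow_add, hC0]; ring
    _ ≤ C0 * (B * (X : ℝ) ^ (2 * (s : ℝ) + 1 / 2)) := by
        have := hMV X hX
        exact mul_le_mul_of_nonneg_left this (by positivity)
    _ ≤ _ := by
        have : 0 ≤ (X : ℝ) ^ (2 * (s : ℝ) + 1 / 2) := by positivity
        linarith

lemma sum_Icc_range (t : ℕ) (F : ℤ → ℂ) : ∑ x ∈ Icc (1 : ℤ) t, F x = ∑ i ∈ range t, F (i + 1) := by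
  symm
  refine sum_bij (fun i _ => (i : ℤ) + 1) ?_ ?_ ?_ ?_
  · intro i hi
    rw [mem_range] at hi
    rw [mem_Icc]; omega
  · intro i _ j _ h
    omega
  · intro z hz
    rw [mem_Icc] at hz
    exact ⟨(z - 1).toNat, by rw [mem_range]; omega, by omega⟩
  · intro i _; rfl

lemma shift_bound (u : ℕ → ℂ) (hu : ∀ n, ‖u n‖ ≤ 1) (t m : ℕ) :
    ‖∑ i ∈ range t, u i‖ ≤ ‖∑ i ∈ range t, u (i + m)‖ + 2 * m := by
  have h1 : ∑ i ∈ range m, u i + ∑ i ∈ range t, u (m + i) = ∑ i ∈ range t, u i + ∑ i ∈ range m, u (t + i) := by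
    rw [← sum_range_add, ← sum_range_add, add_comm]
  have hb : ∀ f : ℕ → ℂ, (∀ n, ‖f n‖ ≤ 1) → ‖∑ i ∈ range m, f i‖ ≤ m := by
    intro f hf
    refine (norm_sum_le _ _).trans ((sum_le_card_nsmul _ _ 1 fun i _ => hf i).trans ?_)
    simp
  have h2 : ∑ i ∈ range t, u i = ∑ i ∈ range t, u (i + m) + (∑ i ∈ range m, u i - ∑ i ∈ range m, u (t + i)) := by
    simp only [add_comm _ m]
    linear_combination -h1
  rw [h2]
  refine (norm_add_le _ _).trans ?_
  have := norm_sub_le (∑ i ∈ range m, u i) (∑ i ∈ range m, u (t + i))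
  have h3 := hb u hu
  have h4 := hb (fun i => u (t + i)) (fun _ => hu _)
  linarith

lemma B3 (l s : ℕ) (B : ℝ) (hMV : MV s (l + 2) B) (b : ℤ) (hb : b ≠ 0) (A' : ℝ) (hA' : 0 ≤ A') :
    ∃ C : ℝ, 0 < C ∧ ∀ (q : ℕ) [NeZero q] (X : ℕ) (_ : 1 ≤ X) (_ : X ≤ q) (t : ℕ) (_ : t ≤ X)
      (G : Polynomial ℝ) (_ : G.natDegree ≤ l + 2) (a : ℤ) (_ : IsCoprime a (q : ℤ))
      (_ : G.coeff (l + 2) = (a * b : ℤ) / (q : ℝ)) (_ : (q : ℝ) ≤ A' * (X : ℝ) ^ (l + 1))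
      (δ : ℝ) (_ : 0 < δ) (_ : δ ≤ 1) (_ : δ * X ≤ ‖∑ i ∈ range t, e (G.eval ((i : ℝ) + 1))‖),
      δ ^ (2 * s + 1) * Real.sqrt X ≤ C := by
  obtain ⟨C, hC, h⟩ := B2 l s B hMV b hb A' hA'
  refine ⟨4 * 2 ^ (2 * s) * C, by positivity, ?_⟩
  intro q _ X hX hXq t ht G hG a ha hc hq δ hδ hδ1 hsum
  have hx : (1 : ℝ) ≤ X := by exact_mod_cast hX
  set R := ⌊δ * X / 4⌋₊ + 1 with hR
  have hRX : R ≤ X := by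
    have h1 : ⌊δ * X / 4⌋₊ < X := by
      rw [Nat.floor_lt (by positivity)]
      nlinarith
    omega
  have h2 := h q X hX (Icc (1 : ℤ) t) (Icc_subset_Icc_right (by exact_mod_cast ht)) G hG a ha hc R (hRX.trans hXq) hq
  have h3 : ∀ m ∈ range R, (δ * X / 2) ^ (2 * s) ≤ ‖∑ x ∈ Icc (1 : ℤ) t, e (G.eval ((x : ℝ) + m))‖ ^ (2 * s) := by
    intro m hm
    have hm' : m ≤ ⌊δ * X / 4⌋₊ := by rw [mem_range] at hm; omega
    have hm2 : (m : ℝ) ≤ δ * X / 4 := (Nat.le_floor_iff (by positivity)).1 hm'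
    refine pow_le_pow_left₀ (by positivity) ?_ _
    rw [sum_Icc_range t (fun x => e (G.eval ((x : ℝ) + m)))]
    have h4 := shift_bound (fun i => e (G.eval ((i : ℝ) + 1))) (fun n => (norm_e _).le) t m
    have h5 : ∑ i ∈ range t, e (G.eval (((i + m : ℕ) : ℝ) + 1)) = ∑ i ∈ range t, e (G.eval ((((i : ℤ) + 1 : ℤ) : ℝ) + m)) := by
      refine sum_congr rfl fun i _ => ?_
      congr 2
      push_cast; ring
    rw [h5] at h4
    linarith
  have h4 := card_nsmul_le_sum _ _ _ h3
  rw [card_range, nsmul_eq_mul] at h4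
  have h5 : δ * X / 4 * (δ * X / 2) ^ (2 * s) ≤ C * (X : ℝ) ^ (2 * (s : ℝ) + 1 / 2) := by
    refine le_trans ?_ (h4.trans h2)
    gcongr
    rw [hR]; push_cast
    exact (Nat.lt_floor_add_one _).le
  have hX0 : (0 : ℝ) < X := by linarith
  have h6 : (X : ℝ) ^ (2 * (s : ℝ) + 1 / 2) = (X : ℝ) ^ (2 * s) * Real.sqrt X := by
    rw [Real.rpow_add hX0, Real.sqrt_eq_rpow, ← Real.rpow_natCast]
    push_cast; rfl
  rw [h6] at h5
  have hsq : Real.sqrt X * Real.sqrt X = X := Real.mul_self_sqrt hX0.le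
  have hs0 : 0 < Real.sqrt X := Real.sqrt_pos.2 hX0
  have h7 : (δ ^ (2 * s + 1) * Real.sqrt X) * ((X : ℝ) ^ (2 * s) * Real.sqrt X) ≤
      (4 * 2 ^ (2 * s) * C) * ((X : ℝ) ^ (2 * s) * Real.sqrt X) := by
    have e1 : (δ ^ (2 * s + 1) * Real.sqrt X) * ((X : ℝ) ^ (2 * s) * Real.sqrt X) =
        4 * 2 ^ (2 * s) * (δ * X / 4 * (δ * X / 2) ^ (2 * s)) := by
      rw [div_pow, mul_pow, pow_succ]
      field_simp
      linear_combination hsq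
    rw [e1, mul_assoc (4 * 2 ^ (2 * s)) C]
    exact mul_le_mul_of_nonneg_left h5 (by positivity)
  exact le_of_mul_le_mul_right h7 (by positivity)

lemma norm_e_sub (x y : ℝ) : ‖e x - e y‖ ≤ 2 * Real.pi * |x - y| := by
  have h1 : e x - e y = e y * (e (x - y) - 1) := by
    rw [mul_sub, ← e_add]; simp
  rw [h1, norm_mul, norm_e, one_mul]
  have h2 : e (x - y) = Complex.exp (I * ((2 * Real.pi * (x - y) : ℝ) : ℂ)) := by
    unfold e; congr 1; push_cast; ring
  rw [h2]
  refine (Real.norm_exp_I_mul_ofReal_sub_one_le).trans ?_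
  rw [Real.norm_eq_abs, abs_mul, abs_of_pos Real.two_pi_pos]

/-- Abel summation bound -/
lemma abel (u w : ℕ → ℂ) (V W0 : ℝ) (L : ℕ) (hV : ∀ t ≤ L, ‖∑ i ∈ range t, u i‖ ≤ V) (hV0 : 0 ≤ V)
    (hw1 : ∀ i, ‖w i‖ ≤ W0) :
    ‖∑ i ∈ range L, u i * w i‖ ≤ V * (W0 + ∑ i ∈ range L, ‖w (i + 1) - w i‖) := by
  have h : ∀ L : ℕ, ∑ i ∈ range L, u i * w i = (∑ i ∈ range L, u i) * w L -
      ∑ i ∈ range L, (∑ j ∈ range (i + 1), u j) * (w (i + 1) - w i) := by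
    intro L
    induction L with
    | zero => simp
    | succ L ih =>
      rw [sum_range_succ, ih, sum_range_succ (fun i => (∑ j ∈ range (i + 1), u j) * (w (i + 1) - w i)),
        sum_range_succ u]
      ring
  rw [h L]
  refine (norm_sub_le _ _).trans ?_
  rw [mul_add, norm_mul]
  refine add_le_add (mul_le_mul (hV L le_rfl) (hw1 L) (norm_nonneg _) hV0) ?_
  refine (norm_sum_le _ _).trans ?_
  rw [mul_sum]
  refine sum_le_sum fun i hi => ?_
  rw [norm_mul]
  exact mul_le_mul_of_nonneg_right (hV _ (by rw [mem_range] at hi; omega)) (norm_nonneg _)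

lemma blocks (u : ℕ → ℂ) (X : ℕ) (hX : 1 ≤ X) (V : ℝ)
    (h : ∀ n0 L, L ≤ X → ‖∑ i ∈ range L, u (n0 + i)‖ ≤ V) (M : ℕ) :
    ‖∑ i ∈ range M, u i‖ ≤ ((M / X : ℕ) + 1) * V := by
  have hind : ∀ j : ℕ, ‖∑ i ∈ range (X * j), u i‖ ≤ j * V := by
    intro j
    induction j with
    | zero => simp
    | succ j ih =>
      rw [mul_add, mul_one, sum_range_add]
      refine (norm_add_le _ _).trans ?_
      have := h (X * j) X le_rfl
      push_cast; linarith
  have : M = X * (M / X) + M % X := (Nat.div_add_mod M X).symm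
  conv_lhs => rw [this, sum_range_add]
  refine (norm_add_le _ _).trans ?_
  have h1 := hind (M / X)
  have h2 := h (X * (M / X)) (M % X) (Nat.mod_lt _ hX).le
  linarith

end FE

namespace FE
open Finset

lemma B4 (l s : ℕ) (B : ℝ) (hMV : MV s (l + 2) B) (P : Polynomial ℤ) (hP : P.natDegree ≤ l + 2)
    (hb : P.coeff (l + 2) ≠ 0) (A : ℝ) (hA : 1 ≤ A) :
    ∃ C : ℝ, 0 < C ∧ ∀ (q : ℕ) [NeZero q] (M : ℕ) (_ : 1 ≤ M) (a : ℤ) (_ : IsCoprime a (q : ℤ))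
      (α : ℝ) (_ : (q : ℝ) ≤ A * (M : ℝ) ^ (l + 1)) (_ : |α - a / q| * (q * (M : ℝ) ^ (l + 1)) ≤ 1)
      (δ : ℝ) (_ : 0 < δ) (_ : δ ≤ 1)
      (_ : δ * M ≤ ‖∑ i ∈ range M, e (α * (P.eval ((i : ℤ) + 1) : ℤ))‖),
      δ ^ (2 * s + 1) * Real.sqrt (min M q : ℕ) ≤ C := by
  set b := P.coeff (l + 2) with hbdef
  obtain ⟨C, hC, h⟩ := B3 l s B hMV b hb A (by linarith)
  set K : ℝ := 1 + 2 * Real.pi * |(b : ℝ)| with hK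
  have hK1 : 1 ≤ K := by
    have : 0 ≤ 2 * Real.pi * |(b : ℝ)| := by positivity
    linarith
  refine ⟨(4 * K) ^ (2 * s + 1) * C, by positivity, ?_⟩
  intro q _ M hM a ha α hq hα δ hδ hδ1 hsum
  by_contra hcon
  push Not at hcon
  set X := min M q with hXdef
  have hq1 : 1 ≤ q := NeZero.one_le
  have hX1 : 1 ≤ X := le_min hM hq1
  have hXM : X ≤ M := min_le_left _ _
  have hXq : X ≤ q := min_le_right _ _
  have hx : (1 : ℝ) ≤ X := by exact_mod_cast hX1
  have hXMr : (X : ℝ) ≤ M := by exact_mod_cast hXM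
  have hXqr : (X : ℝ) ≤ q := by exact_mod_cast hXq
  have hqX : (q : ℝ) ≤ A * (X : ℝ) ^ (l + 1) := by
    rcases le_total M q with h1 | h1
    · have : X = M := min_eq_left h1
      rw [this]; exact hq
    · have : X = q := min_eq_right h1
      rw [this] at hx ⊢
      calc (q : ℝ) = 1 * (q : ℝ) ^ 1 := by ring
        _ ≤ A * (q : ℝ) ^ (l + 1) := by
          gcongr
          omega
  set δ' := δ / (4 * K) with hδ'
  have hδ'0 : 0 < δ' := by positivity
  have hδ'1 : δ' ≤ 1 := by rw [hδ', div_le_one (by positivity)]; linarith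
  set β : ℝ := α - a / q with hβ
  set Pr : Polynomial ℝ := P.map (Int.castRingHom ℝ) with hPr
  have hPrd : Pr.natDegree ≤ l + 2 := (Polynomial.natDegree_map_le).trans hP
  have hPrc : Pr.coeff (l + 2) = b := by rw [hPr, Polynomial.coeff_map]; rfl
  have hPre : ∀ z : ℤ, Pr.eval (z : ℝ) = (P.eval z : ℤ) := by
    intro z
    rw [hPr, Polynomial.eval_intCast_map]; rfl
  have hqp : (0 : ℝ) < q := by exact_mod_cast hq1
  have hsmall : ∀ n0 t : ℕ, t ≤ X → ‖∑ i ∈ range t,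
      e (α * (P.eval (((n0 + i : ℕ) : ℤ) + 1) : ℤ) - β * b * ((i : ℝ) + 1) ^ (l + 2))‖ ≤ δ' * X := by
    intro n0 t ht
    by_contra hc
    push Not at hc
    set G : Polynomial ℝ := Polynomial.C α * Polynomial.taylor (n0 : ℝ) Pr -
      Polynomial.C (β * b) * Polynomial.X ^ (l + 2) with hG
    have hGd : G.natDegree ≤ l + 2 := by
      refine (Polynomial.natDegree_sub_le _ _).trans (max_le ?_ (Polynomial.natDegree_C_mul_X_pow_le _ _))
      refine (Polynomial.natDegree_C_mul_le _ _).trans ?_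
      rw [Polynomial.natDegree_taylor]; exact hPrd
    have hGc : G.coeff (l + 2) = (a * b : ℤ) / (q : ℝ) := by
      rw [hG, Polynomial.coeff_sub, Polynomial.coeff_C_mul, Polynomial.coeff_C_mul_X_pow, if_pos rfl,
        taylor_c2 Pr hPrd, hPrc, hβ]
      push_cast; ring
    have hGe : ∀ i : ℕ, G.eval ((i : ℝ) + 1) =
        α * (P.eval (((n0 + i : ℕ) : ℤ) + 1) : ℤ) - β * b * ((i : ℝ) + 1) ^ (l + 2) := by
      intro i
      rw [hG, Polynomial.eval_sub, Polynomial.eval_C_mul, Polynomial.eval_C_mul, Polynomial.eval_pow,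
        Polynomial.eval_X, Polynomial.taylor_eval, ← hPre]
      congr 3
      push_cast; ring
    have h1 := h q X hX1 hXq t ht G hGd a ha hGc hqX δ' hδ'0 hδ'1 (by
      rw [sum_congr rfl (fun i _ => by rw [hGe i])]; exact hc.le)
    rw [hδ', div_pow, div_mul_eq_mul_div, div_le_iff₀ (by positivity)] at h1
    linarith
  have hvar : |β * b| * (X : ℝ) ^ (l + 2) ≤ |(b : ℝ)| := by
    have h1 : (X : ℝ) ^ (l + 2) ≤ q * (M : ℝ) ^ (l + 1) := by
      calc (X : ℝ) ^ (l + 2) = X * (X : ℝ) ^ (l + 1) := by ring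
        _ ≤ _ := by gcongr
    rw [abs_mul]
    calc |β| * |(b : ℝ)| * (X : ℝ) ^ (l + 2) ≤ |β| * |(b : ℝ)| * (q * (M : ℝ) ^ (l + 1)) := by gcongr
      _ = |β| * (q * (M : ℝ) ^ (l + 1)) * |(b : ℝ)| := by ring
      _ ≤ 1 * |(b : ℝ)| := by gcongr
      _ = _ := one_mul _
  have hblock : ∀ n0 L : ℕ, L ≤ X → ‖∑ i ∈ range L, e (α * (P.eval (((n0 + i : ℕ) : ℤ) + 1) : ℤ))‖ ≤ δ' * X * K := by
    intro n0 L hL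
    -- shift the weight index so that the total variation telescopes up to L ^ (l+2)
    have h1 := abel (fun i => e (α * (P.eval (((n0 + i : ℕ) : ℤ) + 1) : ℤ) - β * b * ((i : ℝ) + 1) ^ (l + 2)))
      (fun i => e (β * b * (((min (i + 1) L : ℕ) : ℝ)) ^ (l + 2))) (δ' * X) 1 L
      (fun t ht => hsmall n0 t (ht.trans hL)) (by positivity) (fun i => (norm_e _).le)
    have h2 : ∑ i ∈ range L, e (α * (P.eval (((n0 + i : ℕ) : ℤ) + 1) : ℤ)) =
        ∑ i ∈ range L, e (α * (P.eval (((n0 + i : ℕ) : ℤ) + 1) : ℤ) - β * b * ((i : ℝ) + 1) ^ (l + 2)) *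
          e (β * b * (((min (i + 1) L : ℕ) : ℝ)) ^ (l + 2)) := by
      refine sum_congr rfl fun i hi => ?_
      have : min (i + 1) L = i + 1 := min_eq_left (by rw [mem_range] at hi; omega)
      rw [this, ← e_add]
      congr 1
      push_cast; ring
    rw [h2]
    refine h1.trans ?_
    refine mul_le_mul_of_nonneg_left ?_ (by positivity)
    rw [hK]
    refine add_le_add le_rfl ?_
    have h3 : ∀ i ∈ range L, ‖e (β * b * (((min (i + 1 + 1) L : ℕ) : ℝ)) ^ (l + 2)) - e (β * b * (((min (i + 1) L : ℕ) : ℝ)) ^ (l + 2))‖ ≤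
        2 * Real.pi * (|β * b| * ((((min (i + 1 + 1) L : ℕ) : ℝ)) ^ (l + 2) - (((min (i + 1) L : ℕ) : ℝ)) ^ (l + 2))) := by
      intro i _
      refine (norm_e_sub _ _).trans (le_of_eq ?_)
      rw [← mul_sub, abs_mul]
      congr 2
      apply abs_of_nonneg
      rw [sub_nonneg]
      gcongr
      omega
    refine (sum_le_sum h3).trans ?_
    rw [← mul_sum, ← mul_sum, sum_range_sub (fun i => (((min (i + 1) L : ℕ) : ℝ)) ^ (l + 2))]
    refine mul_le_mul_of_nonneg_left (le_trans ?_ hvar) (by positivity)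
    refine mul_le_mul_of_nonneg_left ?_ (abs_nonneg _)
    have h4 : (((min (L + 1) L : ℕ) : ℝ)) ^ (l + 2) ≤ (X : ℝ) ^ (l + 2) := by
      gcongr
      exact (min_le_right _ _).trans hL
    have h5 : 0 ≤ (((min (0 + 1) L : ℕ) : ℝ)) ^ (l + 2) := by positivity
    linarith
  have hfin := blocks (fun i : ℕ => e (α * (P.eval ((i : ℤ) + 1) : ℤ))) X hX1 (δ' * X * K) hblock M
  have h6 : ((M / X : ℕ) + 1 : ℝ) ≤ 2 * (M / X) := by
    have h7 : ((M / X : ℕ) : ℝ) ≤ (M : ℝ) / X := Nat.cast_div_le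
    have h8 : 1 ≤ (M : ℝ) / X := by rw [le_div_iff₀ (by linarith)]; linarith
    linarith
  have h9 : ((M / X : ℕ) + 1 : ℝ) * (δ' * X * K) ≤ δ * M / 2 := by
    refine (mul_le_mul_of_nonneg_right h6 (by positivity)).trans (le_of_eq ?_)
    rw [hδ']
    have : (X : ℝ) ≠ 0 := by linarith
    field_simp
    norm_num
  have : 0 < δ * M := by
    have : (0 : ℝ) < M := by linarith
    positivity
  linarith

end FE

namespace FE
open Finset

lemma norm_e_sub_one (x : ℝ) (hx : |x| ≤ 1 / 2) : 4 * |x| ≤ ‖e x - 1‖ := by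
  have h2 : e x = Complex.exp (I * ((2 * Real.pi * x : ℝ) : ℂ)) := by
    unfold e; congr 1; push_cast; ring
  rw [h2, Complex.norm_exp_I_mul_ofReal_sub_one, norm_mul, Real.norm_eq_abs, Real.norm_eq_abs, abs_two]
  have h3 : 2 * Real.pi * x / 2 = Real.pi * x := by ring
  rw [h3]
  have hpi := Real.pi_pos
  have h4 : 2 / Real.pi * (Real.pi * |x|) ≤ Real.sin (Real.pi * |x|) := by
    apply Real.mul_le_sin (by positivity)
    nlinarith
  have h5 : 2 / Real.pi * (Real.pi * |x|) = 2 * |x| := by field_simp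
  rw [h5] at h4
  have h6 : Real.sin (Real.pi * |x|) ≤ |Real.sin (Real.pi * x)| := by
    rcases abs_cases x with ⟨h, _⟩ | ⟨h, _⟩
    · rw [h]; exact le_abs_self _
    · rw [h, mul_neg, Real.sin_neg]; exact neg_le_abs _
  linarith

lemma KL (u : ℕ → ℂ) (φ : ℕ → ℝ) (q i1 M : ℕ) (hiM : i1 ≤ M) (hu : ∀ n, ‖u n‖ ≤ 1)
    (hrec : ∀ n, u (n + q) = u n * e (φ n)) (m0 v : ℝ) (hm0 : 0 < m0) (hv0 : 0 ≤ v)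
    (h1 : ∀ n, i1 ≤ n → n < M + q → m0 ≤ |φ n|) (h2 : ∀ n, i1 ≤ n → n < M + q → |φ n| ≤ 1 / 2)
    (hv : ∀ n, i1 ≤ n → n < M → |φ (n + q) - φ n| ≤ v) :
    ‖∑ n ∈ Ico i1 M, u n‖ ≤ M * (v / m0 ^ 2) + q / m0 := by
  set w : ℕ → ℂ := fun n => (e (φ n) - 1)⁻¹ with hw
  have hpos : ∀ n, i1 ≤ n → n < M + q → 4 * m0 ≤ ‖e (φ n) - 1‖ := fun n ha hb =>
    (mul_le_mul_of_nonneg_left (h1 n ha hb) (by norm_num)).trans (norm_e_sub_one _ (h2 n ha hb))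
  have hne : ∀ n, i1 ≤ n → n < M + q → e (φ n) - 1 ≠ 0 := fun n ha hb h => by
    have := hpos n ha hb
    rw [h, norm_zero] at this
    linarith
  have hwn : ∀ n, i1 ≤ n → n < M + q → ‖w n‖ ≤ 1 / (4 * m0) := by
    intro n ha hb
    rw [hw]
    simp only [norm_inv]
    rw [one_div]
    exact inv_anti₀ (by positivity) (hpos n ha hb)
  have hwd : ∀ n, i1 ≤ n → n < M → ‖w n - w (n + q)‖ ≤ v / m0 ^ 2 := by
    intro n ha hb
    have ha1 := hpos n ha (by omega)
    have ha2 := hpos (n + q) (by omega) (by omega)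
    have e1 : w n - w (n + q) = (e (φ (n + q)) - e (φ n)) * (w n * w (n + q)) := by
      rw [hw]
      have := hne n ha (by omega)
      have := hne (n + q) (by omega) (by omega)
      simp only
      field_simp
      ring
    rw [e1, norm_mul, norm_mul]
    have b1 := hwn n ha (by omega)
    have b2 := hwn (n + q) (by omega) (by omega)
    have b3 : ‖e (φ (n + q)) - e (φ n)‖ ≤ 8 * v := by
      refine (norm_e_sub _ _).trans ?_
      have := hv n ha hb
      have hpi := Real.pi_lt_four
      have hpi0 := Real.pi_pos
      nlinarith [abs_nonneg (φ (n + q) - φ n)]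
    calc ‖e (φ (n + q)) - e (φ n)‖ * (‖w n‖ * ‖w (n + q)‖) ≤ 8 * v * (1 / (4 * m0) * (1 / (4 * m0))) := by gcongr
      _ = (v / m0 ^ 2) * (1 / 2) := by field_simp; ring
      _ ≤ v / m0 ^ 2 := by
        have : 0 ≤ v / m0 ^ 2 := by positivity
        linarith
  have hmain : ∑ n ∈ Ico i1 M, u n = ∑ n ∈ Ico i1 M, u (n + q) * (w n - w (n + q)) +
      (∑ n ∈ Ico M (M + q), u n * w n - ∑ n ∈ Ico i1 (i1 + q), u n * w n) := by
    have e1 : ∑ n ∈ Ico i1 M, u n = ∑ n ∈ Ico i1 M, (u (n + q) * (w n - w (n + q)) + (u (n + q) * w (n + q) - u n * w n)) := by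
      refine sum_congr rfl fun n hn => ?_
      rw [mem_Ico] at hn
      have := hne n hn.1 (by omega)
      have e2 : (u (n + q) - u n) * w n = u n := by
        rw [hrec, hw]; simp only; field_simp
      linear_combination -e2
    rw [e1, sum_add_distrib, sum_sub_distrib]
    congr 1
    rw [sum_Ico_add' (fun n => u n * w n) i1 M q]
    have a1 := sum_Ico_consecutive (fun n => u n * w n) (show i1 ≤ i1 + q by omega) (show i1 + q ≤ M + q by omega)
    have a2 := sum_Ico_consecutive (fun n => u n * w n) hiM (show M ≤ M + q by omega)
    linear_combination a1 - a2
  rw [hmain]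
  have t1 : ‖∑ n ∈ Ico i1 M, u (n + q) * (w n - w (n + q))‖ ≤ M * (v / m0 ^ 2) := by
    refine (norm_sum_le _ _).trans ((sum_le_card_nsmul _ _ (v / m0 ^ 2) fun n hn => ?_).trans ?_)
    · rw [mem_Ico] at hn
      rw [norm_mul]
      have := hwd n hn.1 hn.2
      calc _ ≤ 1 * (v / m0 ^ 2) := mul_le_mul (hu _) this (norm_nonneg _) zero_le_one
        _ = _ := one_mul _
    · rw [nsmul_eq_mul, Nat.card_Ico]
      refine mul_le_mul_of_nonneg_right ?_ (by positivity)
      exact_mod_cast Nat.sub_le _ _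
  have t2 : ∀ c : ℕ, i1 ≤ c → c ≤ M → ‖∑ n ∈ Ico c (c + q), u n * w n‖ ≤ q * (1 / (4 * m0)) := by
    intro c hc1 hc2
    refine (norm_sum_le _ _).trans ((sum_le_card_nsmul _ _ (1 / (4 * m0)) fun n hn => ?_).trans ?_)
    · rw [mem_Ico] at hn
      rw [norm_mul]
      calc _ ≤ 1 * (1 / (4 * m0)) := mul_le_mul (hu _) (hwn n (by omega) (by omega)) (norm_nonneg _) zero_le_one
        _ = _ := one_mul _
    · rw [nsmul_eq_mul, Nat.card_Ico]
      simp
  have t3 := t2 M hiM le_rfl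
  have t4 := t2 i1 le_rfl hiM
  have t5 : (q : ℝ) * (1 / (4 * m0)) = (q / m0) / 4 := by field_simp
  rw [t5] at t3 t4
  have t6 : 0 ≤ (q : ℝ) / m0 := by positivity
  refine (norm_add_le _ _).trans (add_le_add t1 ((norm_sub_le _ _).trans ?_))
  linarith

lemma pow_diff1 (x h z : ℝ) (hx : 0 ≤ x) (hh : 0 ≤ h) (hz : x + h ≤ z) (j : ℕ) :
    z * |(x + h) ^ j - x ^ j| ≤ j * h * z ^ j := by
  have hz0 : 0 ≤ z := by linarith
  induction j with
  | zero => simp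
  | succ j ih =>
    have e1 : (x + h) ^ (j + 1) - x ^ (j + 1) = (x + h) * ((x + h) ^ j - x ^ j) + h * x ^ j := by ring
    rw [e1]
    have h1 : x ^ j ≤ z ^ j := pow_le_pow_left₀ hx (by linarith) j
    have h2 := abs_add_le ((x + h) * ((x + h) ^ j - x ^ j)) (h * x ^ j)
    rw [abs_mul, abs_mul, abs_of_nonneg hh, abs_of_nonneg (by linarith : 0 ≤ x + h), abs_of_nonneg (pow_nonneg hx j)] at h2
    calc z * _ ≤ z * ((x + h) * |(x + h) ^ j - x ^ j| + h * x ^ j) := by gcongr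
      _ ≤ z * (z * |(x + h) ^ j - x ^ j| + h * z ^ j) := by gcongr
      _ ≤ z * (j * h * z ^ j + h * z ^ j) := by gcongr
      _ = _ := by push_cast; ring

lemma pow_diff2 (x h z : ℝ) (hx : 0 ≤ x) (hh : 0 ≤ h) (hz : x + 2 * h ≤ z) (j : ℕ) :
    z ^ 2 * |(x + 2 * h) ^ j - 2 * (x + h) ^ j + x ^ j| ≤ j ^ 2 * h ^ 2 * z ^ j := by
  have hz0 : 0 ≤ z := by linarith
  induction j with
  | zero => norm_num
  | succ j ih =>
    have e1 : (x + 2 * h) ^ (j + 1) - 2 * (x + h) ^ (j + 1) + x ^ (j + 1) =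
      (x + h) * ((x + 2 * h) ^ j - 2 * (x + h) ^ j + x ^ j) + h * ((x + 2 * h) ^ j - x ^ j) := by ring
    rw [e1]
    have h1 := pow_diff1 x (2 * h) z hx (by linarith) hz j
    have h2 := abs_add_le ((x + h) * ((x + 2 * h) ^ j - 2 * (x + h) ^ j + x ^ j)) (h * ((x + 2 * h) ^ j - x ^ j))
    rw [abs_mul, abs_mul, abs_of_nonneg hh, abs_of_nonneg (by linarith : 0 ≤ x + h)] at h2
    set a := |(x + 2 * h) ^ j - 2 * (x + h) ^ j + x ^ j|
    set c := |(x + 2 * h) ^ j - x ^ j|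
    calc z ^ 2 * _ ≤ z ^ 2 * ((x + h) * a + h * c) := by gcongr
      _ ≤ z ^ 2 * (z * a + h * c) := by gcongr; linarith
      _ = z * (z ^ 2 * a) + z * h * (z * c) := by ring
      _ ≤ z * (j ^ 2 * h ^ 2 * z ^ j) + z * h * (j * (2 * h) * z ^ j) := by gcongr
      _ = (j ^ 2 + 2 * j) * h ^ 2 * z ^ (j + 1) := by ring
      _ ≤ _ := by push_cast; gcongr; linarith

lemma pow_low (x h : ℝ) (hx : 0 ≤ x) (hh : 0 ≤ h) (j : ℕ) :
    h * (x + h) ^ (j + 1) ≤ (x + h) * ((x + h) ^ (j + 1) - x ^ (j + 1)) := by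
  have h1 : x ^ j ≤ (x + h) ^ j := pow_le_pow_left₀ hx (by linarith) j
  have h2 : (x + h) * ((x + h) ^ (j + 1) - x ^ (j + 1)) - h * (x + h) ^ (j + 1) =
     (x + h) * x * ((x + h) ^ j - x ^ j) := by ring
  have : 0 ≤ (x + h) * x * ((x + h) ^ j - x ^ j) := mul_nonneg (by positivity) (by linarith)
  linarith

lemma poly_bounds (l : ℕ) (P : Polynomial ℤ) (hP : P.natDegree ≤ l + 2) (hb : P.coeff (l + 2) ≠ 0) :
    ∃ S : ℝ, 1 ≤ S ∧ ∀ (n h : ℕ), 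
      (∀ z : ℝ, 1 ≤ z → (n : ℝ) + h ≤ z → |((P.eval ((n : ℤ) + h) : ℤ) : ℝ) - ((P.eval (n : ℤ) : ℤ) : ℝ)| ≤ S * h * z ^ (l + 1)) ∧
      (∀ z : ℝ, 1 ≤ z → (n : ℝ) + 2 * h ≤ z → |((P.eval ((n : ℤ) + 2 * h) : ℤ) : ℝ) - 2 * ((P.eval ((n : ℤ) + h) : ℤ) : ℝ) + ((P.eval (n : ℤ) : ℤ) : ℝ)| ≤ S * h ^ 2 * z ^ l) ∧
      (S ≤ n + h → (h : ℝ) * ((n : ℝ) + h) ^ (l + 1) / 2 ≤ |((P.eval ((n : ℤ) + h) : ℤ) : ℝ) - ((P.eval (n : ℤ) : ℤ) : ℝ)|) := by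
  have hev : ∀ z : ℤ, ((P.eval z : ℤ) : ℝ) = ∑ j ∈ range (l + 3), (P.coeff j : ℝ) * (z : ℝ) ^ j := by
    intro z
    rw [Polynomial.eval_eq_sum_range' (n := l + 3) (by omega)]
    push_cast; rfl
  set S1 : ℝ := ∑ j ∈ range (l + 3), |(P.coeff j : ℝ)| * j with hS1
  set S2 : ℝ := ∑ j ∈ range (l + 3), |(P.coeff j : ℝ)| * j ^ 2 with hS2
  have hS1n : 0 ≤ S1 := sum_nonneg fun j _ => by positivity
  have hS2n : 0 ≤ S2 := sum_nonneg fun j _ => by positivity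
  refine ⟨1 + 2 * S1 + S2, by linarith, fun n h => ⟨?_, ?_, ?_⟩⟩
  · intro z hz hnz
    rw [hev, hev]
    push_cast
    rw [← sum_sub_distrib]
    have key : z * |∑ j ∈ range (l + 3), ((P.coeff j : ℝ) * ((n : ℝ) + h) ^ j - (P.coeff j : ℝ) * (n : ℝ) ^ j)| ≤
        S1 * h * z ^ (l + 2) := by
      refine (mul_le_mul_of_nonneg_left (abs_sum_le_sum_abs _ _) (by linarith)).trans ?_
      rw [mul_sum, hS1, sum_mul, sum_mul]
      refine sum_le_sum fun j hj => ?_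
      rw [← mul_sub, abs_mul]
      have h1 := pow_diff1 n h z (by positivity) (by positivity) hnz j
      have h2 : z ^ j ≤ z ^ (l + 2) := pow_le_pow_right₀ hz (by rw [mem_range] at hj; omega)
      calc z * (|(P.coeff j : ℝ)| * |((n : ℝ) + h) ^ j - (n : ℝ) ^ j|) = |(P.coeff j : ℝ)| * (z * |((n : ℝ) + h) ^ j - (n : ℝ) ^ j|) := by ring
        _ ≤ |(P.coeff j : ℝ)| * (j * h * z ^ j) := by gcongr
        _ ≤ |(P.coeff j : ℝ)| * (j * h * z ^ (l + 2)) := by gcongr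
        _ = _ := by ring
    have hz0 : 0 < z := by linarith
    refine le_of_mul_le_mul_left (key.trans ?_) hz0
    calc S1 * h * z ^ (l + 2) ≤ (1 + 2 * S1 + S2) * h * z ^ (l + 2) := by gcongr; linarith
      _ = _ := by ring
  · intro z hz hnz
    rw [hev, hev, hev]
    push_cast
    rw [mul_sum, ← sum_sub_distrib, ← sum_add_distrib]
    have key : z ^ 2 * |∑ j ∈ range (l + 3), ((P.coeff j : ℝ) * ((n : ℝ) + 2 * h) ^ j - 2 * ((P.coeff j : ℝ) * ((n : ℝ) + h) ^ j) + (P.coeff j : ℝ) * (n : ℝ) ^ j)| ≤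
        S2 * h ^ 2 * z ^ (l + 2) := by
      refine (mul_le_mul_of_nonneg_left (abs_sum_le_sum_abs _ _) (by positivity)).trans ?_
      rw [mul_sum, hS2, sum_mul, sum_mul]
      refine sum_le_sum fun j hj => ?_
      have e1 : (P.coeff j : ℝ) * ((n : ℝ) + 2 * h) ^ j - 2 * ((P.coeff j : ℝ) * ((n : ℝ) + h) ^ j) + (P.coeff j : ℝ) * (n : ℝ) ^ j =
        (P.coeff j : ℝ) * (((n : ℝ) + 2 * h) ^ j - 2 * ((n : ℝ) + h) ^ j + (n : ℝ) ^ j) := by ring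
      rw [e1, abs_mul]
      have h1 := pow_diff2 n h z (by positivity) (by positivity) hnz j
      have h2 : z ^ j ≤ z ^ (l + 2) := pow_le_pow_right₀ hz (by rw [mem_range] at hj; omega)
      set a := |((n : ℝ) + 2 * h) ^ j - 2 * ((n : ℝ) + h) ^ j + (n : ℝ) ^ j|
      calc z ^ 2 * (|(P.coeff j : ℝ)| * a) = |(P.coeff j : ℝ)| * (z ^ 2 * a) := by ring
        _ ≤ |(P.coeff j : ℝ)| * (j ^ 2 * h ^ 2 * z ^ j) := by gcongr
        _ ≤ |(P.coeff j : ℝ)| * (j ^ 2 * h ^ 2 * z ^ (l + 2)) := by gcongr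
        _ = _ := by ring
    have hz0 : 0 < z ^ 2 := by positivity
    refine le_of_mul_le_mul_left (key.trans ?_) hz0
    calc S2 * h ^ 2 * z ^ (l + 2) ≤ (1 + 2 * S1 + S2) * h ^ 2 * z ^ (l + 2) := by gcongr; linarith
      _ = _ := by ring
  · intro hS
    rw [hev, hev]
    push_cast
    rw [← sum_sub_distrib, sum_range_succ]
    set x : ℝ := (n : ℝ) + h with hx
    have hx1 : 1 ≤ x := by linarith
    have hx2 : 2 * S1 ≤ x := by linarith
    set r := ∑ j ∈ range (l + 2), ((P.coeff j : ℝ) * x ^ j - (P.coeff j : ℝ) * (n : ℝ) ^ j) with hr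
    have hrb : x * |r| ≤ S1 * h * x ^ (l + 1) := by
      refine (mul_le_mul_of_nonneg_left (abs_sum_le_sum_abs _ _) (by linarith)).trans ?_
      have : S1 * h * x ^ (l + 1) ≥ (∑ j ∈ range (l + 2), |(P.coeff j : ℝ)| * j) * h * x ^ (l + 1) := by
        rw [hS1, sum_range_succ _ (l + 2)]
        gcongr
        have : 0 ≤ |(P.coeff (l + 2) : ℝ)| * ((l + 2 : ℕ) : ℝ) := by positivity
        linarith
      refine le_trans ?_ this
      rw [mul_sum, sum_mul, sum_mul]
      refine sum_le_sum fun j hj => ?_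
      rw [← mul_sub, abs_mul]
      have h1 := pow_diff1 n h x (by positivity) (by positivity) le_rfl j
      have h2 : x ^ j ≤ x ^ (l + 1) := pow_le_pow_right₀ hx1 (by rw [mem_range] at hj; omega)
      calc x * (|(P.coeff j : ℝ)| * |x ^ j - (n : ℝ) ^ j|) = |(P.coeff j : ℝ)| * (x * |x ^ j - (n : ℝ) ^ j|) := by ring
        _ ≤ |(P.coeff j : ℝ)| * (j * h * x ^ j) := by gcongr
        _ ≤ |(P.coeff j : ℝ)| * (j * h * x ^ (l + 1)) := by gcongr
        _ = _ := by ring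
    have hlow := pow_low n h (by positivity) (by positivity) (l + 1)
    rw [← hx] at hlow
    rw [show l + 1 + 1 = l + 2 by ring] at hlow
    set y : ℝ := x ^ (l + 2) - (n : ℝ) ^ (l + 2) with hy
    have hb1 : (1 : ℝ) ≤ |(P.coeff (l + 2) : ℝ)| := by
      exact_mod_cast Int.one_le_abs hb
    have hx0 : 0 < x := by linarith
    have hy0 : 0 ≤ y := by
      have : 0 ≤ x * y := le_trans (by positivity) hlow
      exact nonneg_of_mul_nonneg_right this hx0
    have h5 : x * y ≤ x * |(P.coeff (l + 2) : ℝ) * x ^ (l + 2) - (P.coeff (l + 2) : ℝ) * (n : ℝ) ^ (l + 2)| := by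
      rw [← mul_sub, abs_mul, ← hy, abs_of_nonneg hy0]
      gcongr
      nlinarith
    set g := (P.coeff (l + 2) : ℝ) * x ^ (l + 2) - (P.coeff (l + 2) : ℝ) * (n : ℝ) ^ (l + 2) with hg
    have h6 : |g| - |r| ≤ |r + g| := by
      have := abs_sub_abs_le_abs_sub g (-r)
      rw [abs_neg, sub_neg_eq_add, add_comm g r] at this
      exact this
    refine le_of_mul_le_mul_left ?_ hx0
    have h7 : S1 * h * x ^ (l + 1) ≤ x / 2 * h * x ^ (l + 1) := by gcongr; linarith
    have h8 : x * (|g| - |r|) ≤ x * |r + g| := by gcongr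
    have h9 : x * ((h : ℝ) * x ^ (l + 1) / 2) = h * x ^ (l + 2) - x / 2 * h * x ^ (l + 1) := by ring
    rw [h9]
    linarith

end FE

namespace FE
open Finset

lemma e_int (n : ℤ) : e (n : ℝ) = 1 := by
  have := e_std 1 n
  simp only [Nat.cast_one, div_one] at this
  rw [this]
  have : (n : ZMod 1) = 0 := Subsingleton.elim _ _
  rw [this]; simp

lemma E1_alg (l : ℕ) (S b δ M q X : ℝ) (hS : 1 ≤ S) (hb : 0 < b) (hδ : 0 < δ) (hδ1 : δ ≤ 1) (hM : 0 < M)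
    (hq : 0 < q) (hX : X = δ * M / 2)
    (h : X ≤ M * (S * b * q ^ 2 * (4 * M) ^ l / (b * q * X ^ (l + 1) / 2) ^ 2) + q / (b * q * X ^ (l + 1) / 2)) :
    b * M ^ (l + 2) * δ ^ (2 * l + 3) ≤ 2 ^ (2 * l + 3) * (4 * S * 4 ^ l + 2) := by
  have hX0 : 0 < X := by rw [hX]; positivity
  have hXM : X ≤ M := by rw [hX]; nlinarith
  have h1 : M * (S * b * q ^ 2 * (4 * M) ^ l / (b * q * X ^ (l + 1) / 2) ^ 2) + q / (b * q * X ^ (l + 1) / 2) =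
     (4 * S * 4 ^ l * M ^ (l + 1) + 2 * X ^ (l + 1)) / (b * (X ^ (l + 1)) ^ 2) := by
    rw [mul_pow]
    field_simp; ring
  rw [h1, le_div_iff₀ (by positivity)] at h
  have h2 : X ^ (l + 1) ≤ M ^ (l + 1) := by gcongr
  have h3 : b * X ^ (2 * l + 3) ≤ (4 * S * 4 ^ l + 2) * M ^ (l + 1) := by
    calc b * X ^ (2 * l + 3) = X * (b * (X ^ (l + 1)) ^ 2) := by ring
      _ ≤ _ := h
      _ ≤ 4 * S * 4 ^ l * M ^ (l + 1) + 2 * M ^ (l + 1) := by gcongr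
      _ = _ := by ring
  have h4 : b * X ^ (2 * l + 3) * 2 ^ (2 * l + 3) = b * M ^ (l + 2) * δ ^ (2 * l + 3) * M ^ (l + 1) := by
    rw [mul_assoc, ← mul_pow, hX]
    have : δ * M / 2 * 2 = δ * M := by ring
    rw [this, mul_pow]; ring
  have h5 : b * M ^ (l + 2) * δ ^ (2 * l + 3) * M ^ (l + 1) ≤ 2 ^ (2 * l + 3) * (4 * S * 4 ^ l + 2) * M ^ (l + 1) := by
    rw [← h4]
    have : (0 : ℝ) ≤ 2 ^ (2 * l + 3) := by positivity
    nlinarith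
  exact le_of_mul_le_mul_right h5 (by positivity)

set_option maxHeartbeats 1000000 in
lemma E1 (l : ℕ) (P : Polynomial ℤ) (hP : P.natDegree ≤ l + 2) (hb : P.coeff (l + 2) ≠ 0) :
    ∃ A C : ℝ, 1 ≤ A ∧ 0 < C ∧ ∀ (q M : ℕ) (_ : 1 ≤ q) (_ : q ≤ M) (a : ℤ) (α δ : ℝ)
      (_ : |α - a / q| * (q * (A * (M : ℝ) ^ (l + 1))) ≤ 1) (_ : 0 < δ) (_ : δ ≤ 1) (_ : C ≤ δ * M)
      (_ : δ * M ≤ ‖∑ i ∈ range M, e (α * (P.eval ((i : ℤ) + 1) : ℤ))‖),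
      |α - a / q| * (M : ℝ) ^ (l + 2) * δ ^ (2 * l + 3) ≤ C := by
  obtain ⟨S, hS, hPB⟩ := poly_bounds l P hP hb
  have h4l : (1 : ℝ) ≤ 4 ^ (l + 1) := one_le_pow₀ (by norm_num)
  refine ⟨2 * S * 4 ^ (l + 1), 2 ^ (2 * l + 3) * (4 * S * 4 ^ l + 2) + 2 * S, by nlinarith, by positivity, ?_⟩
  intro q M hq hqM a α δ hβ hδ hδ1 hCM hsum
  set β := α - a / q with hβd
  have hM : 1 ≤ M := hq.trans hqM
  have hMr : (1 : ℝ) ≤ M := by exact_mod_cast hM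
  have hqr : (1 : ℝ) ≤ q := by exact_mod_cast hq
  have hqMr : (q : ℝ) ≤ M := by exact_mod_cast hqM
  have hC1 : 0 ≤ 2 ^ (2 * l + 3) * (4 * S * 4 ^ l + 2) := by positivity
  rcases eq_or_ne β 0 with h0 | h0
  · rw [h0]; simp; linarith
  have hβ0 : 0 < |β| := abs_pos.mpr h0
  set X : ℝ := δ * M / 2 with hX
  have hXS : S ≤ X := by rw [hX]; linarith
  set i1 := ⌊X⌋₊ with hi1
  have hX0 : 0 ≤ X := by linarith
  have hi1X : (i1 : ℝ) ≤ X := Nat.floor_le hX0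
  have hi1X' : X < i1 + 1 := Nat.lt_floor_add_one X
  have hXM : X ≤ M := by rw [hX]; nlinarith
  have hiM : i1 ≤ M := by
    have : (i1 : ℝ) ≤ M := hi1X.trans hXM
    exact_mod_cast this
  set u : ℕ → ℂ := fun i => e (α * (P.eval ((i : ℤ) + 1) : ℤ)) with hu
  set φ : ℕ → ℝ := fun i => β * (((P.eval ((i : ℤ) + 1 + q) : ℤ) : ℝ) - ((P.eval ((i : ℤ) + 1) : ℤ) : ℝ)) with hφ
  have hun : ∀ n, ‖u n‖ ≤ 1 := fun n => by rw [hu]; simp only [norm_e]; exact le_rfl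
  have hrec : ∀ n, u (n + q) = u n * e (φ n) := by
    intro n
    obtain ⟨d, hd⟩ : (q : ℤ) ∣ P.eval ((n : ℤ) + 1 + q) - P.eval ((n : ℤ) + 1) := by
      have := Polynomial.sub_dvd_eval_sub ((n : ℤ) + 1 + q) ((n : ℤ) + 1) P
      simpa using this
    have hd' : ((P.eval ((n : ℤ) + 1 + q) : ℤ) : ℝ) = ((P.eval ((n : ℤ) + 1) : ℤ) : ℝ) + q * d := by
      have : P.eval ((n : ℤ) + 1 + q) = P.eval ((n : ℤ) + 1) + q * d := by linarith
      rw [this]; push_cast; ring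
    have e1 : (((n + q : ℕ) : ℤ) + 1) = (n : ℤ) + 1 + q := by push_cast; ring
    rw [hu, hφ]
    simp only []
    rw [e1]
    have e2 : α * ((P.eval ((n : ℤ) + 1 + q) : ℤ) : ℝ) = α * ((P.eval ((n : ℤ) + 1) : ℤ) : ℝ) +
       β * (((P.eval ((n : ℤ) + 1 + q) : ℤ) : ℝ) - ((P.eval ((n : ℤ) + 1) : ℤ) : ℝ)) + ((a * d : ℤ) : ℝ) := by
      rw [hd', hβd]; push_cast; field_simp; ring
    rw [e2, e_add, e_add, e_int, mul_one]
  have hlow : X - 1 < i1 := by linarith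
  have key := KL u φ q i1 M hiM hun hrec (|β| * q * X ^ (l + 1) / 2) (S * |β| * q ^ 2 * (4 * M) ^ l)
    (by have : 0 < X := by linarith
        positivity) (by positivity) ?_ ?_ ?_
  · have hsplit : ‖∑ i ∈ range M, u i‖ ≤ X + ‖∑ n ∈ Ico i1 M, u n‖ := by
      rw [← sum_range_add_sum_Ico u hiM]
      refine (norm_add_le _ _).trans ?_
      gcongr
      refine (norm_sum_le _ _).trans ((sum_le_sum fun n _ => hun n).trans ?_)
      simpa using hi1X
    have := E1_alg l S |β| δ M q X hS hβ0 hδ hδ1 (by linarith) (by linarith) hX (by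
      have h2 : δ * M ≤ ‖∑ i ∈ range M, u i‖ := hsum
      have : δ * M = 2 * X := by rw [hX]; ring
      linarith)
    linarith
  · intro n hn _
    have h := (hPB (n + 1) q).2.2
    push_cast at h
    have hn' : (i1 : ℝ) ≤ n := by exact_mod_cast hn
    have hXn : X ≤ (n : ℝ) + 1 + q := by linarith
    have h := h (by linarith)
    rw [hφ]; simp only [abs_mul]
    have : X ^ (l + 1) ≤ ((n : ℝ) + 1 + q) ^ (l + 1) := by gcongr
    calc |β| * q * X ^ (l + 1) / 2 ≤ |β| * (q * ((n : ℝ) + 1 + q) ^ (l + 1) / 2) := by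
          rw [mul_assoc, mul_div_assoc]; gcongr
      _ ≤ _ := by gcongr
  · intro n _ hn
    have h := (hPB (n + 1) q).1 (4 * M) (by linarith) (by
      have : n + 1 + q ≤ 4 * M := by omega
      exact_mod_cast this)
    push_cast at h
    rw [hφ]; simp only [abs_mul]
    calc _ ≤ |β| * (S * q * (4 * M) ^ (l + 1)) := by gcongr
      _ = (|β| * (q * (2 * S * 4 ^ (l + 1) * (M : ℝ) ^ (l + 1)))) / 2 := by rw [mul_pow]; ring
      _ ≤ 1 / 2 := by linarith
  · intro n _ hn
    have h := (hPB (n + 1) q).2.1 (4 * M) (by linarith) (by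
      have : n + 1 + 2 * q ≤ 4 * M := by omega
      exact_mod_cast this)
    push_cast at h
    have e1 : φ (n + q) - φ n = β * (((P.eval ((n : ℤ) + 1 + 2 * q) : ℤ) : ℝ) - 2 * ((P.eval ((n : ℤ) + 1 + q) : ℤ) : ℝ) + ((P.eval ((n : ℤ) + 1) : ℤ) : ℝ)) := by
      rw [hφ]; simp only []
      have e1 : (((n + q : ℕ) : ℤ) + 1) = (n : ℤ) + 1 + q := by push_cast; ring
      have e2 : (n : ℤ) + 1 + q + q = (n : ℤ) + 1 + 2 * q := by ring
      rw [e1, e2]; ring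
    rw [e1, abs_mul]
    calc _ ≤ |β| * (S * q ^ 2 * (4 * M) ^ l) := by gcongr
      _ = _ := by ring

end FE

namespace FE
open Finset

lemma fs_eq (N : ℕ) [NeZero N] (P : Polynomial ℤ) (M : ℕ) (ξ : ZMod N) :
    fs N P M ξ = ∑ i ∈ range M, e ((ξ.val : ℝ) / N * (P.eval ((i : ℤ) + 1) : ℤ)) := by
  unfold fs
  rw [sum_Icc_range]
  refine sum_congr rfl fun i _ => ?_
  have h := e_std N ((ξ.val : ℤ) * P.eval ((i : ℤ) + 1))
  push_cast at h
  rw [ZMod.natCast_zmod_val] at h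
  rw [← h]
  congr 1
  ring

lemma count_center (N : ℕ) [NeZero N] (c ρ : ℝ) (hρ : 0 ≤ ρ) :
    ((univ.filter fun ξ : ZMod N => |(ξ.val : ℝ) / N - c| ≤ ρ).card : ℝ) ≤ 2 * (N * ρ) + 1 := by
  have hN : (0 : ℝ) < N := by exact_mod_cast Nat.pos_of_ne_zero (NeZero.ne N)
  have h1 : (univ.filter fun ξ : ZMod N => |(ξ.val : ℝ) / N - c| ≤ ρ).card ≤
      (Icc ⌈N * (c - ρ)⌉ ⌊N * (c + ρ)⌋).card := by
    refine card_le_card_of_injOn (fun ξ => (ξ.val : ℤ)) ?_ ?_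
    · intro ξ hξ
      simp only [coe_filter, mem_univ, true_and, Set.mem_ofPred_eq] at hξ
      rw [abs_le] at hξ
      simp only [coe_Icc, Set.mem_Icc]
      have e1 : (ξ.val : ℝ) = N * ((ξ.val : ℝ) / N) := by field_simp
      constructor
      · rw [Int.ceil_le]
        push_cast
        rw [e1]; gcongr; linarith
      · rw [Int.le_floor]
        push_cast
        rw [e1]; gcongr; linarith
    · intro a _ b _ h
      simp only [Nat.cast_inj] at h
      exact ZMod.val_injective N h
  have h2 : ((Icc ⌈N * (c - ρ)⌉ ⌊N * (c + ρ)⌋).card : ℝ) ≤ 2 * (N * ρ) + 1 := by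
    rw [Int.card_Icc]
    have h3 : (((⌊N * (c + ρ)⌋ + 1 - ⌈N * (c - ρ)⌉).toNat : ℕ) : ℝ) = ((max (⌊N * (c + ρ)⌋ + 1 - ⌈N * (c - ρ)⌉) 0 : ℤ) : ℝ) := by
      rw [← Int.toNat_eq_max]; push_cast; rfl
    rw [h3]
    push_cast
    refine max_le ?_ (by positivity)
    have := Int.floor_le (N * (c + ρ))
    have := Int.le_ceil (N * (c - ρ))
    nlinarith
  exact (by exact_mod_cast h1 : ((univ.filter fun ξ : ZMod N => |(ξ.val : ℝ) / N - c| ≤ ρ).card : ℝ) ≤ _).trans h2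

lemma count_rat (N : ℕ) [NeZero N] (L : Finset (ZMod N)) (Y ρ : ℝ) (hY : 1 ≤ Y) (hρ : 0 ≤ ρ)
    (h : ∀ ξ ∈ L, ∃ (q : ℕ) (a : ℤ), 1 ≤ q ∧ (q : ℝ) ≤ Y ∧ |(ξ.val : ℝ) / N - a / q| * q ≤ 1 ∧
      |(ξ.val : ℝ) / N - a / q| ≤ ρ) :
    (L.card : ℝ) ≤ 4 * Y ^ 2 * (2 * (N * ρ) + 1) := by
  have hN : (0 : ℝ) < N := by exact_mod_cast Nat.pos_of_ne_zero (NeZero.ne N)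
  set y := ⌊Y⌋₊ with hy
  have hyY : (y : ℝ) ≤ Y := Nat.floor_le (by linarith)
  have hy1 : 1 ≤ y := Nat.le_floor (by simpa using hY)
  have hy1r : (1 : ℝ) ≤ y := by exact_mod_cast hy1
  set T := (Icc 1 y) ×ˢ (Icc (-1 : ℤ) (y + 1)) with hT
  have hsub : L ⊆ T.biUnion fun p => univ.filter fun ξ : ZMod N => |(ξ.val : ℝ) / N - (p.2 : ℝ) / (p.1 : ℝ)| ≤ ρ := by
    intro ξ hξ
    obtain ⟨q, a, hq, hqY, h1, h2⟩ := h ξ hξ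
    have hqr : (1 : ℝ) ≤ q := by exact_mod_cast hq
    rw [mem_biUnion]
    refine ⟨(q, a), ?_, by simpa using h2⟩
    have hqy : q ≤ y := Nat.le_floor hqY
    have hv0 : 0 ≤ (ξ.val : ℝ) / N := by positivity
    have hv1 : (ξ.val : ℝ) / N ≤ 1 := by
      rw [div_le_one hN]; exact_mod_cast (ZMod.val_lt ξ).le
    have h3 : |(ξ.val : ℝ) / N * q - a| ≤ 1 := by
      have : (ξ.val : ℝ) / N * q - a = ((ξ.val : ℝ) / N - a / q) * q := by field_simp
      rw [this, abs_mul, abs_of_nonneg (by linarith : (0 : ℝ) ≤ q)]; exact h1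
    rw [abs_le] at h3
    have ha1 : (-1 : ℝ) ≤ a := by nlinarith
    have ha2 : (a : ℝ) ≤ q + 1 := by nlinarith
    have ha1' : -1 ≤ a := by exact_mod_cast ha1
    have ha2' : a ≤ q + 1 := by exact_mod_cast ha2
    rw [hT, mem_product, mem_Icc, mem_Icc]
    refine ⟨⟨hq, hqy⟩, ha1', ?_⟩
    simp only []
    omega
  have hc : (L.card : ℝ) ≤ ∑ p ∈ T, (2 * (N * ρ) + 1) := by
    calc (L.card : ℝ) ≤ ((T.biUnion fun p => univ.filter fun ξ : ZMod N => |(ξ.val : ℝ) / N - (p.2 : ℝ) / (p.1 : ℝ)| ≤ ρ).card : ℝ) := by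
          exact_mod_cast card_le_card hsub
      _ ≤ ((∑ p ∈ T, (univ.filter fun ξ : ZMod N => |(ξ.val : ℝ) / N - (p.2 : ℝ) / (p.1 : ℝ)| ≤ ρ).card : ℕ) : ℝ) := by
          exact_mod_cast card_biUnion_le
      _ ≤ _ := by
          push_cast
          exact sum_le_sum fun p _ => count_center N _ ρ hρ
  have hTc : (T.card : ℝ) ≤ 4 * Y ^ 2 := by
    have : T.card = y * (y + 3) := by
      rw [hT, card_product, Nat.card_Icc, Int.card_Icc]
      congr 1
    rw [this]; push_cast
    nlinarith
  rw [sum_const, nsmul_eq_mul] at hc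
  refine hc.trans ?_
  gcongr

lemma caseC (l s : ℕ) (B : ℝ) (hMV : MV s (l + 2) B) (P : Polynomial ℤ) (hP : P.natDegree ≤ l + 2)
    (hb : P.coeff (l + 2) ≠ 0) : ∃ C : ℝ, 0 < C ∧ ∀ (N : ℕ) [NeZero N] (M : ℕ) (ε δ : ℝ) (_ : 1 ≤ M)
      (_ : 0 < ε) (_ : ε * N ≤ (2 * M) ^ (l + 2)) (_ : 0 < δ),
      ((univ.filter fun ξ : ZMod N => δ * M ≤ ‖fs N P M ξ‖).card : ℝ) * δ ^ (2 * s) ≤ C * (1 + 1 / ε) * M := by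
  set b : ℝ := ((P.coeff (l + 2)).natAbs : ℝ) with hbd
  have hB : 0 ≤ B := by
    have := hMV 1 le_rfl
    simp at this
    exact le_trans (by positivity) this
  refine ⟨(b * (2 * s) + 2 ^ (l + 2) + 1) * (2 * s + 1) ^ (l + 2) * (B + 1), by positivity, ?_⟩
  intro N _ M ε δ hM hε hN hδ
  have hNr : (0 : ℝ) < N := by exact_mod_cast Nat.pos_of_ne_zero (NeZero.ne N)
  have hMr : (1 : ℝ) ≤ M := by exact_mod_cast hM
  set L := univ.filter fun ξ : ZMod N => δ * M ≤ ‖fs N P M ξ‖ with hL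
  have h1 : (L.card : ℝ) * (δ * M) ^ (2 * s) ≤ ∑ ξ : ZMod N, ‖fs N P M ξ‖ ^ (2 * s) := by
    calc (L.card : ℝ) * (δ * M) ^ (2 * s) = ∑ ξ ∈ L, (δ * M) ^ (2 * s) := by simp
      _ ≤ ∑ ξ ∈ L, ‖fs N P M ξ‖ ^ (2 * s) := by
        refine sum_le_sum fun ξ hξ => ?_
        rw [hL, mem_filter] at hξ
        gcongr; exact hξ.2
      _ ≤ _ := sum_le_sum_of_subset_of_nonneg (subset_univ _) fun _ _ _ => by positivity
  have h2 := moment N P s (l + 2) M hP hb hM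
  have h3 := hMV M hM
  set Jr : ℝ := (J s (l + 2) (Icc (1 : ℤ) M) : ℝ) with hJ
  have hJ0 : 0 ≤ Jr := by rw [hJ]; positivity
  have h4 : ∑ ξ : ZMod N, ‖fs N P M ξ‖ ^ (2 * s) ≤ (b * (2 * (s * (M : ℝ) ^ (l + 2))) + N) *
      ((2 * s + 1) ^ (l + 2) * (M : ℝ) ^ ((l + 2) * (l + 1) / 2)) * Jr := by
    refine h2.trans ?_
    push_cast
    rw [← mul_assoc, ← mul_assoc (N : ℝ)]
    have : ((((P.coeff (l + 2)).natAbs * (2 * (s * M ^ (l + 2))) / N : ℕ) : ℝ)) ≤ b * (2 * (s * (M : ℝ) ^ (l + 2))) / N := by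
      refine Nat.cast_div_le.trans ?_
      push_cast; exact le_rfl
    have h5 : (N : ℝ) * ((((P.coeff (l + 2)).natAbs * (2 * (s * M ^ (l + 2))) / N : ℕ) : ℝ) + 1) ≤ b * (2 * (s * (M : ℝ) ^ (l + 2))) + N := by
      calc _ ≤ (N : ℝ) * (b * (2 * (s * (M : ℝ) ^ (l + 2))) / N + 1) := by gcongr
        _ = _ := by field_simp
    gcongr
  have h6 : (N : ℝ) ≤ 2 ^ (l + 2) * M ^ (l + 2) * (1 / ε) := by
    rw [mul_one_div, le_div_iff₀ hε, ← mul_pow]; linarith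
  have h7 : b * (2 * (s * (M : ℝ) ^ (l + 2))) + N ≤ (b * (2 * s) + 2 ^ (l + 2) + 1) * (1 + 1 / ε) * M ^ (l + 2) := by
    have hi : 0 < 1 / ε := by positivity
    have : 0 ≤ b * (2 * s) := by positivity
    have h2l : (0 : ℝ) < 2 ^ (l + 2) := by positivity
    calc _ ≤ b * (2 * (s * (M : ℝ) ^ (l + 2))) + 2 ^ (l + 2) * M ^ (l + 2) * (1 / ε) := by gcongr
      _ = (b * (2 * s) + 2 ^ (l + 2) * (1 / ε)) * M ^ (l + 2) := by ring
      _ ≤ _ := by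
        gcongr
        nlinarith [mul_nonneg this hi.le]
  have h8 : (M : ℝ) ^ (2 * (s : ℝ) + 1 / 2) ≤ M ^ (2 * s) * M := by
    rw [Real.rpow_add (by linarith)]
    have e1 : (M : ℝ) ^ (2 * (s : ℝ)) = M ^ (2 * s) := by
      rw [← Real.rpow_natCast]; push_cast; rfl
    rw [e1]
    gcongr
    calc (M : ℝ) ^ (1 / 2 : ℝ) ≤ (M : ℝ) ^ (1 : ℝ) := Real.rpow_le_rpow_of_exponent_le hMr (by norm_num)
      _ = M := Real.rpow_one _
  have h9 : Jr * (M : ℝ) ^ ((l + 2) * (l + 1) / 2) * M ^ (l + 2) ≤ (B + 1) * (M ^ (2 * s) * M) := by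
    have e1 : (l + 2) * (l + 1) / 2 + (l + 2) = (l + 2) * (l + 2 + 1) / 2 := by
      have : (l + 2) * (l + 2 + 1) = (l + 2) * (l + 1) + (l + 2) * 2 := by ring
      rw [this, Nat.add_mul_div_right _ _ (by norm_num)]
    rw [mul_assoc, ← pow_add, e1]
    refine h3.trans ?_
    gcongr
    linarith
  set D := (b * (2 * s) + 2 ^ (l + 2) + 1) with hD
  have hD0 : 0 ≤ D := by rw [hD]; positivity
  set F := (2 * (s : ℝ) + 1) ^ (l + 2) with hF
  have hF0 : 0 ≤ F := by rw [hF]; positivity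
  set Z := (M : ℝ) ^ ((l + 2) * (l + 1) / 2) with hZ
  have hZ0 : 0 ≤ Z := by rw [hZ]; positivity
  have hε1 : 0 ≤ 1 + 1 / ε := by positivity
  have h10 : (L.card : ℝ) * δ ^ (2 * s) * (M : ℝ) ^ (2 * s) ≤ D * F * (B + 1) * (1 + 1 / ε) * M * M ^ (2 * s) := by
    calc (L.card : ℝ) * δ ^ (2 * s) * (M : ℝ) ^ (2 * s) = (L.card : ℝ) * (δ * M) ^ (2 * s) := by rw [mul_pow]; ring
      _ ≤ _ := h1.trans h4
      _ ≤ (D * (1 + 1 / ε) * M ^ (l + 2)) * (F * Z) * Jr := by gcongr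
      _ = D * (1 + 1 / ε) * F * (Jr * Z * M ^ (l + 2)) := by ring
      _ ≤ D * (1 + 1 / ε) * F * ((B + 1) * (M ^ (2 * s) * M)) := by gcongr
      _ = _ := by ring
  exact le_of_mul_le_mul_right h10 (by positivity)

end FE

namespace FE
open Finset

lemma level_c1 (s l : ℕ) (c δ C Y E C2 M : ℝ) (_hc : 0 ≤ c) (hδ : 0 < δ) (hδ1 : δ ≤ 1) (hC : 0 < C) (hE : 0 ≤ E)
    (hY : Y = C2 / δ ^ (4 * s + 2)) (hM : M ≤ Y) (hC2 : 0 < C2)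
    (h : c * δ ^ (2 * s) ≤ C * E * M) : c * δ ^ (8 * s + 4 + (2 * l + 3)) ≤ C * C2 * E := by
  have h1 : δ ^ (2 * s + 2 + (2 * l + 3)) ≤ 1 := pow_le_one₀ hδ.le hδ1
  have h2 : Y * δ ^ (4 * s + 2) = C2 := by rw [hY]; field_simp
  have hY0 : 0 ≤ Y := by rw [hY]; positivity
  calc c * δ ^ (8 * s + 4 + (2 * l + 3)) = c * δ ^ (2 * s) * δ ^ (4 * s + 2) * δ ^ (2 * s + 2 + (2 * l + 3)) := by ring
    _ ≤ C * E * Y * δ ^ (4 * s + 2) * 1 := by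
      have h3 : c * δ ^ (2 * s) ≤ C * E * Y := h.trans (by gcongr)
      exact mul_le_mul (mul_le_mul_of_nonneg_right h3 (by positivity)) h1 (by positivity) (by positivity)
    _ = C * E * (Y * δ ^ (4 * s + 2)) := by ring
    _ = _ := by rw [h2]; ring

lemma level_c2 (s l : ℕ) (c δ C Y ε C2 M N ρ : ℝ) (hδ : 0 < δ) (hδ1 : δ ≤ 1) (hC : 0 < C) (hε : 0 < ε)
    (hY : Y = C2 / δ ^ (4 * s + 2)) (_hC2 : 0 < C2) (hM : 0 < M) (hN : ε * N ≤ (2 * M) ^ (l + 2))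
    (hρ : ρ = C / (M ^ (l + 2) * δ ^ (2 * l + 3)))
    (h : c ≤ 4 * Y ^ 2 * (2 * (N * ρ) + 1)) :
    c * δ ^ (8 * s + 4 + (2 * l + 3)) ≤ 4 * C2 ^ 2 * (2 * 2 ^ (l + 2) * C + 1) * (1 + 1 / ε) := by
  have h2 : Y * δ ^ (4 * s + 2) = C2 := by rw [hY]; field_simp
  have h6 : N ≤ 2 ^ (l + 2) * M ^ (l + 2) * (1 / ε) := by
    rw [mul_one_div, le_div_iff₀ hε, ← mul_pow]; linarith
  have h3 : N * ρ * δ ^ (2 * l + 3) ≤ 2 ^ (l + 2) * C * (1 / ε) := by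
    calc N * ρ * δ ^ (2 * l + 3) = N * (C / M ^ (l + 2)) := by rw [hρ]; field_simp
      _ ≤ (2 ^ (l + 2) * M ^ (l + 2) * (1 / ε)) * (C / M ^ (l + 2)) := by gcongr
      _ = _ := by field_simp
  have h4 : δ ^ (2 * l + 3) ≤ 1 := pow_le_one₀ hδ.le hδ1
  have h5 : 0 < 2 ^ (l + 2) * C := by positivity
  have h7 : 0 < 1 / ε := by positivity
  calc c * δ ^ (8 * s + 4 + (2 * l + 3)) ≤ 4 * Y ^ 2 * (2 * (N * ρ) + 1) * δ ^ (8 * s + 4 + (2 * l + 3)) := by gcongr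
    _ = 4 * (Y * δ ^ (4 * s + 2)) ^ 2 * (2 * (N * ρ * δ ^ (2 * l + 3)) + δ ^ (2 * l + 3)) := by ring
    _ ≤ 4 * C2 ^ 2 * (2 * (2 ^ (l + 2) * C * (1 / ε)) + 1) := by rw [h2]; gcongr
    _ ≤ _ := by
      rw [mul_assoc (4 * C2 ^ 2)]
      gcongr
      nlinarith

lemma level (l s : ℕ) (B : ℝ) (hMV : MV s (l + 2) B) (P : Polynomial ℤ) (hP : P.natDegree ≤ l + 2)
    (hb : P.coeff (l + 2) ≠ 0) : ∃ C : ℝ, 0 < C ∧ ∀ (N : ℕ) [NeZero N] (M : ℕ) (ε δ : ℝ) (_ : 1 ≤ M)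
      (_ : 0 < ε) (_ : ε * N ≤ (2 * M) ^ (l + 2)) (_ : 0 < δ) (_ : δ ≤ 1),
      ((univ.filter fun ξ : ZMod N => δ * M ≤ ‖fs N P M ξ‖).card : ℝ) * δ ^ (8 * s + 4 + (2 * l + 3)) ≤ C * (1 + 1 / ε) := by
  obtain ⟨CC, hCC, hcase⟩ := caseC l s B hMV P hP hb
  obtain ⟨A, CE, hA, hCE, hE1⟩ := E1 l P hP hb
  set A' := ⌈A⌉₊ with hA'
  have hAA : A ≤ A' := Nat.le_ceil A
  obtain ⟨CB, hCB, hB4⟩ := B4 l s B hMV P hP hb A' (hA.trans hAA)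
  set C2 : ℝ := CB ^ 2 + CE + 1 with hC2
  have hC2p : 0 < C2 := by positivity
  refine ⟨CC * C2 + 4 * C2 ^ 2 * (2 * 2 ^ (l + 2) * CE + 1), by positivity, ?_⟩
  intro N _ M ε δ hM hε hN hδ hδ1
  have hMr : (1 : ℝ) ≤ M := by exact_mod_cast hM
  set L := univ.filter fun ξ : ZMod N => δ * M ≤ ‖fs N P M ξ‖ with hL
  set Y : ℝ := C2 / δ ^ (4 * s + 2) with hY
  have hε1 : 0 < 1 + 1 / ε := by positivity
  have hYC : C2 ≤ Y * δ := by
    rw [hY]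
    have : C2 / δ ^ (4 * s + 2) * δ = C2 / δ ^ (4 * s + 1) := by
      field_simp; ring
    rw [this, le_div_iff₀ (by positivity)]
    have : δ ^ (4 * s + 1) ≤ 1 := pow_le_one₀ hδ.le hδ1
    nlinarith
  have hY1 : 1 ≤ Y := by
    have : 0 < Y := by rw [hY]; positivity
    have : 1 ≤ C2 := by rw [hC2]; nlinarith [sq_nonneg CB]
    nlinarith
  rcases le_or_gt (M : ℝ) Y with hMY | hMY
  · have h1 := hcase N M ε δ hM hε hN hδ
    have h2 := level_c1 s l _ δ CC Y (1 + 1 / ε) C2 M (by positivity) hδ hδ1 hCC hε1.le hY hMY hC2p h1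
    refine h2.trans ?_
    gcongr
    have : 0 ≤ 4 * C2 ^ 2 * (2 * 2 ^ (l + 2) * CE + 1) := by positivity
    linarith
  · set ρ : ℝ := CE / (M ^ (l + 2) * δ ^ (2 * l + 3)) with hρ
    have h1 : (L.card : ℝ) ≤ 4 * Y ^ 2 * (2 * (N * ρ) + 1) := by
      refine count_rat N L Y ρ hY1 (by positivity) ?_
      intro ξ hξ
      rw [hL, mem_filter, fs_eq] at hξ
      replace hξ := hξ.2
      set α : ℝ := (ξ.val : ℝ) / N with hα
      have hA'1 : 1 ≤ A' := by
        have : (1 : ℝ) ≤ A' := hA.trans hAA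
        exact_mod_cast this
      have hQ : 0 < A' * M ^ (l + 1) := by positivity
      obtain ⟨r, hr1, hr2⟩ := Real.exists_rat_abs_sub_le_and_den_le α hQ
      have hq1 : 1 ≤ r.den := r.pos
      have hq1r : (1 : ℝ) ≤ r.den := by exact_mod_cast hq1
      have : NeZero r.den := ⟨by omega⟩
      have hcast : (r : ℝ) = (r.num : ℝ) / r.den := Rat.cast_def r
      rw [hcast] at hr1
      rw [le_div_iff₀ (by positivity)] at hr1
      push_cast at hr1
      have hM1 : (1 : ℝ) ≤ M ^ (l + 1) := one_le_pow₀ hMr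
      have hAr : (1 : ℝ) ≤ A' := by exact_mod_cast hA'1
      set β := |α - (r.num : ℝ) / r.den| with hβ
      have hβ0 : 0 ≤ β := abs_nonneg _
      have g1 : β * (r.den * (A * (M : ℝ) ^ (l + 1))) ≤ 1 := by
        refine le_trans ?_ hr1
        rw [mul_comm (r.den : ℝ)]
        gcongr
        have : A * (M : ℝ) ^ (l + 1) ≤ A' * (M : ℝ) ^ (l + 1) := by gcongr
        linarith
      have g2 : β * (r.den * (M : ℝ) ^ (l + 1)) ≤ 1 := by
        refine le_trans ?_ g1
        have : (M : ℝ) ^ (l + 1) ≤ A * (M : ℝ) ^ (l + 1) := by nlinarith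
        gcongr
      have g3 : β * r.den ≤ 1 := by
        refine le_trans ?_ g2
        gcongr
        nlinarith
      have hcop : IsCoprime r.num (r.den : ℤ) := by
        rw [Int.isCoprime_iff_gcd_eq_one]
        exact r.reduced
      have hb4 := hB4 r.den M hM r.num hcop α (by exact_mod_cast hr2) g2 δ hδ hδ1 hξ
      have hmin : ((min M r.den : ℕ) : ℝ) ≤ Y := by
        rw [hY, le_div_iff₀ (by positivity)]
        have e1 : (δ ^ (2 * s + 1) * Real.sqrt (min M r.den : ℕ)) ^ 2 ≤ CB ^ 2 := by gcongr
        rw [mul_pow, Real.sq_sqrt (by positivity), ← pow_mul] at e1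
        have e2 : (2 * s + 1) * 2 = 4 * s + 2 := by ring
        rw [e2] at e1
        rw [hC2]; linarith
      have hqY : (r.den : ℝ) ≤ Y := by
        rcases le_total M r.den with hh | hh
        · rw [min_eq_left hh] at hmin; linarith
        · rwa [min_eq_right hh] at hmin
      have hqM : r.den ≤ M := by
        have : (r.den : ℝ) ≤ M := by linarith
        exact_mod_cast this
      refine ⟨r.den, r.num, hq1, hqY, g3, ?_⟩
      have := hE1 r.den M hq1 hqM r.num α δ g1 hδ hδ1 (by
        have : Y * δ ≤ M * δ := by gcongr
        nlinarith [sq_nonneg CB]) hξ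
      rw [hρ, le_div_iff₀ (by positivity)]
      linarith
    have h2 := level_c2 s l _ δ CE Y ε C2 M N ρ hδ hδ1 hCE hε hY hC2p (by linarith) hN hρ h1
    refine h2.trans ?_
    gcongr
    have : 0 ≤ CC * C2 := by positivity
    linarith

end FE

namespace FE
open Finset

lemma dft_eq (N : ℕ) [NeZero N] (h : ZMod N → ℂ) (ξ : ZMod N) :
    dft N h ξ = (1 / (N : ℂ)) * ∑ x : ZMod N, h x * ZMod.stdAddChar (-(x * ξ)) := by
  unfold dft
  congr 1
  refine sum_congr rfl fun x _ => ?_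
  congr 1
  have h := e_std N (-((x.val : ℤ) * ξ.val))
  push_cast at h
  rw [ZMod.natCast_zmod_val, ZMod.natCast_zmod_val] at h
  rw [← h]
  unfold e
  congr 1
  push_cast
  ring

lemma orth (N : ℕ) [NeZero N] (t : ZMod N) :
    ∑ ξ : ZMod N, (ZMod.stdAddChar (ξ * t) : ℂ) = if t = 0 then (N : ℂ) else 0 := by
  have := AddChar.sum_mulShift t (ZMod.isPrimitive_stdAddChar N)
  rw [this, ZMod.card]
  push_cast
  rfl

lemma conj_std (N : ℕ) [NeZero N] (t : ZMod N) :
    (starRingEnd ℂ) (ZMod.stdAddChar t) = ZMod.stdAddChar (-t) := by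
  rw [AddChar.map_neg_eq_conj]

/-- autocorrelation -/
noncomputable def Ac (N : ℕ) [NeZero N] (h : ZMod N → ℂ) (m : ZMod N) : ℂ :=
  (1 / (N : ℂ)) * ∑ x : ZMod N, h (x + m) * (starRingEnd ℂ) (h x)

lemma Ac_eq (N : ℕ) [NeZero N] (h : ZMod N → ℂ) (m : ZMod N) :
    ∑ ξ : ZMod N, ((‖dft N h ξ‖ ^ 2 : ℝ) : ℂ) * ZMod.stdAddChar (ξ * m) = Ac N h m := by
  have hN : (N : ℂ) ≠ 0 := by exact_mod_cast NeZero.ne N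
  have h1 : ∀ ξ : ZMod N, ((‖dft N h ξ‖ ^ 2 : ℝ) : ℂ) * ZMod.stdAddChar (ξ * m) =
      (1 / (N : ℂ)) ^ 2 * ∑ x : ZMod N, ∑ y : ZMod N, h x * (starRingEnd ℂ) (h y) * ZMod.stdAddChar (ξ * (m - x + y)) := by
    intro ξ
    have : ((‖dft N h ξ‖ ^ 2 : ℝ) : ℂ) = dft N h ξ * (starRingEnd ℂ) (dft N h ξ) := by
      rw [Complex.mul_conj, Complex.normSq_eq_norm_sq]
    rw [this, dft_eq, map_mul, map_sum]
    have e0 : (starRingEnd ℂ) (1 / (N : ℂ)) = 1 / (N : ℂ) := by simp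
    rw [e0, mul_mul_mul_comm, sum_mul_sum, ← sq, mul_assoc, sum_mul]
    congr 1
    refine sum_congr rfl fun x _ => ?_
    rw [sum_mul]
    refine sum_congr rfl fun y _ => ?_
    rw [map_mul, conj_std]
    have : ξ * (m - x + y) = -(x * ξ) + -(-(y * ξ)) + ξ * m := by ring
    rw [this, AddChar.map_add_eq_mul, AddChar.map_add_eq_mul]
    ring
  simp_rw [h1]
  rw [← mul_sum, sum_comm]
  have h2 : ∀ x : ZMod N, ∑ ξ : ZMod N, ∑ y : ZMod N, h x * (starRingEnd ℂ) (h y) * ZMod.stdAddChar (ξ * (m - x + y)) =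
      N * (h x * (starRingEnd ℂ) (h (x - m))) := by
    intro x
    rw [sum_comm]
    simp_rw [← mul_sum, orth]
    rw [sum_eq_single (x - m)]
    · simp; ring
    · intro y _ hy
      rw [if_neg]
      · simp
      · intro h0
        apply hy
        linear_combination h0
    · simp
  simp_rw [h2]
  unfold Ac
  rw [← mul_sum, ← mul_assoc]
  have e1 : (1 / (N : ℂ)) ^ 2 * N = 1 / N := by field_simp
  rw [e1]
  congr 1
  exact (Fintype.sum_equiv (Equiv.addRight m) _ _ (fun x => by simp)).symm

lemma sum_a (N : ℕ) [NeZero N] (h : ZMod N → ℂ) :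
    ∑ ξ : ZMod N, ‖dft N h ξ‖ ^ 2 = (1 / (N : ℝ)) * ∑ x : ZMod N, ‖h x‖ ^ 2 := by
  have := Ac_eq N h 0
  simp only [mul_zero, AddChar.map_zero_eq_one, mul_one] at this
  unfold Ac at this
  simp only [add_zero, Complex.mul_conj, Complex.normSq_eq_norm_sq] at this
  apply Complex.ofReal_injective
  push_cast
  push_cast at this
  exact this

lemma step1 (N : ℕ) [NeZero N] (g h : ZMod N → ℂ) (hg : (1 / (N : ℝ)) * ∑ x : ZMod N, ‖g x‖ ^ 2 ≤ 1)
    (p : ℕ → ZMod N) (S : Finset ℕ) (τ : ℝ) (hτ : 0 ≤ τ)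
    (hS : ∀ n ∈ S, τ ≤ ‖(1 / (N : ℂ)) * ∑ x : ZMod N, h x * g (x - p n)‖) :
    (τ * S.card) ^ 2 ≤ ∑ n ∈ S, ∑ n' ∈ S, ‖Ac N h (p n - p n')‖ := by
  have hN : (0 : ℝ) < N := by exact_mod_cast Nat.pos_of_ne_zero (NeZero.ne N)
  have hNc : (N : ℂ) ≠ 0 := by exact_mod_cast NeZero.ne N
  set T : ℕ → ℂ := fun n => (1 / (N : ℂ)) * ∑ x : ZMod N, h x * g (x - p n) with hT
  have hθ : ∀ n, ∃ θ : ℂ, ‖θ‖ ≤ 1 ∧ θ * T n = (‖T n‖ : ℂ) := by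
    intro n
    rcases eq_or_ne (T n) 0 with h0 | h0
    · exact ⟨0, by simp, by simp [h0]⟩
    · have hn : (‖T n‖ : ℂ) ≠ 0 := by simpa using h0
      refine ⟨(starRingEnd ℂ) (T n) / ‖T n‖, ?_, ?_⟩
      · simp [h0]
      · rw [div_mul_eq_mul_div, mul_comm, Complex.mul_conj, Complex.normSq_eq_norm_sq]
        push_cast
        field_simp
  choose θ hθ1 hθ2 using hθ
  set F : ZMod N → ℂ := fun x => ∑ n ∈ S, θ n * h (x + p n) with hF
  have hT2 : ∀ n, T n = (1 / (N : ℂ)) * ∑ x : ZMod N, h (x + p n) * g x := by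
    intro n
    rw [hT]
    simp only []
    congr 1
    exact (Fintype.sum_equiv (Equiv.addRight (p n)) _ _ (fun x => by simp)).symm
  have h1 : ((∑ n ∈ S, ‖T n‖ : ℝ) : ℂ) = (1 / (N : ℂ)) * ∑ x : ZMod N, F x * g x := by
    push_cast
    simp_rw [← hθ2, hT2, hF, sum_mul]
    rw [sum_comm, mul_sum]
    refine sum_congr rfl fun n _ => ?_
    rw [mul_left_comm, mul_sum]
    congr 1
    refine sum_congr rfl fun x _ => ?_
    ring
  have h2 : τ * S.card ≤ (1 / (N : ℝ)) * ∑ x : ZMod N, ‖F x‖ * ‖g x‖ := by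
    calc τ * S.card = ∑ n ∈ S, τ := by simp [mul_comm]
      _ ≤ ∑ n ∈ S, ‖T n‖ := sum_le_sum hS
      _ = ‖((∑ n ∈ S, ‖T n‖ : ℝ) : ℂ)‖ := by
        rw [Complex.norm_real, Real.norm_of_nonneg (sum_nonneg fun _ _ => norm_nonneg _)]
      _ ≤ _ := by
        rw [h1, norm_mul]
        have : ‖(1 / (N : ℂ))‖ = 1 / N := by simp
        rw [this]
        gcongr
        refine (norm_sum_le _ _).trans (sum_le_sum fun x _ => ?_)
        rw [norm_mul]
  have h3 : (τ * S.card) ^ 2 ≤ (1 / (N : ℝ)) * ∑ x : ZMod N, ‖F x‖ ^ 2 := by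
    have hcs := sum_mul_sq_le_sq_mul_sq (univ : Finset (ZMod N)) (fun x => ‖F x‖) (fun x => ‖g x‖)
    have hF0 : 0 ≤ ∑ x : ZMod N, ‖F x‖ ^ 2 := sum_nonneg fun _ _ => by positivity
    calc (τ * S.card) ^ 2 ≤ ((1 / (N : ℝ)) * ∑ x : ZMod N, ‖F x‖ * ‖g x‖) ^ 2 := by gcongr
      _ = (1 / (N : ℝ)) ^ 2 * (∑ x : ZMod N, ‖F x‖ * ‖g x‖) ^ 2 := by rw [mul_pow]
      _ ≤ (1 / (N : ℝ)) ^ 2 * ((∑ x : ZMod N, ‖F x‖ ^ 2) * ∑ x : ZMod N, ‖g x‖ ^ 2) := by gcongr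
      _ = (1 / (N : ℝ)) * (∑ x : ZMod N, ‖F x‖ ^ 2) * ((1 / (N : ℝ)) * ∑ x : ZMod N, ‖g x‖ ^ 2) := by ring
      _ ≤ (1 / (N : ℝ)) * (∑ x : ZMod N, ‖F x‖ ^ 2) * 1 := by gcongr
      _ = _ := by ring
  refine h3.trans ?_
  have h4 : (((1 / (N : ℝ)) * ∑ x : ZMod N, ‖F x‖ ^ 2 : ℝ) : ℂ) =
      ∑ n ∈ S, ∑ n' ∈ S, θ n * (starRingEnd ℂ) (θ n') * Ac N h (p n - p n') := by
    have e1 : ∀ x, (((‖F x‖ ^ 2 : ℝ)) : ℂ) = ∑ n ∈ S, ∑ n' ∈ S, θ n * (starRingEnd ℂ) (θ n') * (h (x + p n) * (starRingEnd ℂ) (h (x + p n'))) := by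
      intro x
      have : ((‖F x‖ ^ 2 : ℝ) : ℂ) = F x * (starRingEnd ℂ) (F x) := by
        rw [Complex.mul_conj, Complex.normSq_eq_norm_sq]
      rw [this, hF]
      simp only []
      rw [map_sum, sum_mul_sum]
      refine sum_congr rfl fun n _ => sum_congr rfl fun n' _ => ?_
      rw [map_mul]; ring
    rw [Complex.ofReal_mul, Complex.ofReal_sum]
    simp_rw [e1]
    rw [sum_comm, mul_sum]
    refine sum_congr rfl fun n _ => ?_
    rw [sum_comm, mul_sum]
    refine sum_congr rfl fun n' _ => ?_
    rw [← mul_sum, mul_left_comm]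
    congr 1
    unfold Ac
    push_cast
    congr 1
    refine Fintype.sum_equiv (Equiv.addRight (p n')) _ _ (fun x => ?_)
    simp
  have h5 : (1 / (N : ℝ)) * ∑ x : ZMod N, ‖F x‖ ^ 2 = ‖(((1 / (N : ℝ)) * ∑ x : ZMod N, ‖F x‖ ^ 2 : ℝ) : ℂ)‖ := by
    rw [Complex.norm_real, Real.norm_of_nonneg (by positivity)]
  rw [h5, h4]
  refine (norm_sum_le _ _).trans (sum_le_sum fun n _ => ?_)
  refine (norm_sum_le _ _).trans (sum_le_sum fun n' _ => ?_)
  rw [norm_mul, norm_mul, Complex.norm_conj]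
  have : ‖θ n‖ * ‖θ n'‖ ≤ 1 := by
    have := hθ1 n; have := hθ1 n'
    exact mul_le_one₀ (hθ1 n) (norm_nonneg _) (hθ1 n')
  nlinarith [norm_nonneg (Ac N h (p n - p n'))]

lemma step2 (N : ℕ) [NeZero N] (h : ZMod N → ℂ) (p : ℕ → ZMod N) (R : Finset ℕ) :
    ∑ n ∈ R, ∑ n' ∈ R, ‖Ac N h (p n - p n')‖ ^ 2 =
      ∑ ζ : ZMod N, ‖dft N h ζ‖ ^ 2 * ∑ ξ : ZMod N, ‖dft N h ξ‖ ^ 2 *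
        ‖∑ n ∈ R, (ZMod.stdAddChar ((ξ - ζ) * p n) : ℂ)‖ ^ 2 := by
  have key : ∀ (z : ℂ), ((‖z‖ ^ 2 : ℝ) : ℂ) = z * (starRingEnd ℂ) z := fun z => by
    rw [Complex.mul_conj, Complex.normSq_eq_norm_sq]
  set a : ZMod N → ℂ := fun ξ => ((‖dft N h ξ‖ ^ 2 : ℝ) : ℂ) with ha
  have hac : ∀ ξ, (starRingEnd ℂ) (a ξ) = a ξ := fun ξ => by rw [ha]; exact Complex.conj_ofReal _
  have h1 : ∀ m, ((‖Ac N h m‖ ^ 2 : ℝ) : ℂ) = ∑ ζ : ZMod N, ∑ ξ : ZMod N, a ζ * (a ξ * ZMod.stdAddChar ((ξ - ζ) * m)) := by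
    intro m
    rw [key, ← Ac_eq, map_sum, sum_mul_sum, sum_comm]
    refine sum_congr rfl fun ζ _ => sum_congr rfl fun ξ _ => ?_
    rw [map_mul (starRingEnd ℂ), conj_std]
    have : (ξ - ζ) * m = ξ * m + -(ζ * m) := by ring
    rw [this, AddChar.map_add_eq_mul]
    have := hac ζ
    rw [ha] at this ⊢
    simp only [] at this ⊢
    rw [this]; ring
  have h2 : ∀ t : ZMod N, ((‖∑ n ∈ R, (ZMod.stdAddChar (t * p n) : ℂ)‖ ^ 2 : ℝ) : ℂ) =
      ∑ n ∈ R, ∑ n' ∈ R, (ZMod.stdAddChar (t * (p n - p n')) : ℂ) := by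
    intro t
    rw [key, map_sum, sum_mul_sum]
    refine sum_congr rfl fun n _ => sum_congr rfl fun n' _ => ?_
    rw [conj_std, ← AddChar.map_add_eq_mul]
    congr 1; ring
  apply Complex.ofReal_injective
  rw [Complex.ofReal_sum, Complex.ofReal_sum]
  simp_rw [Complex.ofReal_mul, Complex.ofReal_sum, Complex.ofReal_mul, h1, h2]
  simp_rw [mul_sum]
  have h3 : ∀ n ∈ R, ∑ n' ∈ R, ∑ ζ : ZMod N, ∑ ξ : ZMod N, a ζ * (a ξ * (ZMod.stdAddChar ((ξ - ζ) * (p n - p n')) : ℂ)) =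
      ∑ ζ : ZMod N, ∑ ξ : ZMod N, ∑ n' ∈ R, a ζ * (a ξ * (ZMod.stdAddChar ((ξ - ζ) * (p n - p n')) : ℂ)) := by
    intro n _
    rw [sum_comm]
    exact sum_congr rfl fun ζ _ => sum_comm
  rw [sum_congr rfl h3, sum_comm]
  refine sum_congr rfl fun ζ _ => ?_
  rw [sum_comm]

lemma TT (N : ℕ) [NeZero N] (g h : ZMod N → ℂ) (hg : (1 / (N : ℝ)) * ∑ x : ZMod N, ‖g x‖ ^ 2 ≤ 1)
    (hh : (1 / (N : ℝ)) * ∑ x : ZMod N, ‖h x‖ ^ 2 ≤ 1) (η : ℝ) (hη : ∀ ξ, ‖dft N h ξ‖ ≤ η)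
    (p : ℕ → ZMod N) (R S : Finset ℕ) (hSR : S ⊆ R) (τ : ℝ) (hτ : 0 ≤ τ)
    (hS : ∀ n ∈ S, τ ≤ ‖(1 / (N : ℂ)) * ∑ x : ZMod N, h x * g (x - p n)‖) (σ : ℝ) (hσ : 0 ≤ σ) :
    τ ^ 4 * (S.card : ℝ) ^ 2 ≤ (R.card : ℝ) ^ 2 * (((univ.filter fun ξ : ZMod N => σ * R.card ≤
      ‖∑ n ∈ R, (ZMod.stdAddChar (ξ * p n) : ℂ)‖).card : ℝ) * η ^ 2 + σ ^ 2) := by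
  set f : ZMod N → ℝ := fun ξ => ‖∑ n ∈ R, (ZMod.stdAddChar (ξ * p n) : ℂ)‖ with hf
  set L := univ.filter fun ξ : ZMod N => σ * R.card ≤ f ξ with hL
  have h1 := step1 N g h hg p S τ hτ hS
  have hsa : ∑ ξ : ZMod N, ‖dft N h ξ‖ ^ 2 ≤ 1 := by rw [sum_a]; exact hh
  have hf0 : ∀ ξ, 0 ≤ f ξ := fun ξ => norm_nonneg _
  have hfM : ∀ ξ, f ξ ≤ R.card := by
    intro ξ
    refine (norm_sum_le _ _).trans ?_
    simp
  have h2 : (τ * S.card) ^ 4 ≤ (S.card : ℝ) ^ 2 * ∑ n ∈ R, ∑ n' ∈ R, ‖Ac N h (p n - p n')‖ ^ 2 := by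
    calc (τ * S.card) ^ 4 = ((τ * S.card) ^ 2) ^ 2 := by ring
      _ ≤ (∑ n ∈ S, ∑ n' ∈ S, ‖Ac N h (p n - p n')‖) ^ 2 := by gcongr
      _ = (∑ x ∈ S ×ˢ S, ‖Ac N h (p x.1 - p x.2)‖) ^ 2 := by rw [sum_product]
      _ ≤ ((S ×ˢ S).card : ℝ) * ∑ x ∈ S ×ˢ S, ‖Ac N h (p x.1 - p x.2)‖ ^ 2 := sq_sum_le_card_mul_sum_sq
      _ ≤ (S.card : ℝ) ^ 2 * ∑ x ∈ R ×ˢ R, ‖Ac N h (p x.1 - p x.2)‖ ^ 2 := by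
        rw [card_product]
        push_cast
        rw [← sq]
        gcongr
      _ = _ := by rw [sum_product]
  rw [step2] at h2
  have h3 : ∀ ζ : ZMod N, ∑ ξ : ZMod N, ‖dft N h ξ‖ ^ 2 * f (ξ - ζ) ^ 2 ≤ (R.card : ℝ) ^ 2 * (L.card * η ^ 2 + σ ^ 2) := by
    intro ζ
    have hpt : ∀ ξ : ZMod N, ‖dft N h ξ‖ ^ 2 * f (ξ - ζ) ^ 2 ≤ (if ξ - ζ ∈ L then η ^ 2 * (R.card : ℝ) ^ 2 else 0) +
        ‖dft N h ξ‖ ^ 2 * (σ * R.card) ^ 2 := by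
      intro ξ
      have hd0 := norm_nonneg (dft N h ξ)
      split_ifs with hc
      · have : ‖dft N h ξ‖ ^ 2 * f (ξ - ζ) ^ 2 ≤ η ^ 2 * (R.card : ℝ) ^ 2 := by
          gcongr
          · exact hη ξ
          · exact hfM _
        have : 0 ≤ ‖dft N h ξ‖ ^ 2 * (σ * R.card) ^ 2 := by positivity
        linarith
      · rw [zero_add]
        rw [hL, mem_filter] at hc
        simp only [mem_univ, true_and, not_le] at hc
        gcongr
    refine (sum_le_sum fun ξ _ => hpt ξ).trans ?_
    rw [sum_add_distrib, ← sum_mul]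
    have e1 : ∑ ξ : ZMod N, (if ξ - ζ ∈ L then η ^ 2 * (R.card : ℝ) ^ 2 else 0) = L.card * (η ^ 2 * (R.card : ℝ) ^ 2) := by
      rw [Fintype.sum_equiv (Equiv.subRight ζ) _ (fun ξ => if ξ ∈ L then η ^ 2 * (R.card : ℝ) ^ 2 else 0) (fun x => by simp)]
      rw [sum_ite_mem, univ_inter, sum_const, nsmul_eq_mul]
    rw [e1]
    have : (∑ ξ : ZMod N, ‖dft N h ξ‖ ^ 2) * (σ * R.card) ^ 2 ≤ 1 * (σ * R.card) ^ 2 := by gcongr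
    nlinarith
  set Q : ℝ := (R.card : ℝ) ^ 2 * (L.card * η ^ 2 + σ ^ 2) with hQ
  have hQ0 : 0 ≤ Q := by positivity
  have h4 : (τ * S.card) ^ 4 ≤ (S.card : ℝ) ^ 2 * Q := by
    refine h2.trans ?_
    gcongr
    calc _ ≤ ∑ ζ : ZMod N, ‖dft N h ζ‖ ^ 2 * Q := by
          refine sum_le_sum fun ζ _ => ?_
          gcongr
          exact h3 ζ
      _ = (∑ ζ : ZMod N, ‖dft N h ζ‖ ^ 2) * Q := by rw [sum_mul]
      _ ≤ 1 * Q := by gcongr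
      _ = Q := one_mul _
  rcases Nat.eq_zero_or_pos S.card with h0 | h0
  · rw [h0]; simpa using hQ0
  · have h0' : (0 : ℝ) < (S.card : ℝ) ^ 2 := by positivity
    refine le_of_mul_le_mul_left ?_ h0'
    calc _ = (τ * S.card) ^ 4 := by ring
      _ ≤ _ := h4

end FE

namespace FE
open Finset

lemma fs_nat (N : ℕ) [NeZero N] (P : Polynomial ℤ) (M : ℕ) (ξ : ZMod N) :
    ∑ n ∈ Icc 1 M, (ZMod.stdAddChar (ξ * ((P.eval (n : ℤ) : ℤ) : ZMod N)) : ℂ) = fs N P M ξ := by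
  unfold fs
  refine sum_bij (fun n _ => (n : ℤ)) ?_ ?_ ?_ ?_
  · intro n hn
    rw [mem_Icc] at hn ⊢; omega
  · intro a _ b _ h
    exact_mod_cast h
  · intro z hz
    rw [mem_Icc] at hz
    refine ⟨z.toNat, ?_, ?_⟩
    · rw [mem_Icc]; omega
    · omega
  · intro n _; rfl

lemma final_alg (D K : ℕ) (C L η ε τ S M : ℝ) (hC : 0 < C) (hη : 0 < η) (hη1 : η ≤ 1) (hηε : η ≤ ε)
    (hτ : 0 < τ) (hτ1 : τ ≤ 1) (hτK : τ ^ K = η) (hK : 3 * D + 6 ≤ K) (hM : 0 ≤ M)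
    (h1 : L * (τ ^ 3) ^ D ≤ C * (1 + 1 / ε))
    (h2 : τ ^ 4 * S ^ 2 ≤ M ^ 2 * (L * η ^ 2 + (τ ^ 3) ^ 2)) :
    S ≤ (2 * C + 1) * τ * M := by
  have hε : 0 < ε := lt_of_lt_of_le hη hηε
  have h3 : (1 + 1 / ε) * η ≤ 2 := by
    have : 1 / ε * η ≤ 1 := by
      rw [one_div_mul_eq_div, div_le_one hε]; exact hηε
    linarith
  have h4 : L * η ^ 2 * (τ ^ 3) ^ D ≤ 2 * C * τ ^ 6 * (τ ^ 3) ^ D := by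
    calc L * η ^ 2 * (τ ^ 3) ^ D = L * (τ ^ 3) ^ D * η ^ 2 := by ring
      _ ≤ C * (1 + 1 / ε) * η ^ 2 := by gcongr
      _ = C * ((1 + 1 / ε) * η) * η := by ring
      _ ≤ C * 2 * η := by gcongr
      _ = C * 2 * τ ^ K := by rw [hτK]
      _ ≤ C * 2 * τ ^ (3 * D + 6) := by
        have := pow_le_pow_of_le_one hτ.le hτ1 hK
        gcongr C * 2 * ?_
      _ = _ := by rw [pow_add, pow_mul]; ring
  have h5 : L * η ^ 2 ≤ 2 * C * τ ^ 6 := le_of_mul_le_mul_right h4 (by positivity)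
  have h6 : τ ^ 4 * S ^ 2 ≤ τ ^ 4 * ((2 * C + 1) * (τ * M) ^ 2) := by
    calc _ ≤ _ := h2
      _ ≤ M ^ 2 * (2 * C * τ ^ 6 + (τ ^ 3) ^ 2) := by gcongr
      _ = _ := by ring
  have h7 : S ^ 2 ≤ (2 * C + 1) * (τ * M) ^ 2 := le_of_mul_le_mul_left h6 (by positivity)
  refine le_of_sq_le_sq ?_ (by positivity)
  calc S ^ 2 ≤ _ := h7
    _ ≤ (2 * C + 1) ^ 2 * (τ * M) ^ 2 := by
      gcongr
      nlinarith
    _ = _ := by ring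

lemma K_bound (k s K : ℕ) (hk : 2 ≤ k) (hs : (s : ℝ) ≤ 10 * (k : ℝ) ^ 2 * Real.log k)
    (hK : (K : ℝ) ≥ 300 * (k : ℝ) ^ 2 * Real.log k) : 3 * (8 * s + 4 + (2 * k - 1)) + 6 ≤ K := by
  have hk2 : (2 : ℝ) ≤ k := by exact_mod_cast hk
  have h1 := Real.log_two_gt_d9
  have h2 : Real.log 2 ≤ Real.log k := Real.log_le_log (by norm_num) hk2
  have h3 : 0.69 * (k : ℝ) ^ 2 ≤ (k : ℝ) ^ 2 * Real.log k := by
    have : 0.69 ≤ Real.log k := by linarith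
    nlinarith [sq_nonneg (k : ℝ)]
  have h4 : ((3 * (8 * s + 4 + 2 * k) + 6 : ℕ) : ℝ) ≤ K := by
    push_cast
    nlinarith
  have : 3 * (8 * s + 4 + 2 * k) + 6 ≤ K := by exact_mod_cast h4
  omega

end FE

theorem fourier_error_term_estimate :
    ∃ C : ℝ, 0 < C ∧ ∀ (P : Polynomial ℤ) (k : ℕ), P.natDegree = k → 2 ≤ k →
      P.eval 0 = 0 →
      ∃ c C₁ : ℝ, 0 < c ∧ 0 < C₁ ∧
        ∀ (ε : ℝ), 0 < ε → ∀ (N : ℕ) [NeZero N], ∀ g h : ZMod N → ℂ,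
        (1 / (N : ℝ)) * ∑ x : ZMod N, ‖g x‖ ^ 2 ≤ 1 →
        (1 / (N : ℝ)) * ∑ x : ZMod N, ‖h x‖ ^ 2 ≤ 1 →
        ∀ η : ℝ, 0 < η → η ≤ ε → (∀ ξ : ZMod N, ‖dft N h ξ‖ ≤ η) →
        ∀ K : ℕ, (K : ℝ) ≥ C * (k : ℝ) ^ 2 * Real.log k →
        (((Finset.Icc 1 ⌊c * (ε * N) ^ (1 / (k : ℝ))⌋₊).filter fun n : ℕ =>
            η ^ (1 / (K : ℝ)) ≤
              ‖(1 / (N : ℂ)) * ∑ x : ZMod N,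
                  h x * g (x - (((P.eval (n : ℤ) : ℤ) : ZMod N)))‖).card : ℝ)
          ≤ C₁ * η ^ (1 / (K : ℝ)) * (c * (ε * N) ^ (1 / (k : ℝ))) := by
  refine ⟨300, by norm_num, ?_⟩
  intro P k hPk hk _
  obtain ⟨l, rfl⟩ : ∃ l, k = l + 2 := ⟨k - 2, by omega⟩
  obtain ⟨s, _, hs, B, _, hMV⟩ := FE.mvt (l + 2) hk
  have hb : P.coeff (l + 2) ≠ 0 := by
    rw [← hPk]
    intro h0
    have : P = 0 := Polynomial.leadingCoeff_eq_zero.mp h0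
    rw [this] at hPk
    simp at hPk
  obtain ⟨C, hC, hlev⟩ := FE.level l s B hMV P hPk.le hb
  refine ⟨1, 2 * C + 1, one_pos, by positivity, ?_⟩
  intro ε hε N _ g h hg hh η hη hηε hdft K hK
  have hNr : (0 : ℝ) < N := by exact_mod_cast Nat.pos_of_ne_zero (NeZero.ne N)
  rw [one_mul]
  set X : ℝ := (ε * N) ^ (1 / ((l + 2 : ℕ) : ℝ)) with hX
  have hX0 : 0 < X := by rw [hX]; positivity
  have hXk : X ^ (l + 2) = ε * N := by
    rw [hX, one_div]
    exact Real.rpow_inv_natCast_pow (by positivity) (by omega)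
  set M := ⌊X⌋₊ with hM
  have hMX : (M : ℝ) ≤ X := Nat.floor_le hX0.le
  have hKD := FE.K_bound (l + 2) s K hk hs hK
  have hK0 : K ≠ 0 := by omega
  set τ : ℝ := η ^ (1 / (K : ℝ)) with hτ
  have hτ0 : 0 < τ := by rw [hτ]; positivity
  have hτK : τ ^ K = η := by
    rw [hτ, one_div]
    exact Real.rpow_inv_natCast_pow hη.le hK0
  set S := (Finset.Icc 1 M).filter fun n : ℕ =>
            τ ≤ ‖(1 / (N : ℂ)) * ∑ x : ZMod N, h x * g (x - (((P.eval (n : ℤ) : ℤ) : ZMod N)))‖ with hS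
  have hSM : (S.card : ℝ) ≤ M := by
    have : S.card ≤ (Finset.Icc 1 M).card := Finset.card_le_card (Finset.filter_subset _ _)
    rw [Nat.card_Icc] at this
    exact_mod_cast this
  rcases le_or_gt η 1 with hη1 | hη1
  · have hτ1 : τ ≤ 1 := Real.rpow_le_one hη.le hη1 (by positivity)
    rcases Nat.eq_zero_or_pos M with hM0 | hM0
    · rw [hM0] at hSM
      have : 0 ≤ (2 * C + 1) * τ * X := by positivity
      simp only [Nat.cast_zero] at hSM
      linarith
    have hM1 : (1 : ℝ) ≤ M := by exact_mod_cast hM0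
    have hN2 : ε * N ≤ (2 * M) ^ (l + 2) := by
      rw [← hXk]
      have : X < M + 1 := Nat.lt_floor_add_one X
      have : X ≤ 2 * M := by linarith
      gcongr
    have h1 := hlev N M ε (τ ^ 3) hM0 hε hN2 (by positivity) (pow_le_one₀ hτ0.le hτ1)
    have h2 := FE.TT N g h hg hh η hdft (fun n => ((P.eval (n : ℤ) : ℤ) : ZMod N)) (Finset.Icc 1 M) S
      (Finset.filter_subset _ _) τ hτ0.le (fun n hn => (Finset.mem_filter.mp hn).2) (τ ^ 3) (by positivity)
    simp only [FE.fs_nat, Nat.card_Icc, Nat.add_sub_cancel] at h2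
    have h3 := FE.final_alg _ K C _ η ε τ S.card M hC hη hη1 hηε hτ0 hτ1 hτK (by omega) (by positivity) h1 h2
    refine h3.trans ?_
    gcongr
  · have hτ1 : 1 ≤ τ := Real.one_le_rpow hη1.le (by positivity)
    calc (S.card : ℝ) ≤ 1 * X := by linarith
      _ ≤ (2 * C + 1) * τ * X := by
        gcongr
        nlinarith
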